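/- arXiv:1903.08304 — 4 statements merged into one kernel-verified Lean document; each statement's English description precedes it below -/
import Mathlib

section
/- (Szegő Strong Limit Theorem) Let L : 𝕋 → ℝ be integrable on the unit circle 𝕋 with Fourier coefficients L_k = (1/2π)∫₀^{2π} L(e^{iθ}) e^{−ikθ} dθ satisfying ∑_{k=1}^∞ k|L_k|² < ∞, and let φ = e^L > 0 with φ ∈ L¹(𝕋), with Fourier coefficients φ_k = (1/2π)∫₀^{2π} φ(e^{iθ}) e^{−ikθ} dθ. Let D_n(φ) = det( (φ_{i−j})_{0 ≤ i,j ≤ n} ) be the (n+1)×(n+1) Toeplitz determinant generated by φ. Then D_n(φ) · exp( −(n+1) L₀ − ∑_{k=1}^∞ k |L_k|² ) → 1 as n → ∞. -/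
open MeasureTheory Filter Topology Complex

/-- The `k`-th Fourier coefficient `g_k = (1/2π)∫₀^{2π} g(e^{iθ}) e^{-ikθ} dθ` of a
(`2π`-periodic) function on the unit circle. -/
noncomputable def circCoeff (g : ℝ → ℂ) (k : ℤ) : ℂ :=
  (1 / (2 * Real.pi) : ℂ) * ∫ θ in (0 : ℝ)..(2 * Real.pi),
    g θ * Complex.exp (-(Complex.I * k * θ))

/-- The Toeplitz determinant `D_n(φ) = det((φ_{i-j})_{0 ≤ i,j ≤ n})`. -/
noncomputable def toeplitzDet (φ : ℝ → ℂ) (n : ℕ) : ℂ :=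
  Matrix.det (Matrix.of fun i j : Fin (n + 1) =>
    circCoeff φ ((i : ℕ) - (j : ℕ) : ℤ))

namespace Szego
set_option linter.unusedSectionVars false
open AddCircle

variable {T : ℝ} [hT : Fact (0 < T)]

noncomputable def vdm (N : ℕ) (x : Fin N → AddCircle T) : ℂ :=
  Matrix.det (Matrix.of fun i j : Fin N => (fourier (i : ℤ) (x j) : ℂ))

noncomputable def wt (N : ℕ) (f : AddCircle T → ℝ) (x : Fin N → AddCircle T) : ℝ :=
  ‖vdm N x‖ ^ 2 * ∏ j, Real.exp (f (x j))

noncomputable def Z (N : ℕ) (f : AddCircle T → ℝ) : ENNReal :=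
  ∫⁻ x, ENNReal.ofReal (wt N f x) ∂(Measure.pi fun _ : Fin N => (haarAddCircle : Measure (AddCircle T)))

noncomputable def TD (N : ℕ) (φ : AddCircle T → ℂ) : ℂ :=
  Matrix.det (Matrix.of fun i j : Fin N => fourierCoeff φ ((i : ℤ) - (j : ℤ)))

theorem andreief {X : Type*} [MeasurableSpace X] (μ : Measure X) [SigmaFinite μ] {N : ℕ}
    (f g : Fin N → X → ℂ) (hint : ∀ i j, Integrable (fun x => f i x * g j x) μ) :
    ∫ x, Matrix.det (Matrix.of fun i j : Fin N => f i (x j)) *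
        Matrix.det (Matrix.of fun i j : Fin N => g i (x j)) ∂(Measure.pi fun _ : Fin N => μ)
      = (N.factorial : ℂ) * Matrix.det (Matrix.of fun i j : Fin N => ∫ x, f i x * g j x ∂μ) := by
  have hI : ∀ σ τ : Equiv.Perm (Fin N), Integrable (fun x : Fin N → X =>
      ∏ i, (f (σ i) (x i) * g (τ i) (x i))) (Measure.pi fun _ : Fin N => μ) := fun σ τ =>
    Integrable.fintype_prod (f := fun i x => f (σ i) x * g (τ i) x) (fun i => hint _ _)
  have h1 : ∀ x : Fin N → X, Matrix.det (Matrix.of fun i j : Fin N => f i (x j)) *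
        Matrix.det (Matrix.of fun i j : Fin N => g i (x j)) =
      ∑ τ : Equiv.Perm (Fin N), ∑ σ : Equiv.Perm (Fin N),
        ((Equiv.Perm.sign σ : ℤ) : ℂ) * ((Equiv.Perm.sign τ : ℤ) : ℂ) *
          ∏ i, (f (σ i) (x i) * g (τ i) (x i)) := by
    intro x
    rw [Matrix.det_apply', Matrix.det_apply', Finset.sum_mul_sum, Finset.sum_comm]
    refine Finset.sum_congr rfl fun τ _ => Finset.sum_congr rfl fun σ _ => ?_
    simp only [Matrix.of_apply, Finset.prod_mul_distrib]
    ring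
  simp_rw [h1]
  rw [integral_finsetSum _ fun τ _ => integrable_finsetSum _ fun σ _ => (hI σ τ).const_mul _]
  have h2 : ∀ τ : Equiv.Perm (Fin N), ∫ x, ∑ σ : Equiv.Perm (Fin N),
        ((Equiv.Perm.sign σ : ℤ) : ℂ) * ((Equiv.Perm.sign τ : ℤ) : ℂ) *
          ∏ i, (f (σ i) (x i) * g (τ i) (x i)) ∂(Measure.pi fun _ : Fin N => μ) =
      Matrix.det (Matrix.of fun i j : Fin N => ∫ x, f i x * g j x ∂μ) := by
    intro τ
    rw [integral_finsetSum _ fun σ _ => (hI σ τ).const_mul _]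
    simp_rw [integral_const_mul]
    have : ∀ σ : Equiv.Perm (Fin N), ∫ x : Fin N → X, ∏ i, (f (σ i) (x i) * g (τ i) (x i))
        ∂(Measure.pi fun _ : Fin N => μ) = ∏ i, ∫ x, f (σ i) x * g (τ i) x ∂μ := fun σ =>
      integral_fintype_prod_eq_prod (μ := fun _ => μ) (f := fun i x => f (σ i) x * g (τ i) x)
    simp_rw [this]
    have h3 := Matrix.det_permute' τ (Matrix.of fun i j : Fin N => ∫ x, f i x * g j x ∂μ)
    have h4 : ((Equiv.Perm.sign τ : ℤ) : ℂ) * ((Equiv.Perm.sign τ : ℤ) : ℂ) = 1 := by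
      rw [← Int.cast_mul, ← Units.val_mul, Int.units_mul_self]; simp
    calc _ = ((Equiv.Perm.sign τ : ℤ) : ℂ) * ((Matrix.of fun i j : Fin N => ∫ x, f i x * g j x ∂μ).submatrix id τ).det := by
            rw [Matrix.det_apply', Finset.mul_sum]
            refine Finset.sum_congr rfl fun σ _ => ?_
            simp only [Matrix.submatrix_apply, Matrix.of_apply, id]
            ring
      _ = _ := by rw [h3, ← mul_assoc, h4, one_mul]
  simp_rw [h2]
  simp [Fintype.card_perm]

theorem vdm_continuous (N : ℕ) : Continuous (vdm (T := T) N) := by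
  unfold vdm
  refine Continuous.matrix_det ?_
  refine continuous_matrix fun i j => ?_
  simp only [Matrix.of_apply]
  exact (fourier (i : ℤ)).continuous.comp (continuous_apply j)

theorem wt_nonneg (N : ℕ) (f : AddCircle T → ℝ) (x) : 0 ≤ wt N f x := by
  unfold wt; positivity

theorem wt_aemeas (N : ℕ) (f : AddCircle T → ℝ) (hf : AEMeasurable f haarAddCircle) :
    AEMeasurable (wt N f) (Measure.pi fun _ : Fin N => haarAddCircle) := by
  unfold wt
  refine AEMeasurable.mul ?_ ?_
  · exact ((vdm_continuous N).norm.pow 2).aemeasurable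
  · refine Finset.aemeasurable_fun_prod _ fun j _ => ?_
    refine Real.measurable_exp.comp_aemeasurable ?_
    exact hf.comp_quasiMeasurePreserving (Measure.quasiMeasurePreserving_eval _ j)

theorem heine (N : ℕ) (f : AddCircle T → ℝ)
    (hf : Integrable (fun x => Real.exp (f x)) haarAddCircle) :
    Integrable (wt N f) (Measure.pi fun _ : Fin N => haarAddCircle) ∧
    TD N (fun x => (Real.exp (f x) : ℂ)) =
      ((∫ x, wt N f x ∂(Measure.pi fun _ : Fin N => haarAddCircle) : ℝ) : ℂ) / (N.factorial : ℂ) := by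
  constructor
  · unfold wt
    have h1 : Integrable (fun x : Fin N → AddCircle T => ∏ j, Real.exp (f (x j)))
      (Measure.pi fun _ : Fin N => haarAddCircle) :=
      Integrable.fintype_prod (f := fun _ x => Real.exp (f x)) (fun _ => hf)
    obtain ⟨C, hC⟩ := isCompact_univ.exists_bound_of_continuousOn
      ((vdm_continuous (T := T) N).norm.pow 2).continuousOn
    exact h1.bdd_mul (c := C) ((vdm_continuous (T := T) N).norm.pow 2).aestronglyMeasurable
      (Eventually.of_forall fun x => hC x trivial)
  · have hfc : Integrable (fun x => (Real.exp (f x) : ℂ)) (haarAddCircle : Measure (AddCircle T)) := hf.ofReal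
    have key := andreief (haarAddCircle : Measure (AddCircle T)) (N := N)
      (fun i x => (fourier (-(i : ℤ)) x : ℂ) * (Real.exp (f x) : ℂ)) (fun j x => (fourier (j : ℤ) x : ℂ)) ?_
    · have hN : (N.factorial : ℂ) ≠ 0 := by exact_mod_cast N.factorial_ne_zero
      rw [eq_div_iff hN, mul_comm]
      have e1 : TD N (fun x => (Real.exp (f x) : ℂ)) = Matrix.det (Matrix.of fun i j : Fin N =>
          ∫ x, (fourier (-(i : ℤ)) x : ℂ) * (Real.exp (f x) : ℂ) * (fourier (j : ℤ) x : ℂ)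
            ∂(haarAddCircle : Measure (AddCircle T))) := by
        unfold TD fourierCoeff
        congr 1
        ext i j
        simp only [Matrix.of_apply]
        refine integral_congr_ae (Eventually.of_forall fun x => ?_)
        simp only [smul_eq_mul]
        rw [neg_sub, sub_eq_add_neg, fourier_add]
        ring
      rw [e1, ← key]
      refine Eq.trans ?_ (integral_ofReal (𝕜 := ℂ))
      refine integral_congr_ae (Eventually.of_forall fun x => ?_)
      simp only [wt]
      have e2 : Matrix.det (Matrix.of fun i j : Fin N => (fourier (-(i : ℤ)) (x j) : ℂ) * (Real.exp (f (x j)) : ℂ))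
         = (∏ j, (Real.exp (f (x j)) : ℂ)) * (starRingEnd ℂ) (vdm N x) := by
        unfold vdm
        rw [RingHom.map_det, ← Matrix.det_mul_row]
        congr 1
        ext i j
        simp only [Matrix.of_apply, RingHom.mapMatrix_apply, Matrix.map_apply]
        rw [fourier_neg, mul_comm]
      rw [e2]
      change _ * _ * vdm N x = _
      have e3 : (((‖vdm N x‖ ^ 2 : ℝ)) : ℂ) = (starRingEnd ℂ) (vdm N x) * vdm N x := by
        rw [mul_comm, Complex.mul_conj, Complex.normSq_eq_norm_sq]
      rw [RCLike.ofReal_mul]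
      change _ = (((‖vdm N x‖ ^ 2 : ℝ)) : ℂ) * ((∏ j, Real.exp (f (x j)) : ℝ) : ℂ)
      rw [e3]
      push_cast
      ring
    · intro i j
      have : Integrable (fun x => ((fourier (-(i : ℤ)) x : ℂ) * (fourier (j : ℤ) x : ℂ)) * (Real.exp (f x) : ℂ))
          (haarAddCircle : Measure (AddCircle T)) := by
        refine hfc.bdd_mul (c := 1) ?_ (Eventually.of_forall fun x => ?_)
        · exact ((fourier (-(i : ℤ))).continuous.mul (fourier (j : ℤ)).continuous).aestronglyMeasurable
        · rw [norm_mul, fourier_apply, fourier_apply, Circle.norm_coe, Circle.norm_coe, mul_one]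
      refine this.congr (Eventually.of_forall fun x => ?_)
      simp only; ring

theorem TD_eq_Z (N : ℕ) (f : AddCircle T → ℝ)
    (hf : Integrable (fun x => Real.exp (f x)) haarAddCircle) :
    TD N (fun x => (Real.exp (f x) : ℂ)) = (((Z N f).toReal / N.factorial : ℝ) : ℂ) ∧ Z N f ≠ ⊤ := by
  obtain ⟨h1, h2⟩ := heine N f hf
  have h3 : ENNReal.ofReal (∫ x, wt N f x ∂(Measure.pi fun _ : Fin N => haarAddCircle)) = Z N f :=
    ofReal_integral_eq_lintegral_ofReal h1 (Eventually.of_forall fun x => wt_nonneg N f x)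
  constructor
  · rw [h2, ← h3, ENNReal.toReal_ofReal (integral_nonneg fun x => wt_nonneg N f x)]
    push_cast; rfl
  · rw [← h3]; exact ENNReal.ofReal_ne_top

end Szego

namespace Szego
open Matrix ComplexOrder in
theorem det_dual {d n : Type*} [Fintype d] [DecidableEq d] [Fintype n] [DecidableEq n]
    (A1 : Matrix n d ℂ) (A2 : Matrix n n ℂ) (V1 : Matrix d d ℂ) (V2 : Matrix d n ℂ)
    (h : V1 * A1ᴴ + V2 * A2ᴴ = 0) (hA2 : A2.det = 1) :
    (A1 * A1ᴴ + A2 * A2ᴴ).det * (V1.det * star V1.det) = (V1 * V1ᴴ + V2 * V2ᴴ).det := by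
  set G := A1 * A1ᴴ + A2 * A2ᴴ with hG
  have hpd : G.PosDef := by
    rw [hG]
    refine PosDef.posSemidef_add (posSemidef_self_mul_conjTranspose _) ?_
    refine PosDef.mul_conjTranspose_self _ ?_
    refine Matrix.vecMul_injective_of_isUnit ?_
    rw [Matrix.isUnit_iff_isUnit_det, hA2]; exact isUnit_one
  have hG0 : G.det ≠ 0 := hpd.det_pos.ne'
  have hGH : star G.det = G.det := by
    rw [← det_conjTranspose, hpd.isHermitian.eq]
  have h1 : (fromBlocks V1 V2 A1 A2) * (fromBlocks (1 : Matrix d d ℂ) 0 A1 A2)ᴴ =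
      fromBlocks V1 0 A1 G := by
    rw [fromBlocks_conjTranspose, fromBlocks_multiply]
    simp [h, hG]
  have h' : A1 * V1ᴴ + A2 * V2ᴴ = 0 := by
    have := congrArg conjTranspose h
    simpa using this
  have h2 : (fromBlocks V1 V2 A1 A2) * (fromBlocks V1 V2 A1 A2)ᴴ =
      fromBlocks (V1 * V1ᴴ + V2 * V2ᴴ) 0 0 G := by
    rw [fromBlocks_conjTranspose, fromBlocks_multiply, h, h', hG]
  have d1 := congrArg det h1
  have d2 := congrArg det h2
  rw [det_mul, det_conjTranspose, det_fromBlocks_zero₁₂, det_fromBlocks_zero₁₂, hA2] at d1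
  rw [det_mul, det_conjTranspose, det_fromBlocks_zero₁₂] at d2
  simp only [det_one, star_one, mul_one] at d1
  rw [d1, star_mul, hGH] at d2
  apply mul_right_cancel₀ hG0
  rw [← d2]; ring

theorem cauchy_det {d : ℕ} (a b : Fin d → ℂ) (h : ∀ i j, 1 - a i * b j ≠ 0) :
    (Matrix.of fun i j => (1 - a i * b j)⁻¹).det * ∏ i, ∏ j, (1 - a i * b j) =
      (Matrix.vandermonde a).det * (Matrix.vandermonde b).det := by
  induction d with
  | zero => simp
  | succ d ih =>
    have ih' := ih (fun i => a i.succ) (fun i => b i.succ) (fun i j => h _ _)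
    have hv : ∀ c : Fin (d+1) → ℂ, (Matrix.vandermonde c).det =
        (∏ i : Fin d, (c i.succ - c 0)) * (Matrix.vandermonde (fun i : Fin d => c i.succ)).det := by
      intro c
      rw [Matrix.det_vandermonde, Matrix.det_vandermonde, Fin.prod_univ_succ]
      simp [Fin.prod_Ioi_succ]
    have key : (Matrix.of fun i j => (1 - a i * b j)⁻¹).det =
        (1 - a 0 * b 0)⁻¹ * ((∏ i : Fin d, ((a i.succ - a 0) * (1 - a i.succ * b 0)⁻¹)) *
         ((∏ i : Fin d, ((b i.succ - b 0) * (1 - a 0 * b i.succ)⁻¹)) *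
          (Matrix.of fun i j : Fin d => (1 - a i.succ * b j.succ)⁻¹).det)) := by
      rw [← Matrix.det_mul_row, ← Matrix.det_mul_column]
      let B : Matrix (Fin (d+1)) (Fin (d+1)) ℂ := Matrix.of fun i j =>
        if i = 0 then (1 - a 0 * b j)⁻¹ else
          (1 - a i * b j)⁻¹ - (1 - a i * b 0)⁻¹ * (1 - a 0 * b 0) * (1 - a 0 * b j)⁻¹
      have e1 : (Matrix.of fun i j => (1 - a i * b j)⁻¹).det = B.det := by
        refine Matrix.det_eq_of_forall_row_eq_smul_add_const
          (fun i => if i = 0 then 0 else (1 - a i * b 0)⁻¹ * (1 - a 0 * b 0)) 0 (by simp) ?_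
        intro i j
        simp only [B, Matrix.of_apply]
        split_ifs with hi
        · subst hi; simp
        · simp
      rw [e1, Matrix.det_succ_column_zero, Fin.sum_univ_succ]
      have z : ∀ i : Fin d, B i.succ 0 = 0 := by
        intro i
        simp only [B, Matrix.of_apply, Fin.succ_ne_zero, if_false]
        rw [mul_assoc, mul_inv_cancel₀ (h 0 0)]; simp
      simp only [z]
      simp only [Fin.val_zero, pow_zero, one_mul, mul_zero, zero_mul, Finset.sum_const_zero, add_zero]
      congr 1
      congr 1
      ext i j
      simp only [B, Matrix.of_apply, Matrix.submatrix_apply, Fin.succAbove_zero, Fin.succ_ne_zero, if_false]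
      have := h i.succ j.succ
      have := h i.succ 0
      have h3 := h 0 j.succ
      have := h 0 0
      generalize a i.succ = x at *
      generalize b j.succ = y at *
      generalize a 0 = s at *
      generalize b 0 = t at *
      have h3' : 1 - y * s ≠ 0 := by rwa [mul_comm]
      field_simp
      ring
    rw [key, hv a, hv b, Fin.prod_univ_succ, Fin.prod_univ_succ]
    simp_rw [fun i : Fin d => Fin.prod_univ_succ (fun j => 1 - a i.succ * b j)]
    rw [Finset.prod_mul_distrib, Finset.prod_mul_distrib, Finset.prod_mul_distrib,
      Finset.prod_inv_distrib, Finset.prod_inv_distrib]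
    have p1 : ∏ i : Fin d, (1 - a i.succ * b 0) ≠ 0 := Finset.prod_ne_zero_iff.2 fun i _ => h _ _
    have p2 : ∏ i : Fin d, (1 - a 0 * b i.succ) ≠ 0 := Finset.prod_ne_zero_iff.2 fun i _ => h _ _
    have p3 := h 0 0
    generalize ∏ i : Fin d, (1 - a i.succ * b 0) = P1 at *
    generalize ∏ i : Fin d, (1 - a 0 * b i.succ) = P2 at *
    calc _ = (∏ i : Fin d, (a i.succ - a 0)) * (∏ i : Fin d, (b i.succ - b 0)) *
          ((Matrix.of fun i j : Fin d => (1 - a i.succ * b j.succ)⁻¹).det *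
            ∏ i : Fin d, ∏ j : Fin d, (1 - a i.succ * b j.succ)) := by
            field_simp
      _ = _ := by rw [ih']; ring

noncomputable def gram {d : ℕ} (b : Fin d → ℂ) (K : ℕ) : Matrix (Fin d) (Fin d) ℂ :=
  Matrix.of fun l k => ∑ m ∈ Finset.range K, (b l * star (b k)) ^ m

open Matrix ComplexOrder in
theorem gram_eq {d : ℕ} (b : Fin d → ℂ) (N : ℕ) :
    gram b (d + N) = vandermonde b * (vandermonde b)ᴴ +
      (of fun (l : Fin d) (m : Fin N) => b l ^ (d + m : ℕ)) *
        (of fun (l : Fin d) (m : Fin N) => b l ^ (d + m : ℕ))ᴴ := by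
  ext l k
  simp only [gram, of_apply, Matrix.add_apply, Matrix.mul_apply, conjTranspose_apply,
    vandermonde_apply, star_pow, ← mul_pow]
  rw [Finset.sum_range_add, Finset.sum_range, Finset.sum_range]

open Matrix ComplexOrder in
theorem gram_posDef {d : ℕ} (b : Fin d → ℂ) (hb : Function.Injective b) (N : ℕ) :
    (gram b (d + N)).PosDef := by
  rw [gram_eq]
  refine PosDef.add_posSemidef ?_ (posSemidef_self_mul_conjTranspose _)
  refine PosDef.mul_conjTranspose_self _ ?_
  refine Matrix.vecMul_injective_of_isUnit ?_
  rw [Matrix.isUnit_iff_isUnit_det]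
  exact isUnit_iff_ne_zero.2 (Matrix.det_vandermonde_ne_zero_iff.2 hb)

open Matrix ComplexOrder in
theorem gram_mono {d : ℕ} (b : Fin d → ℂ) (hb : Function.Injective b) (N : ℕ) :
    (gram b (d + N)).det ≤ (gram b (d + (N + 1))).det := by
  have hp := gram_posDef b hb N
  set u : Fin d → ℂ := fun l => b l ^ (d + N)
  have e : gram b (d + (N + 1)) = gram b (d + N) +
      replicateCol Unit u * replicateRow Unit (star u) := by
    ext l k
    simp [gram, u, ← add_assoc, Finset.sum_range_succ, Matrix.mul_apply, mul_pow]
  rw [e, det_add_replicateCol_mul_replicateRow hp.det_pos.ne'.isUnit]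
  have hq : 0 ≤ star u ⬝ᵥ ((gram b (d + N))⁻¹ *ᵥ u) := hp.inv.posSemidef.dotProduct_mulVec_nonneg u
  have e2 : (1 + replicateRow Unit (star u) * (gram b (d + N))⁻¹ * replicateCol Unit u).det =
      1 + star u ⬝ᵥ ((gram b (d + N))⁻¹ *ᵥ u) := by
    rw [det_unique, Matrix.mul_assoc]
    simp [Matrix.mul_apply, dotProduct, Matrix.mulVec]
  rw [e2]
  have := mul_nonneg hp.det_pos.le hq
  rw [mul_add, mul_one]
  exact le_add_of_nonneg_right this

theorem gram_tendsto {d : ℕ} (b : Fin d → ℂ) (hb : ∀ l, ‖b l‖ < 1) :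
    Tendsto (fun N => (gram b (d + N)).det) atTop
      (𝓝 (Matrix.of fun l k => (1 - b l * star (b k))⁻¹).det) := by
  have : Tendsto (fun N => gram b N) atTop (𝓝 (Matrix.of fun l k => (1 - b l * star (b k))⁻¹)) := by
    refine tendsto_pi_nhds.2 fun l => tendsto_pi_nhds.2 fun k => ?_
    simp only [gram, Matrix.of_apply]
    refine (hasSum_geometric_of_norm_lt_one ?_).tendsto_sum_nat
    rw [norm_mul, norm_star]
    nlinarith [hb l, hb k, norm_nonneg (b l), norm_nonneg (b k)]
  have h2 := ((Continuous.matrix_det continuous_id).tendsto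
    (Matrix.of fun l k => (1 - b l * star (b k))⁻¹)).comp this
  refine h2.comp ?_
  simpa [add_comm] using tendsto_add_atTop_nat d

end Szego

namespace Szego
set_option linter.unusedSectionVars false
set_option linter.unusedVariables false
open AddCircle

variable {T : ℝ} [hT : Fact (0 < T)]

noncomputable def pol {d : ℕ} (b : Fin d → ℂ) : Polynomial ℂ :=
  ∏ l, (Polynomial.X - Polynomial.C (star (b l)))

theorem pol_monic {d : ℕ} (b : Fin d → ℂ) : (pol b).Monic :=
  Polynomial.monic_prod_of_monic _ _ fun l _ => Polynomial.monic_X_sub_C _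

theorem pol_natDegree {d : ℕ} (b : Fin d → ℂ) : (pol b).natDegree = d := by
  simp [pol]

noncomputable def A1 {d : ℕ} (b : Fin d → ℂ) (N : ℕ) : Matrix (Fin N) (Fin d) ℂ :=
  Matrix.of fun i m => (Polynomial.X ^ (i : ℕ) * pol b).coeff m
noncomputable def A2 {d : ℕ} (b : Fin d → ℂ) (N : ℕ) : Matrix (Fin N) (Fin N) ℂ :=
  Matrix.of fun i m => (Polynomial.X ^ (i : ℕ) * pol b).coeff (d + m)

theorem A2_det {d : ℕ} (b : Fin d → ℂ) (N : ℕ) : (A2 b N).det = 1 := by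
  have h : ∀ i m : Fin N, i < m → A2 b N i m = 0 := by
    intro i m him
    simp only [A2, Matrix.of_apply]
    refine Polynomial.coeff_eq_zero_of_natDegree_lt ?_
    have := Fin.lt_def.1 him
    rw [Polynomial.natDegree_X_pow_mul _ (pol_monic b).ne_zero, pol_natDegree]
    omega
  rw [Matrix.det_of_isLowerTriangular _ (fun i m him => h i m (by simpa using him))]
  refine Finset.prod_eq_one fun i _ => ?_
  simp only [A2, Matrix.of_apply]
  rw [Polynomial.coeff_X_pow_mul]
  have := (pol_monic b).coeff_natDegree
  rwa [pol_natDegree] at this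

theorem pol_eval {d : ℕ} (b : Fin d → ℂ) (N : ℕ) (i : Fin N) (z : ℂ) :
    z ^ (i : ℕ) * (pol b).eval z = ∑ m ∈ Finset.range (d + N), (Polynomial.X ^ (i : ℕ) * pol b).coeff m * z ^ m := by
  rw [← Polynomial.eval_eq_sum_range']
  · simp
  · rw [Polynomial.natDegree_X_pow_mul _ (pol_monic b).ne_zero, pol_natDegree]
    omega

theorem four_pow (m : ℕ) (x : AddCircle T) : (fourier (m : ℤ) x : ℂ) = (fourier 1 x) ^ m := by
  induction m with
  | zero => simp
  | succ k ih => rw [pow_succ, ← ih, Nat.cast_succ, fourier_add]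

theorem integral_four (m k : ℕ) :
    ∫ x : AddCircle T, (fourier (m : ℤ) x : ℂ) * star (fourier (k : ℤ) x : ℂ) ∂haarAddCircle = if m = k then 1 else 0 := by
  have h := congrFun (fourierCoeff_fourier (T := T) m) k
  have e : fourierCoeff (fourier (m : ℤ) : AddCircle T → ℂ) k = ∫ x : AddCircle T, (fourier (m : ℤ) x : ℂ) * star (fourier (k : ℤ) x : ℂ) ∂haarAddCircle := by
    unfold fourierCoeff
    refine integral_congr_ae (Eventually.of_forall fun x => ?_)
    simp only [smul_eq_mul]
    rw [fourier_neg, mul_comm]; rfl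
  rw [← e, h]
  simp [Pi.single_apply, eq_comm]

theorem TD_pol {d : ℕ} (b : Fin d → ℂ) (N : ℕ) :
    TD N (fun x : AddCircle T => ((‖(pol b).eval (fourier 1 x : ℂ)‖ ^ 2 : ℝ) : ℂ)) =
      (A1 b N * (A1 b N).conjTranspose + A2 b N * (A2 b N).conjTranspose).det := by
  unfold TD
  rw [← Matrix.det_transpose]
  congr 1
  ext i j
  simp only [Matrix.transpose_apply, Matrix.of_apply, Matrix.add_apply, Matrix.mul_apply,
    Matrix.conjTranspose_apply, A1, A2]
  have e : ∀ x : AddCircle T, (fourier (-((j : ℤ) - (i : ℤ))) x : ℂ) • ((‖(pol b).eval (fourier 1 x : ℂ)‖ ^ 2 : ℝ) : ℂ)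
     = ∑ m ∈ Finset.range (d + N), ∑ k ∈ Finset.range (d + N),
        ((Polynomial.X ^ (i : ℕ) * pol b).coeff m * star ((Polynomial.X ^ (j : ℕ) * pol b).coeff k)) *
          ((fourier (m : ℤ) x : ℂ) * star (fourier (k : ℤ) x : ℂ)) := by
    intro x
    have e1 : (((‖(pol b).eval (fourier 1 x : ℂ)‖ ^ 2 : ℝ)) : ℂ) =
      (pol b).eval (fourier 1 x : ℂ) * star ((pol b).eval (fourier 1 x : ℂ)) := by
        rw [Complex.star_def, Complex.mul_conj, Complex.normSq_eq_norm_sq]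
    have h1 := pol_eval b N i (fourier 1 x)
    have h2 := congrArg star (pol_eval b N j (fourier 1 x))
    have e2 : (fourier (-((j : ℤ) - (i : ℤ))) x : ℂ) = (fourier 1 x : ℂ) ^ (i : ℕ) * star ((fourier 1 x : ℂ) ^ (j : ℕ)) := by
      rw [neg_sub, sub_eq_add_neg, fourier_add, fourier_neg, four_pow, four_pow]; rfl
    rw [smul_eq_mul, e1, e2]
    calc _ = ((fourier 1 x : ℂ) ^ (i : ℕ) * (pol b).eval (fourier 1 x : ℂ)) *
          star ((fourier 1 x : ℂ) ^ (j : ℕ) * (pol b).eval (fourier 1 x : ℂ)) := by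
            rw [star_mul]; ring
      _ = _ := by
        rw [h2, h1, star_sum, Finset.sum_mul_sum]
        refine Finset.sum_congr rfl fun m _ => Finset.sum_congr rfl fun k _ => ?_
        rw [four_pow, four_pow, star_mul]; ring
  unfold fourierCoeff
  simp_rw [e]
  have hI : ∀ (c : ℂ) (m k : ℕ), Integrable (fun x : AddCircle T => c * ((fourier (m : ℤ) x : ℂ) * star (fourier (k : ℤ) x : ℂ))) haarAddCircle := by
    intro c m k
    refine Continuous.integrable_of_hasCompactSupport ?_ (HasCompactSupport.of_compactSpace _)
    exact continuous_const.mul ((fourier (m : ℤ)).continuous.mul (fourier (k : ℤ)).continuous.star)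
  rw [integral_finsetSum _ fun m _ => integrable_finsetSum _ fun k _ => hI _ _ _]
  simp_rw [integral_finsetSum _ fun k _ => hI _ _ k, integral_const_mul, integral_four]
  have : ∀ m ∈ Finset.range (d + N), ∑ k ∈ Finset.range (d + N),
      (Polynomial.X ^ (i : ℕ) * pol b).coeff m * star ((Polynomial.X ^ (j : ℕ) * pol b).coeff k) * (if m = k then 1 else 0) =
      (Polynomial.X ^ (i : ℕ) * pol b).coeff m * star ((Polynomial.X ^ (j : ℕ) * pol b).coeff m) := by
    intro m hm
    simp only [mul_ite, mul_one, mul_zero, Finset.sum_ite_eq, hm, if_true]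
  rw [Finset.sum_congr rfl this, Finset.sum_range_add, Finset.sum_range, Finset.sum_range]

theorem TD_gram {d : ℕ} (b : Fin d → ℂ) (N : ℕ) :
    TD N (fun x : AddCircle T => ((‖(pol b).eval (fourier 1 x : ℂ)‖ ^ 2 : ℝ) : ℂ)) *
      ((Matrix.vandermonde b).det * star (Matrix.vandermonde b).det) = (gram b (d + N)).det := by
  rw [TD_pol, gram_eq]
  refine det_dual _ _ _ _ ?_ (A2_det b N)
  ext l i
  simp only [Matrix.add_apply, Matrix.mul_apply, Matrix.conjTranspose_apply, A1, A2,
    Matrix.of_apply, Matrix.vandermonde_apply, Matrix.zero_apply]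
  have h := congrArg star (pol_eval b N i (star (b l)))
  have h0 : (pol b).eval (star (b l)) = 0 := by
    unfold pol
    rw [Polynomial.eval_prod]
    exact Finset.prod_eq_zero (Finset.mem_univ l) (by simp)
  rw [h0, mul_zero, star_zero, star_sum, Finset.sum_range_add, Finset.sum_range, Finset.sum_range] at h
  rw [h]
  simp [mul_comm]

open ComplexOrder in
theorem nice_poly {d : ℕ} (b : Fin d → ℂ) (hb : Function.Injective b) (hb1 : ∀ l, ‖b l‖ < 1) :
    (∀ N, TD N (fun x : AddCircle T => ((‖(pol b).eval (fourier 1 x : ℂ)‖ ^ 2 : ℝ) : ℂ)) ≤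
      (∏ l, ∏ k, (1 - b l * star (b k)))⁻¹) ∧
    Tendsto (fun N => TD N (fun x : AddCircle T => ((‖(pol b).eval (fourier 1 x : ℂ)‖ ^ 2 : ℝ) : ℂ)))
      atTop (𝓝 (∏ l, ∏ k, (1 - b l * star (b k)))⁻¹) := by
  set v := (Matrix.vandermonde b).det with hv
  have hv0 : v ≠ 0 := Matrix.det_vandermonde_ne_zero_iff.2 hb
  have hne : ∀ l k, 1 - b l * star (b k) ≠ 0 := by
    intro l k h
    have : ‖b l * star (b k)‖ = 1 := by rw [← sub_eq_zero.1 h]; simp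
    rw [norm_mul, norm_star] at this
    nlinarith [hb1 l, hb1 k, norm_nonneg (b l), norm_nonneg (b k)]
  have hP : (∏ l, ∏ k, (1 - b l * star (b k))) ≠ 0 :=
    Finset.prod_ne_zero_iff.2 fun l _ => Finset.prod_ne_zero_iff.2 fun k _ => hne l k
  have hc := cauchy_det b (fun k => star (b k)) hne
  have hvs : (Matrix.vandermonde fun k => star (b k)).det = star v := by
    rw [hv, Matrix.det_vandermonde, Matrix.det_vandermonde, star_prod]
    simp
  rw [hvs, ← hv] at hc
  have hpos : 0 < v * star v := by
    rw [Complex.star_def, Complex.mul_conj]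
    exact_mod_cast Complex.normSq_pos.2 hv0
  have hC : (∏ l, ∏ k, (1 - b l * star (b k)))⁻¹ =
      (Matrix.of fun l k => (1 - b l * star (b k))⁻¹).det * (v * star v)⁻¹ := by
    rw [eq_mul_inv_iff_mul_eq₀ hpos.ne', ← hc, mul_comm, mul_assoc, mul_inv_cancel₀ hP, mul_one]
  have hT : ∀ N, TD N (fun x : AddCircle T => ((‖(pol b).eval (fourier 1 x : ℂ)‖ ^ 2 : ℝ) : ℂ)) =
      (gram b (d + N)).det * (v * star v)⁻¹ := by
    intro N
    rw [eq_mul_inv_iff_mul_eq₀ hpos.ne', TD_gram]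
  have hmono : Monotone fun N => (gram b (d + N)).det := monotone_nat_of_le_succ (gram_mono b hb)
  have ht := gram_tendsto b hb1
  simp_rw [hT, hC]
  refine ⟨fun N => ?_, ht.mul_const _⟩
  refine mul_le_mul_of_nonneg_right (hmono.ge_of_tendsto ht N) ?_
  rw [Complex.star_def, Complex.mul_conj, ← Complex.ofReal_inv]
  exact_mod_cast inv_nonneg.2 (Complex.normSq_nonneg v)

end Szego

namespace Szego

noncomputable abbrev H2 := lp (fun _ : ℕ => ℂ) 2

noncomputable def ee (k : ℕ) : H2 := lp.single 2 k (1 : ℂ)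

noncomputable def vt (b : ℂ) (k : ℕ) : H2 := (b ^ (k + 1) / (Real.sqrt (k + 1) : ℂ)) • ee k

noncomputable def vv (b : ℂ) : H2 := ∑' k, vt b k

theorem ee_norm (k : ℕ) : ‖ee k‖ = 1 := by
  unfold ee
  rw [lp.norm_single (by norm_num)]; simp

theorem vt_norm (b : ℂ) (k : ℕ) : ‖vt b k‖ ≤ ‖b‖ ^ (k + 1) := by
  unfold vt
  rw [norm_smul, ee_norm, mul_one, norm_div, norm_pow]
  refine div_le_self (by positivity) ?_
  rw [Complex.norm_real, Real.norm_of_nonneg (Real.sqrt_nonneg _), Real.one_le_sqrt]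
  have : (0 : ℝ) ≤ k := Nat.cast_nonneg k
  linarith

theorem vt_summable {b : ℂ} (hb : ‖b‖ < 1) : Summable (vt b) := by
  refine Summable.of_norm_bounded (g := fun k => ‖b‖ ^ (k + 1)) ?_ (vt_norm b)
  exact (summable_nat_add_iff 1).2 (summable_geometric_of_lt_one (norm_nonneg b) hb)

theorem vv_apply {b : ℂ} (hb : ‖b‖ < 1) (k : ℕ) :
    (vv b : ∀ _ : ℕ, ℂ) k = b ^ (k + 1) / (Real.sqrt (k + 1) : ℂ) := by
  have h := (vt_summable hb).hasSum.mapL (lp.evalCLM ℂ (fun _ : ℕ => ℂ) 2 k)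
  have h2 : ∀ j, lp.evalCLM ℂ (fun _ : ℕ => ℂ) 2 k (vt b j) =
      if j = k then b ^ (k + 1) / (Real.sqrt (k + 1) : ℂ) else 0 := by
    intro j
    change ((vt b j : H2) : ∀ _ : ℕ, ℂ) k = _
    unfold vt ee
    rw [lp.coeFn_smul, Pi.smul_apply, lp.single_apply, smul_eq_mul]
    split_ifs with h
    · subst h; simp
    · rw [Pi.single_eq_of_ne (by exact fun h' => h h'.symm)]; simp
  simp_rw [h2] at h
  exact (h.unique (hasSum_ite_eq k _))

theorem vv_cont : ContinuousOn vv (Metric.ball 0 1) := by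
  intro b hb
  have hb : ‖b‖ < 1 := by simpa using hb
  obtain ⟨r, h1, h2⟩ := exists_between hb
  have hr0 : 0 ≤ r := (norm_nonneg b).trans h1.le
  have : ContinuousOn vv (Metric.ball 0 r) := by
    refine continuousOn_tsum (u := fun k => r ^ (k + 1)) (fun k => ?_)
      ((summable_nat_add_iff 1).2 (summable_geometric_of_lt_one hr0 h2)) ?_
    · unfold vt; fun_prop
    · intro k x hx
      have hx : ‖x‖ < r := by simpa using hx
      exact (vt_norm x k).trans (pow_le_pow_left₀ (norm_nonneg _) hx.le _)
  exact (this.continuousAt (Metric.isOpen_ball.mem_nhds (by simpa using h1))).continuousWithinAt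

theorem vv_tail {b : ℂ} (hb : ‖b‖ ≤ 1 / 2) (k : ℕ) :
    ‖vv b - ∑ j ∈ Finset.range (k + 1), vt b j‖ ≤ 2 * ‖b‖ ^ (k + 2) := by
  have hb1 : ‖b‖ < 1 := by linarith
  have h := (vt_summable hb1).sum_add_tsum_nat_add (k + 1)
  unfold vv
  rw [← h, add_sub_cancel_left]
  have hs : HasSum (fun i : ℕ => ‖b‖ ^ (k + 2) * ‖b‖ ^ i) (‖b‖ ^ (k + 2) * (1 - ‖b‖)⁻¹) :=
    (hasSum_geometric_of_lt_one (norm_nonneg b) hb1).mul_left _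
  refine (tsum_of_norm_bounded hs fun i => ?_).trans ?_
  · refine (vt_norm b _).trans (le_of_eq ?_)
    ring
  · rw [mul_comm]
    refine mul_le_mul_of_nonneg_right ?_ (by positivity)
    rw [inv_le_comm₀ (by linarith) (by norm_num)]
    linarith

noncomputable def MM : AddSubmonoid H2 :=
  (AddSubmonoid.closure {y : H2 | ∃ b : ℂ, ‖b‖ < 1 ∧ y = -vv b}).topologicalClosure

theorem MM_closed : IsClosed (MM : Set H2) := AddSubmonoid.isClosed_topologicalClosure _

theorem neg_vv_mem {b : ℂ} (hb : ‖b‖ < 1) : -vv b ∈ MM :=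
  AddSubmonoid.le_topologicalClosure _ (AddSubmonoid.subset_closure ⟨b, hb, rfl⟩)

theorem smul_ee_mem (k : ℕ) : ∀ c : ℂ, c • ee k ∈ MM := by
  induction k using Nat.strong_induction_on with
  | _ k ih =>
  intro c
  obtain ⟨g, hg⟩ := IsAlgClosed.exists_pow_nat_eq (-c * (Real.sqrt (k + 1) : ℂ)) (Nat.succ_pos k)
  let β : ℕ → ℂ := fun s => g / ((s : ℂ) + 1)
  let y : ℕ → H2 := fun s => ((s + 1) ^ (k + 1)) • (-vv (β s) + ∑ j ∈ Finset.range k, vt (β s) j)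
  have hβn : ∀ s, ‖β s‖ = ‖g‖ / ((s : ℝ) + 1) := by
    intro s
    simp only [β, norm_div]
    congr 1
    rw [← Nat.cast_succ, Complex.norm_natCast]; simp
  have hβ : Tendsto (fun s => ‖β s‖) atTop (𝓝 0) := by
    simp_rw [hβn, div_eq_mul_one_div ‖g‖]
    simpa using tendsto_one_div_add_atTop_nhds_zero_nat.const_mul ‖g‖
  have hev : ∀ᶠ s in atTop, ‖β s‖ ≤ 1 / 2 := hβ.eventually_le_const (by norm_num)
  have hmem : ∀ᶠ s in atTop, y s ∈ MM := by
    filter_upwards [hev] with s hs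
    refine AddSubmonoid.nsmul_mem _ (add_mem (neg_vv_mem (by linarith)) (sum_mem fun j hj => ?_)) _
    exact ih j (Finset.mem_range.1 hj) _
  have hk : (Real.sqrt (k + 1) : ℂ) ≠ 0 := by
    rw [Ne, Complex.ofReal_eq_zero]
    positivity
  have hlim : Tendsto y atTop (𝓝 (c • ee k)) := by
    rw [tendsto_iff_norm_sub_tendsto_zero]
    refine squeeze_zero' (Eventually.of_forall fun s => norm_nonneg _) (g := fun s => 2 * ‖g‖ ^ (k + 1) * ‖β s‖) ?_ ?_
    · filter_upwards [hev] with s hs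
      have hs0 : ((s : ℂ) + 1) ≠ 0 := by exact_mod_cast Nat.succ_ne_zero s
      have e0 : c • ee k = -(((s + 1) ^ (k + 1)) • vt (β s) k) := by
        unfold vt
        rw [← Nat.cast_smul_eq_nsmul ℂ, smul_smul, ← neg_smul]
        congr 1
        simp only [β]
        rw [div_pow, ← Nat.succ_eq_add_one k, hg]
        push_cast
        field_simp
      have e1 : y s - c • ee k = -(((s + 1) ^ (k + 1)) • (vv (β s) - ∑ j ∈ Finset.range (k + 1), vt (β s) j)) := by
        rw [e0, Finset.sum_range_succ]
        simp only [y, smul_add, smul_sub, smul_neg]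
        abel
      rw [e1, norm_neg, ← Nat.cast_smul_eq_nsmul ℝ, norm_smul]
      have := vv_tail hs k
      have hs1 : (0 : ℝ) < (s : ℝ) + 1 := by positivity
      calc _ ≤ ((s : ℝ) + 1) ^ (k + 1) * (2 * ‖β s‖ ^ (k + 2)) := by
            rw [Real.norm_of_nonneg (by positivity)]
            push_cast
            exact mul_le_mul_of_nonneg_left this (by positivity)
        _ = 2 * (((s : ℝ) + 1) * ‖β s‖) ^ (k + 1) * ‖β s‖ := by rw [mul_pow]; ring
        _ = _ := by
          congr 3
          rw [hβn]; field_simp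
    · simpa using hβ.const_mul (2 * ‖g‖ ^ (k + 1))
  exact MM_closed.mem_of_tendsto hlim hmem

theorem MM_top (x : H2) : x ∈ MM := by
  have h := lp.hasSum_single (p := 2) (by norm_num) x
  refine MM_closed.mem_of_tendsto h (Eventually.of_forall fun s => sum_mem fun i _ => ?_)
  have : (lp.single 2 i (x i) : H2) = x i • ee i := by
    unfold ee
    rw [← lp.single_smul]; simp
  rw [this]
  exact smul_ee_mem i _

def SS : Set H2 := {y | ∃ (d : ℕ) (b : Fin d → ℂ), Function.Injective b ∧ (∀ l, ‖b l‖ < 1) ∧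
  y = -∑ l, vv (b l)}

theorem SS_closure {d : ℕ} (b : Fin d → ℂ) (hb : ∀ l, ‖b l‖ < 1) :
    -∑ l, vv (b l) ∈ closure SS := by
  let β : ℝ → Fin d → ℂ := fun t l => b l + (t : ℂ) * (l : ℕ)
  have hc : ∀ l, Tendsto (fun t => β t l) (𝓝 0) (𝓝 (b l)) := by
    intro l
    have : Continuous fun t => β t l := by simp only [β]; fun_prop
    simpa [β] using this.tendsto 0
  have hlim : Tendsto (fun t => -∑ l, vv (β t l)) (𝓝[≠] 0) (𝓝 (-∑ l, vv (b l))) := by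
    refine ((tendsto_finsetSum _ fun l _ => ?_).neg).mono_left nhdsWithin_le_nhds
    have := (vv_cont.continuousAt (Metric.isOpen_ball.mem_nhds (show b l ∈ Metric.ball (0 : ℂ) 1 by simpa using hb l)))
    exact this.tendsto.comp (hc l)
  refine mem_closure_of_tendsto hlim ?_
  have h1 : ∀ᶠ t in 𝓝[≠] (0 : ℝ), ∀ l, ‖β t l‖ < 1 := by
    rw [eventually_all]
    intro l
    exact ((hc l).norm.eventually_lt_const (hb l)).filter_mono nhdsWithin_le_nhds
  have h2 : ∀ᶠ t in 𝓝[≠] (0 : ℝ), ∀ l m, l ≠ m → β t l ≠ β t m := by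
    rw [eventually_all]; intro l
    rw [eventually_all]; intro m
    by_cases hlm : l = m
    · simp [hlm]
    by_cases hbl : b l = b m
    · filter_upwards [self_mem_nhdsWithin] with t ht _ h
      simp only [β, hbl, add_right_inj] at h
      have ht' : (t : ℂ) ≠ 0 := by exact_mod_cast ht
      have := mul_left_cancel₀ ht' h
      exact hlm (Fin.ext (by exact_mod_cast this))
    · have hd : ∀ᶠ t in 𝓝 (0 : ℝ), β t l ≠ β t m :=
        (((hc l).sub (hc m)).eventually_ne (sub_ne_zero.2 hbl)).mono fun t ht => sub_ne_zero.1 ht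
      filter_upwards [hd.filter_mono nhdsWithin_le_nhds] with t ht _ using ht
  filter_upwards [h1, h2] with t ht1 ht2
  exact ⟨d, β t, fun l m h => by by_contra hlm; exact ht2 l m hlm h, ht1, rfl⟩

theorem SS_dense (x : H2) : x ∈ closure SS := by
  have h : ((AddSubmonoid.closure {y : H2 | ∃ b : ℂ, ‖b‖ < 1 ∧ y = -vv b} : AddSubmonoid H2) : Set H2) ⊆ closure SS := by
    intro y hy
    have : ∃ (d : ℕ) (b : Fin d → ℂ), (∀ l, ‖b l‖ < 1) ∧ y = -∑ l, vv (b l) := by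
      induction hy using AddSubmonoid.closure_induction with
      | mem y hy =>
        obtain ⟨b, hb, rfl⟩ := hy
        exact ⟨1, fun _ => b, fun _ => hb, by simp⟩
      | zero => exact ⟨0, Fin.elim0, fun l => l.elim0, by simp⟩
      | add y z _ _ hy hz =>
        obtain ⟨d, b, hb, rfl⟩ := hy
        obtain ⟨d', b', hb', rfl⟩ := hz
        refine ⟨d + d', Fin.append b b', ?_, ?_⟩
        · intro l
          refine Fin.addCases (fun i => ?_) (fun i => ?_) l
          · simpa using hb i
          · simpa using hb' i
        · rw [Fin.sum_univ_add]; simp [add_comm]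
    obtain ⟨d, b, hb, rfl⟩ := this
    exact SS_closure b hb
  exact closure_minimal h isClosed_closure (MM_top x)

end Szego

namespace Szego
set_option linter.unusedSectionVars false
set_option linter.unusedVariables false
open AddCircle

variable {T : ℝ} [hT : Fact (0 < T)]

def Rel (f : AddCircle T → ℝ) (x : H2) : Prop :=
  MemLp (fun t => (f t : ℂ)) 2 haarAddCircle ∧ fourierCoeff (fun t => (f t : ℂ)) 0 = 0 ∧
    ∀ k : ℕ, fourierCoeff (fun t => (f t : ℂ)) ((k : ℤ) + 1) = x k / (Real.sqrt (k + 1) : ℂ)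

theorem H2_hasSum (x : H2) : HasSum (fun k => ‖x k‖ ^ 2) (‖x‖ ^ 2) := by
  have h := lp.hasSum_norm (p := 2) (by norm_num) x
  simpa using h

theorem Rel.int {f : AddCircle T → ℝ} {x : H2} (h : Rel f x) :
    Integrable (fun t => (f t : ℂ)) haarAddCircle := h.1.integrable (by norm_num)

theorem Rel.aem {f : AddCircle T → ℝ} {x : H2} (h : Rel f x) :
    AEMeasurable f haarAddCircle := by
  have := h.1.aestronglyMeasurable.aemeasurable
  have h2 := Complex.measurable_re.comp_aemeasurable this
  exact h2

theorem Rel.lin {f g : AddCircle T → ℝ} {x y : H2} (hf : Rel f x) (hg : Rel g y) (a b : ℝ) :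
    Rel (fun t => a * f t + b * g t) ((a : ℂ) • x + (b : ℂ) • y) := by
  have e : (fun t => ((a * f t + b * g t : ℝ) : ℂ)) =
      (fun t => (a : ℂ) * (f t : ℂ)) + (fun t => (b : ℂ) * (g t : ℂ)) := by
    ext t; simp
  have hc : ∀ n, fourierCoeff (fun t => ((a * f t + b * g t : ℝ) : ℂ)) n =
      a * fourierCoeff (fun t => (f t : ℂ)) n + b * fourierCoeff (fun t => (g t : ℂ)) n := by
    intro n
    rw [e, fourierCoeff.add (hf.int.const_mul _) (hg.int.const_mul _), Pi.add_apply,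
      fourierCoeff.const_mul, fourierCoeff.const_mul]
  refine ⟨?_, ?_, fun k => ?_⟩
  · rw [e]
    exact (hf.1.const_mul _).add (hg.1.const_mul _)
  · rw [hc, hf.2.1, hg.2.1]; simp
  · rw [hc, hf.2.2, hg.2.2]
    have : ((a : ℂ) • x + (b : ℂ) • y : H2) k = a * x k + b * y k := rfl
    rw [this]
    ring

theorem Rel.zero : Rel (fun _ : AddCircle T => (0 : ℝ)) 0 := by
  refine ⟨by simp, ?_, fun k => ?_⟩ <;> simp [fourierCoeff]

theorem Rel.add {f g : AddCircle T → ℝ} {x y : H2} (hf : Rel f x) (hg : Rel g y) :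
    Rel (fun t => f t + g t) (x + y) := by
  simpa using hf.lin hg 1 1

theorem Rel.sub {f g : AddCircle T → ℝ} {x y : H2} (hf : Rel f x) (hg : Rel g y) :
    Rel (fun t => f t - g t) (x - y) := by
  simpa [sub_eq_add_neg] using hf.lin hg 1 (-1)

theorem Rel.sum {d : ℕ} {f : Fin d → AddCircle T → ℝ} {x : Fin d → H2} (h : ∀ l, Rel (f l) (x l)) :
    Rel (fun t => ∑ l, f l t) (∑ l, x l) := by
  induction d with
  | zero => simpa using Rel.zero
  | succ d ih =>
    simp_rw [Fin.sum_univ_succ]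
    exact (h 0).add (ih fun l => h l.succ)

theorem coeff_neg (f : AddCircle T → ℝ) (n : ℤ) :
    fourierCoeff (fun t => (f t : ℂ)) (-n) = star (fourierCoeff (fun t => (f t : ℂ)) n) := by
  unfold fourierCoeff
  rw [Complex.star_def, ← integral_conj]
  refine integral_congr_ae (Eventually.of_forall fun x => ?_)
  simp only [smul_eq_mul, map_mul, Complex.conj_ofReal]
  rw [fourier_neg (n := -n)]

theorem Rel.norm_le {f : AddCircle T → ℝ} {x : H2} (h : Rel f x) :
    eLpNorm (fun t => (f t : ℂ)) 2 haarAddCircle ≤ ENNReal.ofReal (2 * ‖x‖) := by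
  set F := h.1.toLp _ with hF
  have hn : ‖F‖ = (eLpNorm (fun t => (f t : ℂ)) 2 haarAddCircle).toReal := Lp.norm_toLp _ h.1
  have hcoe : fourierCoeff (F : AddCircle T → ℂ) = fourierCoeff (fun t => (f t : ℂ)) :=
    fourierCoeff_congr_ae h.1.coeFn_toLp
  have H₁ : HasSum (fun i => ‖fourierBasis.repr F i‖ ^ 2) (‖F‖ ^ 2) := by
    have := lp.hasSum_norm (p := 2) (by norm_num) (fourierBasis.repr F)
    simpa using this
  simp_rw [fourierBasis_repr, hcoe] at H₁
  have hx := H2_hasSum x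
  have hk : ∀ k : ℕ, ‖fourierCoeff (fun t => (f t : ℂ)) ((k : ℤ) + 1)‖ ^ 2 ≤ ‖x k‖ ^ 2 := by
    intro k
    rw [h.2.2]
    refine pow_le_pow_left₀ (norm_nonneg _) ?_ 2
    rw [norm_div]
    refine div_le_self (norm_nonneg _) ?_
    rw [Complex.norm_real, Real.norm_of_nonneg (Real.sqrt_nonneg _), Real.one_le_sqrt]
    have : (0 : ℝ) ≤ k := Nat.cast_nonneg k
    linarith
  have s1 : Summable fun k : ℕ => ‖fourierCoeff (fun t => (f t : ℂ)) ((k : ℤ) + 1)‖ ^ 2 :=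
    Summable.of_nonneg_of_le (fun k => by positivity) hk hx.summable
  have b1 : ∑' k : ℕ, ‖fourierCoeff (fun t => (f t : ℂ)) ((k : ℤ) + 1)‖ ^ 2 ≤ ‖x‖ ^ 2 := by
    rw [← hx.tsum_eq]
    exact s1.tsum_le_tsum hk hx.summable
  set S := ∑' k : ℕ, ‖fourierCoeff (fun t => (f t : ℂ)) ((k : ℤ) + 1)‖ ^ 2 with hS
  have p1 : HasSum (fun n : ℕ => ‖fourierCoeff (fun t => (f t : ℂ)) (n : ℤ)‖ ^ 2) S := by
    refine (hasSum_nat_add_iff' 1).1 ?_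
    simpa [h.2.1] using s1.hasSum
  have p2 : HasSum (fun n : ℕ => ‖fourierCoeff (fun t => (f t : ℂ)) (-((n : ℤ) + 1))‖ ^ 2) S := by
    simp_rw [coeff_neg, norm_star]
    exact s1.hasSum
  have hh := H₁.unique (HasSum.of_nat_of_neg_add_one (f := fun n : ℤ => ‖fourierCoeff (fun t => (f t : ℂ)) n‖ ^ 2) p1 p2)
  have : ‖F‖ ≤ 2 * ‖x‖ := by
    refine abs_le_of_sq_le_sq' ?_ (by positivity) |>.2
    nlinarith [norm_nonneg x]
  rw [hn] at this
  exact (ENNReal.le_ofReal_iff_toReal_le h.1.eLpNorm_ne_top (by positivity)).2 this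

noncomputable def fac (b : ℂ) (t : AddCircle T) : ℝ := Real.log (‖(fourier 1 t : ℂ) - star b‖ ^ 2)

theorem norm_four (n : ℤ) (t : AddCircle T) : ‖(fourier n t : ℂ)‖ = 1 := by
  rw [fourier_apply, Circle.norm_coe]

theorem fac_norm_ne {b : ℂ} (hb : ‖b‖ < 1) (t : AddCircle T) : (fourier 1 t : ℂ) - star b ≠ 0 := by
  intro h
  have h1 := norm_four 1 t
  rw [sub_eq_zero.1 h, norm_star] at h1
  linarith

theorem fac_cont {b : ℂ} (hb : ‖b‖ < 1) : Continuous (fac (T := T) b) := by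
  unfold fac
  refine Continuous.log ?_ fun t => pow_ne_zero 2 (norm_ne_zero_iff.2 (fac_norm_ne hb t))
  exact (((fourier 1).continuous.sub continuous_const).norm).pow 2

theorem fac_hasSum {b : ℂ} (hb : ‖b‖ < 1) (t : AddCircle T) :
    HasSum (fun k : ℕ => -(b ^ (k + 1) / ((k : ℂ) + 1)) * (fourier ((k : ℤ) + 1) t : ℂ) +
      -(star b ^ (k + 1) / ((k : ℂ) + 1)) * (fourier (-((k : ℤ) + 1)) t : ℂ)) (fac b t : ℂ) := by
  set z := (fourier 1 t : ℂ) with hz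
  have hz1 : ‖z‖ = 1 := norm_four 1 t
  have hbz : ‖b * z‖ < 1 := by rw [norm_mul, hz1, mul_one]; exact hb
  have h1 : HasSum (fun k : ℕ => (b * z) ^ (k + 1) / ((k : ℂ) + 1)) (-Complex.log (1 - b * z)) := by
    have := (hasSum_nat_add_iff' 1).2 (Complex.hasSum_taylorSeries_neg_log hbz)
    simpa using this
  have h2 := h1.map (starRingEnd ℂ) Complex.continuous_conj
  have h3 := (h1.add h2).neg
  have hne : 1 - b * z ≠ 0 := by
    intro h
    rw [← sub_eq_zero.1 h] at hbz
    simp at hbz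
  have hval : (fac b t : ℂ) = -(-Complex.log (1 - b * z) + (starRingEnd ℂ) (-Complex.log (1 - b * z))) := by
    rw [Complex.add_conj, Complex.neg_re, Complex.log_re]
    have : ‖z - star b‖ = ‖1 - b * z‖ := by
      have e : z - star b = z * star (1 - b * z) := by
        rw [star_sub, star_one, star_mul, mul_sub, mul_one, ← mul_assoc, Complex.star_def,
          Complex.mul_conj, Complex.normSq_eq_norm_sq, hz1]; simp
      rw [e, norm_mul, norm_star, hz1, one_mul]
    unfold fac
    rw [← hz, this, Real.log_pow]
    push_cast; ring
  rw [hval]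
  refine (congrArg (fun g : ℕ → ℂ => HasSum g _) (funext fun k => ?_)).mpr h3
  have e1 : (fourier ((k : ℤ) + 1) t : ℂ) = z ^ (k + 1) := by
    rw [hz, ← four_pow]; norm_cast
  rw [fourier_neg, e1]
  simp only [Function.comp, map_div₀, map_pow, map_mul, map_add, map_one, Complex.conj_natCast, mul_pow, Complex.star_def]
  ring

theorem fac_coeff {b : ℂ} (hb : ‖b‖ < 1) (n : ℤ) :
    HasSum (fun k : ℕ => -(b ^ (k + 1) / ((k : ℂ) + 1)) * (if n = (k : ℤ) + 1 then 1 else 0) +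
      -(star b ^ (k + 1) / ((k : ℂ) + 1)) * (if n = -((k : ℤ) + 1) then 1 else 0))
      (fourierCoeff (fun t : AddCircle T => (fac b t : ℂ)) n) := by
  set F : ℕ → AddCircle T → ℂ := fun k t => -(b ^ (k + 1) / ((k : ℂ) + 1)) * (fourier ((k : ℤ) + 1) t : ℂ) +
      -(star b ^ (k + 1) / ((k : ℂ) + 1)) * (fourier (-((k : ℤ) + 1)) t : ℂ) with hF
  have hc : ∀ k, Continuous (F k) := fun k =>
    (continuous_const.mul (fourier _).continuous).add (continuous_const.mul (fourier _).continuous)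
  have hint : ∀ {G : AddCircle T → ℂ}, Continuous G → Integrable G haarAddCircle := fun hG =>
    hG.integrable_of_hasCompactSupport (HasCompactSupport.of_compactSpace _)
  have hcf : ∀ k, fourierCoeff (F k) n = -(b ^ (k + 1) / ((k : ℂ) + 1)) * (if n = (k : ℤ) + 1 then 1 else 0) +
      -(star b ^ (k + 1) / ((k : ℂ) + 1)) * (if n = -((k : ℤ) + 1) then 1 else 0) := by
    intro k
    have : F k = (fun t => -(b ^ (k + 1) / ((k : ℂ) + 1)) * (fourier ((k : ℤ) + 1) t : ℂ)) +
      (fun t => -(star b ^ (k + 1) / ((k : ℂ) + 1)) * (fourier (-((k : ℤ) + 1)) t : ℂ)) := rfl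
    have i1 : ∀ (c : ℂ) (m : ℤ), Integrable (fun t : AddCircle T => c * (fourier m t : ℂ)) haarAddCircle :=
      fun c m => hint (continuous_const.mul (fourier m).continuous)
    rw [this, fourierCoeff.add (i1 _ _) (i1 _ _), Pi.add_apply, fourierCoeff.const_mul,
      fourierCoeff.const_mul, fourierCoeff_fourier, fourierCoeff_fourier, Pi.single_apply, Pi.single_apply]
  simp_rw [← hcf]
  have hbd : ∀ k t, ‖F k t‖ ≤ 2 * ‖b‖ ^ (k + 1) := by
    intro k t
    have h1 : (1 : ℝ) ≤ ‖((k : ℂ) + 1)‖ := by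
      rw [← Nat.cast_succ, Complex.norm_natCast]; simp
    have h2 : ‖b‖ ^ (k + 1) / ‖((k : ℂ) + 1)‖ ≤ ‖b‖ ^ (k + 1) := div_le_self (by positivity) h1
    refine (norm_add_le _ _).trans ?_
    rw [norm_mul, norm_mul, norm_four, norm_four, norm_neg, norm_neg, norm_div, norm_div, norm_pow, norm_pow, norm_star]
    linarith
  have hsum : Summable fun k : ℕ => 2 * ‖b‖ ^ (k + 1) :=
    ((summable_nat_add_iff 1).2 (summable_geometric_of_lt_one (norm_nonneg b) hb)).mul_left 2
  have key := hasSum_integral_of_dominated_convergence (μ := (haarAddCircle : Measure (AddCircle T)))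
    (F := fun k t => (fourier (-n) t : ℂ) • F k t) (f := fun t => (fourier (-n) t : ℂ) • (fac b t : ℂ))
    (fun k _ => 2 * ‖b‖ ^ (k + 1))
    (fun k => ((fourier (-n)).continuous.smul (hc k)).aestronglyMeasurable)
    (fun k => Eventually.of_forall fun t => by rw [norm_smul, norm_four, one_mul]; exact hbd k t)
    (Eventually.of_forall fun t => hsum) (integrable_const _)
    (Eventually.of_forall fun t => (fac_hasSum hb t).const_smul _)
  exact key

theorem fac_rel {b : ℂ} (hb : ‖b‖ < 1) : Rel (fac (T := T) b) (-vv b) := by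
  refine ⟨?_, ?_, fun k => ?_⟩
  · have hc : Continuous (fun t : AddCircle T => (fac b t : ℂ)) := Complex.continuous_ofReal.comp (fac_cont hb)
    exact hc.memLp_of_hasCompactSupport (HasCompactSupport.of_compactSpace _)
  · have := fac_coeff (T := T) hb 0
    refine this.unique ?_
    convert hasSum_zero with k
    have h1 : (0 : ℤ) ≠ (k : ℤ) + 1 := by omega
    have h2 : (0 : ℤ) ≠ -((k : ℤ) + 1) := by omega
    rw [if_neg h1, if_neg h2]; simp
  · have := fac_coeff (T := T) hb ((k : ℤ) + 1)
    refine this.unique ?_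
    convert hasSum_ite_eq k (-(b ^ (k + 1) / ((k : ℂ) + 1))) using 1
    · ext j
      have h2 : (k : ℤ) + 1 ≠ -((j : ℤ) + 1) := by omega
      rw [if_neg h2]
      by_cases hjk : j = k
      · subst hjk; simp
      · have h1 : (k : ℤ) + 1 ≠ (j : ℤ) + 1 := by omega
        rw [if_neg h1, if_neg hjk]; simp
    · rw [lp.coeFn_neg, Pi.neg_apply, vv_apply hb, neg_div, div_div, ← Complex.ofReal_mul, Real.mul_self_sqrt (by positivity)]
      push_cast; rfl

theorem exp_norm {d : ℕ} (b : Fin d → ℂ) (hb : ∀ l, ‖b l‖ < 1) :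
    ((Real.exp (‖-∑ l, vv (b l)‖ ^ 2) : ℝ) : ℂ) = (∏ l, ∏ k, (1 - b l * star (b k)))⁻¹ := by
  have hlt : ∀ l k, ‖b l * star (b k)‖ < 1 := by
    intro l k
    rw [norm_mul, norm_star]
    nlinarith [hb l, hb k, norm_nonneg (b l), norm_nonneg (b k)]
  have hne : ∀ l k, 1 - b l * star (b k) ≠ 0 := by
    intro l k h
    have := hlt l k
    rw [← sub_eq_zero.1 h] at this
    simp at this
  have h1 : ∀ l k, HasSum (fun m : ℕ => (b l * star (b k)) ^ (m + 1) / ((m : ℂ) + 1)) (-Complex.log (1 - b l * star (b k))) := by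
    intro l k
    have := (hasSum_nat_add_iff' 1).2 (Complex.hasSum_taylorSeries_neg_log (hlt l k))
    simpa using this
  have h2 := hasSum_sum (s := Finset.univ) fun l _ => hasSum_sum (s := Finset.univ) fun k _ => h1 l k
  have h3 := (H2_hasSum (-∑ l, vv (b l))).mapL Complex.ofRealCLM
  have e : ∀ m : ℕ, Complex.ofRealCLM (‖(-∑ l, vv (b l) : H2) m‖ ^ 2) =
      ∑ l, ∑ k, (b l * star (b k)) ^ (m + 1) / ((m : ℂ) + 1) := by
    intro m
    have e1 : (-∑ l, vv (b l) : H2) m = -(∑ l, b l ^ (m + 1)) / (Real.sqrt (m + 1) : ℂ) := by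
      rw [lp.coeFn_neg, Pi.neg_apply, lp.coeFn_sum, Finset.sum_apply, neg_div, Finset.sum_div]
      congr 1
      exact Finset.sum_congr rfl fun l _ => vv_apply (hb l) m
    rw [e1, norm_div, norm_neg, div_pow, Complex.norm_real, Real.norm_of_nonneg (Real.sqrt_nonneg _), Real.sq_sqrt (by positivity)]
    have e2 : ((‖∑ l, b l ^ (m + 1)‖ ^ 2 : ℝ) : ℂ) = (∑ l, b l ^ (m + 1)) * star (∑ l, b l ^ (m + 1)) := by
      rw [Complex.star_def, Complex.mul_conj, Complex.normSq_eq_norm_sq]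
    rw [Complex.ofRealCLM_apply, Complex.ofReal_div, e2, star_sum, Finset.sum_mul_sum]
    simp_rw [← Finset.sum_div, mul_pow, star_pow]
    push_cast; rfl
  simp_rw [e] at h3
  have h4 := h3.unique h2
  rw [Complex.ofRealCLM_apply] at h4
  rw [Complex.ofReal_exp, h4, Complex.exp_sum]
  simp_rw [Complex.exp_sum, Complex.exp_neg, Complex.exp_log (hne _ _), Finset.prod_inv_distrib]

end Szego

namespace Szego
set_option linter.unusedSectionVars false
set_option linter.unusedVariables false
open AddCircle

variable {T : ℝ} [hT : Fact (0 < T)]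

open ComplexOrder in
theorem nice {s : H2} (hs : s ∈ SS) : ∃ g : AddCircle T → ℝ, Rel g s ∧
    (∀ N, Z N g ≤ ENNReal.ofReal (N.factorial * Real.exp (‖s‖ ^ 2))) ∧
    Tendsto (fun N => (Z N g).toReal / N.factorial) atTop (𝓝 (Real.exp (‖s‖ ^ 2))) := by
  obtain ⟨d, b, hb, hb1, rfl⟩ := hs
  set g : AddCircle T → ℝ := fun t => ∑ l, fac (b l) t with hg
  have hcont : Continuous g := continuous_finsetSum _ fun l _ => fac_cont (hb1 l)
  have hexp : ∀ t, Real.exp (g t) = ‖(pol b).eval (fourier 1 t : ℂ)‖ ^ 2 := by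
    intro t
    rw [hg, Real.exp_sum, pol, Polynomial.eval_prod, norm_prod, ← Finset.prod_pow]
    refine Finset.prod_congr rfl fun l _ => ?_
    have := norm_pos_iff.2 (fac_norm_ne (hb1 l) t)
    rw [fac, Real.exp_log (by positivity)]
    simp
  have hint : Integrable (fun x => Real.exp (g x)) (haarAddCircle : Measure (AddCircle T)) :=
    (Real.continuous_exp.comp hcont).integrable_of_hasCompactSupport (HasCompactSupport.of_compactSpace _)
  have hfun : (fun x : AddCircle T => ((‖(pol b).eval (fourier 1 x : ℂ)‖ ^ 2 : ℝ) : ℂ)) =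
      fun x => (Real.exp (g x) : ℂ) := by
    ext x; rw [hexp]
  have hn := nice_poly (T := T) b hb hb1
  rw [← exp_norm b hb1, hfun] at hn
  simp_rw [fun N => (TD_eq_Z N g hint).1] at hn
  refine ⟨g, ?_, ?_, ?_⟩
  · rw [← Finset.sum_neg_distrib]
    exact Rel.sum fun l => fac_rel (hb1 l)
  · intro N
    have h1 := Complex.real_le_real.1 (hn.1 N)
    have hN : (0 : ℝ) < N.factorial := by positivity
    rw [div_le_iff₀ hN, mul_comm] at h1
    rw [← ENNReal.ofReal_toReal (TD_eq_Z N g hint).2]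
    exact ENNReal.ofReal_le_ofReal h1
  · have := (Complex.continuous_re.tendsto _).comp hn.2
    simpa only [Function.comp_def, Complex.ofReal_re] using this

theorem Z_upper {f : AddCircle T → ℝ} {x : H2} (hf : Rel f x) (N : ℕ) :
    Z N f ≤ ENNReal.ofReal (N.factorial * Real.exp (‖x‖ ^ 2)) := by
  obtain ⟨s, hs, hsx⟩ := mem_closure_iff_seq_limit.1 (SS_dense x)
  choose g hg hgu hgt using fun n => nice (T := T) (hs n)
  have h0 : Tendsto (fun n => eLpNorm ((fun t => (g n t : ℂ)) - fun t => (f t : ℂ)) 2 haarAddCircle) atTop (𝓝 0) := by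
    have hb : Tendsto (fun n => ENNReal.ofReal (2 * ‖s n - x‖)) atTop (𝓝 0) := by
      have : Tendsto (fun n => 2 * ‖s n - x‖) atTop (𝓝 (2 * 0)) :=
        (tendsto_iff_norm_sub_tendsto_zero.1 hsx).const_mul 2
      rw [mul_zero] at this
      simpa using ENNReal.tendsto_ofReal this
    refine tendsto_of_tendsto_of_tendsto_of_le_of_le tendsto_const_nhds hb (fun _ => bot_le) fun n => ?_
    have := ((hg n).sub hf).norm_le
    have e : ((fun t => (g n t : ℂ)) - fun t => (f t : ℂ)) = fun t => ((g n t - f t : ℝ) : ℂ) := by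
      ext t; simp
    rw [e]; exact this
  have h1 := tendstoInMeasure_of_tendsto_eLpNorm (by norm_num) (fun n => (hg n).1.1) hf.1.1 h0
  obtain ⟨ns, hns, hae⟩ := h1.exists_seq_tendsto_ae
  have hae2 : ∀ᵐ t ∂(haarAddCircle : Measure (AddCircle T)), Tendsto (fun n => g (ns n) t) atTop (𝓝 (f t)) := by
    filter_upwards [hae] with t ht
    simpa [Function.comp_def] using (Complex.continuous_re.tendsto _).comp ht
  have hae3 : ∀ᵐ y ∂(Measure.pi fun _ : Fin N => (haarAddCircle : Measure (AddCircle T))),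
      ∀ j, Tendsto (fun n => g (ns n) (y j)) atTop (𝓝 (f (y j))) := by
    rw [ae_all_iff]
    intro j
    exact (Measure.quasiMeasurePreserving_eval (fun _ : Fin N => (haarAddCircle : Measure (AddCircle T))) j).ae hae2
  have hae4 : ∀ᵐ y ∂(Measure.pi fun _ : Fin N => (haarAddCircle : Measure (AddCircle T))),
      ENNReal.ofReal (wt N f y) = liminf (fun n => ENNReal.ofReal (wt N (g (ns n)) y)) atTop := by
    filter_upwards [hae3] with y hy
    refine (Tendsto.liminf_eq ?_).symm
    refine ENNReal.tendsto_ofReal ?_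
    unfold wt
    exact tendsto_const_nhds.mul (tendsto_finsetProd _ fun j _ => (Real.continuous_exp.tendsto _).comp (hy j))
  unfold Z
  rw [lintegral_congr_ae hae4]
  refine (lintegral_liminf_le' fun n => ?_).trans ?_
  · exact (wt_aemeas N (g (ns n)) (hg (ns n)).aem).ennreal_ofReal
  · have hlim : Tendsto (fun n => ENNReal.ofReal (N.factorial * Real.exp (‖s (ns n)‖ ^ 2))) atTop
        (𝓝 (ENNReal.ofReal (N.factorial * Real.exp (‖x‖ ^ 2)))) := by
      refine ENNReal.tendsto_ofReal (tendsto_const_nhds.mul ?_)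
      exact (Real.continuous_exp.tendsto _).comp (((hsx.comp hns.tendsto_atTop).norm).pow 2)
    rw [← hlim.liminf_eq]
    exact liminf_le_liminf (Eventually.of_forall fun n => hgu (ns n) N)

theorem Z_cs {f g : AddCircle T → ℝ} (hf : AEMeasurable f haarAddCircle) (hg : AEMeasurable g haarAddCircle) (N : ℕ) :
    (Z N g) ^ 2 ≤ Z N f * Z N (fun t => 2 * g t - f t) := by
  set h : AddCircle T → ℝ := fun t => 2 * g t - f t with hh
  have hhm : AEMeasurable h haarAddCircle := (hg.const_mul 2).sub hf
  have hpq : (2 : ℝ).HolderConjugate 2 := by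
    constructor <;> norm_num
  have key := ENNReal.lintegral_mul_le_Lp_mul_Lq (Measure.pi fun _ : Fin N => (haarAddCircle : Measure (AddCircle T))) hpq
    (((wt_aemeas N f hf).ennreal_ofReal).pow_const (1/2 : ℝ)) (((wt_aemeas N h hhm).ennreal_ofReal).pow_const (1/2 : ℝ))
  have e : ∀ y, ENNReal.ofReal (wt N f y) ^ (1/2 : ℝ) * ENNReal.ofReal (wt N h y) ^ (1/2 : ℝ) = ENNReal.ofReal (wt N g y) := by
    intro y
    rw [← ENNReal.mul_rpow_of_nonneg _ _ (by norm_num), ← ENNReal.ofReal_mul (wt_nonneg N f y)]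
    have : wt N f y * wt N h y = wt N g y ^ (2 : ℝ) := by
      rw [Real.rpow_two]
      unfold wt
      have : (∏ j, Real.exp (f (y j))) * ∏ j, Real.exp (h (y j)) = (∏ j, Real.exp (g (y j))) ^ 2 := by
        rw [← Finset.prod_mul_distrib, ← Finset.prod_pow]
        refine Finset.prod_congr rfl fun j _ => ?_
        rw [← Real.exp_add, ← Real.exp_nat_mul, hh]
        congr 1; push_cast; ring
      rw [mul_pow, ← this]; ring
    rw [this, ← ENNReal.ofReal_rpow_of_nonneg (wt_nonneg N g y) (by norm_num), ← ENNReal.rpow_mul]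
    norm_num
  simp only [Pi.mul_apply, e, ← ENNReal.rpow_mul] at key
  norm_num at key
  have k2 : Z N g ≤ Z N f ^ (1/2 : ℝ) * Z N h ^ (1/2 : ℝ) := by
    unfold Z; norm_num; exact key
  calc (Z N g) ^ 2 ≤ (Z N f ^ (1/2 : ℝ) * Z N h ^ (1/2 : ℝ)) ^ 2 := pow_le_pow_left' k2 2
    _ = _ := by
      rw [← ENNReal.mul_rpow_of_nonneg _ _ (by norm_num), ← ENNReal.rpow_natCast, ← ENNReal.rpow_mul]
      norm_num

theorem Z_limit {f : AddCircle T → ℝ} {x : H2} (hf : Rel f x) :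
    Tendsto (fun N => (Z N f).toReal / N.factorial) atTop (𝓝 (Real.exp (‖x‖ ^ 2))) := by
  have hup : ∀ {f : AddCircle T → ℝ} {x : H2} (hf : Rel f x) (N : ℕ),
      Z N f ≠ ⊤ ∧ (Z N f).toReal / N.factorial ≤ Real.exp (‖x‖ ^ 2) := by
    intro f x hf N
    have h := Z_upper hf N
    refine ⟨(h.trans_lt ENNReal.ofReal_lt_top).ne, ?_⟩
    have hN : (0 : ℝ) < N.factorial := by positivity
    rw [div_le_iff₀ hN, mul_comm]
    exact ENNReal.toReal_le_of_le_ofReal (by positivity) h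
  refine tendsto_order.2 ⟨fun c hc => ?_, fun c hc => Eventually.of_forall fun N => (hup hf N).2.trans_lt hc⟩
  have hcont : Continuous fun s : H2 => Real.exp (‖s‖ ^ 2) ^ 2 * Real.exp (-‖(2 : ℂ) • s - x‖ ^ 2) := by fun_prop
  have hopen : IsOpen {s : H2 | c < Real.exp (‖s‖ ^ 2) ^ 2 * Real.exp (-‖(2 : ℂ) • s - x‖ ^ 2)} :=
    isOpen_lt continuous_const hcont
  have hx : x ∈ {s : H2 | c < Real.exp (‖s‖ ^ 2) ^ 2 * Real.exp (-‖(2 : ℂ) • s - x‖ ^ 2)} := by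
    have : (2 : ℂ) • x - x = x := by rw [two_smul]; abel
    simp only [Set.mem_ofPred_eq, this]
    rw [← Real.exp_nat_mul, ← Real.exp_add]
    have e : ((2 : ℕ) : ℝ) * ‖x‖ ^ 2 + -‖x‖ ^ 2 = ‖x‖ ^ 2 := by push_cast; ring
    rw [e]; exact hc
  obtain ⟨s, hsc, hs⟩ := mem_closure_iff.1 (SS_dense x) _ hopen hx
  obtain ⟨g, hg, -, hgt⟩ := nice (T := T) hs
  have hh : Rel (fun t => 2 * g t - f t) ((2 : ℂ) • s - x) := by
    have := hg.lin hf 2 (-1)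
    simpa [sub_eq_add_neg] using this
  have hlim : Tendsto (fun N => ((Z N g).toReal / N.factorial) ^ 2 * Real.exp (-‖(2 : ℂ) • s - x‖ ^ 2)) atTop
      (𝓝 (Real.exp (‖s‖ ^ 2) ^ 2 * Real.exp (-‖(2 : ℂ) • s - x‖ ^ 2))) := (hgt.pow 2).mul_const _
  filter_upwards [(tendsto_order.1 hlim).1 c hsc] with N hN
  refine hN.trans_le ?_
  have hcs := ENNReal.toReal_mono (ENNReal.mul_ne_top (hup hf N).1 (hup hh N).1) (Z_cs hf.aem hg.aem N)
  rw [ENNReal.toReal_pow, ENNReal.toReal_mul] at hcs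
  have hb := (hup hh N).2
  have hN : (0 : ℝ) < N.factorial := by positivity
  rw [Real.exp_neg, ← div_eq_mul_inv, div_le_iff₀ (Real.exp_pos _)]
  calc ((Z N g).toReal / N.factorial) ^ 2 = (Z N g).toReal ^ 2 / (N.factorial * N.factorial) := by ring
    _ ≤ ((Z N f).toReal * (Z N (fun t => 2 * g t - f t)).toReal) / (N.factorial * N.factorial) := by gcongr
    _ = (Z N f).toReal / N.factorial * ((Z N (fun t => 2 * g t - f t)).toReal / N.factorial) := by field_simp
    _ ≤ _ := by gcongr

end Szego

namespace Szego
set_option linter.unusedSectionVars false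
set_option linter.unusedVariables false
open AddCircle

variable {T : ℝ} [hT : Fact (0 < T)]

theorem int_zero {h : AddCircle T → ℂ} (hi : Integrable h haarAddCircle) (h0 : ∀ n, fourierCoeff h n = 0)
    (G : C(AddCircle T, ℂ)) : ∫ t, G t * h t ∂haarAddCircle = 0 := by
  have hint : ∀ G : C(AddCircle T, ℂ), Integrable (fun t => G t * h t) haarAddCircle := fun G =>
    hi.bdd_mul (c := ‖G‖) G.continuous.aestronglyMeasurable (Eventually.of_forall fun t => G.norm_coe_le_norm t)
  let Λ₀ : C(AddCircle T, ℂ) →ₗ[ℂ] ℂ :=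
    { toFun := fun G => ∫ t, G t * h t ∂haarAddCircle
      map_add' := fun G H => by
        rw [← integral_add (hint G) (hint H)]
        simp only [ContinuousMap.add_apply, add_mul]
      map_smul' := fun c G => by
        simp only [ContinuousMap.smul_apply, smul_eq_mul, mul_assoc, integral_const_mul, RingHom.id_apply] }
  let Λ : C(AddCircle T, ℂ) →L[ℂ] ℂ := Λ₀.mkContinuous (∫ t, ‖h t‖ ∂haarAddCircle) fun G => by
    refine (norm_integral_le_integral_norm _).trans ?_
    rw [← integral_mul_const]
    refine integral_mono (hint G).norm (hi.norm.mul_const _) fun t => ?_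
    simp only [norm_mul]
    rw [mul_comm]
    gcongr
    exact G.norm_coe_le_norm t
  have hle : (Submodule.span ℂ (Set.range (@fourier T))).topologicalClosure ≤ LinearMap.ker Λ.toLinearMap := by
    refine Submodule.topologicalClosure_minimal _ ?_ Λ.isClosed_ker
    rw [Submodule.span_le]
    rintro _ ⟨n, rfl⟩
    have := h0 (-n)
    rw [fourierCoeff, neg_neg] at this
    exact this
  rw [span_fourier_closure_eq_top] at hle
  exact hle (Submodule.mem_top (x := G))

theorem ae_zero {f : AddCircle T → ℝ} (hi : Integrable f haarAddCircle)
    (h0 : ∀ g : BoundedContinuousFunction (AddCircle T) ℝ, ∫ t, g t * f t ∂haarAddCircle = 0) :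
    f =ᵐ[haarAddCircle] 0 := by
  have hm := hi.aestronglyMeasurable.aemeasurable
  have hmn : AEMeasurable (fun t => -f t) (haarAddCircle : Measure (AddCircle T)) := hm.neg
  have f1 : ∫⁻ t, ENNReal.ofReal (f t) ∂haarAddCircle ≠ ⊤ := hi.lintegral_lt_top.ne
  have f2 : ∫⁻ t, ENNReal.ofReal (-f t) ∂haarAddCircle ≠ ⊤ := hi.neg.lintegral_lt_top.ne
  have := isFiniteMeasure_withDensity f1
  have := isFiniteMeasure_withDensity f2
  have key : haarAddCircle.withDensity (fun t => ENNReal.ofReal (f t)) =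
      haarAddCircle.withDensity (fun t => ENNReal.ofReal (-f t)) := by
    refine ext_of_forall_integral_eq_of_IsFiniteMeasure fun g => ?_
    rw [integral_withDensity_eq_integral_toReal_smul₀ hm.ennreal_ofReal (Eventually.of_forall fun _ => ENNReal.ofReal_lt_top),
      integral_withDensity_eq_integral_toReal_smul₀ hmn.ennreal_ofReal (Eventually.of_forall fun _ => ENNReal.ofReal_lt_top),
      ← sub_eq_zero, ← integral_sub]
    · rw [← h0 g]
      refine integral_congr_ae (Eventually.of_forall fun t => ?_)
      simp only [ENNReal.toReal_ofReal', smul_eq_mul]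
      rw [← sub_mul, max_comm, max_comm (-f t), mul_comm]
      congr 1
      rcases le_total 0 (f t) with h | h
      · rw [max_eq_right h, max_eq_left (by linarith)]; ring
      · rw [max_eq_left h, max_eq_right (by linarith)]; ring
    · simp only [ENNReal.toReal_ofReal', smul_eq_mul]
      exact hi.pos_part.mul_bdd (c := ‖g‖) g.continuous.aestronglyMeasurable (Eventually.of_forall fun t => g.norm_coe_le_norm t)
    · simp only [ENNReal.toReal_ofReal', smul_eq_mul]
      exact hi.neg_part.mul_bdd (c := ‖g‖) g.continuous.aestronglyMeasurable (Eventually.of_forall fun t => g.norm_coe_le_norm t)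
  rw [withDensity_eq_iff hm.ennreal_ofReal hmn.ennreal_ofReal f1] at key
  filter_upwards [key] with t ht
  have := congrArg ENNReal.toReal ht
  simp only [ENNReal.toReal_ofReal'] at this
  rcases le_total 0 (f t) with h | h
  · rw [max_eq_left h, max_eq_right (by linarith)] at this; exact this
  · rw [max_eq_right h, max_eq_left (by linarith)] at this; simp; linarith

theorem memL2 {f : AddCircle T → ℝ} (hi : Integrable f haarAddCircle)
    (hs : Summable fun k : ℕ => ‖fourierCoeff (fun t => (f t : ℂ)) ((k : ℤ) + 1)‖ ^ 2) :
    MemLp (fun t => (f t : ℂ)) 2 haarAddCircle := by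
  set c : ℤ → ℂ := fourierCoeff (fun t => (f t : ℂ)) with hc
  have hsum : Summable fun n : ℤ => ‖c n‖ ^ 2 := by
    refine Summable.of_nat_of_neg_add_one (f := fun n : ℤ => ‖c n‖ ^ 2) ((summable_nat_add_iff 1).1 (by exact_mod_cast hs)) ?_
    simp_rw [hc, coeff_neg, norm_star]
    exact hs
  have hmem : Memℓp c 2 := by
    refine memℓp_gen ?_
    simpa using hsum
  set F : Lp ℂ 2 (haarAddCircle : Measure (AddCircle T)) := fourierBasis.repr.symm ⟨c, hmem⟩ with hF
  have hFc : ∀ n, fourierCoeff (F : AddCircle T → ℂ) n = c n := by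
    intro n
    rw [← fourierBasis_repr, hF, LinearIsometryEquiv.apply_symm_apply]
  have hFL : MemLp (F : AddCircle T → ℂ) 2 haarAddCircle := Lp.memLp F
  have hFi : Integrable (F : AddCircle T → ℂ) haarAddCircle := hFL.integrable (by norm_num)
  have hd : ∀ n, fourierCoeff (fun t => (f t : ℂ) - F t) n = 0 := by
    intro n
    have h1 : fourierCoeff (fun t => (f t : ℂ) - F t) n = c n - fourierCoeff (F : AddCircle T → ℂ) n := by
      rw [hc]
      unfold fourierCoeff
      rw [← integral_sub]
      · simp only [smul_sub]
      · exact hi.ofReal.bdd_mul (c := 1) (fourier _).continuous.aestronglyMeasurable (Eventually.of_forall fun t => (norm_four _ t).le)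
      · exact hFi.bdd_mul (c := 1) (fourier _).continuous.aestronglyMeasurable (Eventually.of_forall fun t => (norm_four _ t).le)
    rw [h1, hFc, sub_self]
  have hdi : Integrable (fun t => (f t : ℂ) - F t) haarAddCircle := hi.ofReal.sub hFi
  have hz : (fun t => f t - (F t).re) =ᵐ[haarAddCircle] 0 := by
    refine ae_zero (hi.sub hFi.re) fun g => ?_
    let G : C(AddCircle T, ℂ) := ⟨fun t => (g t : ℂ), Complex.continuous_ofReal.comp g.continuous⟩
    have h1 := int_zero hdi hd G
    have h2 : Integrable (fun t => G t * ((f t : ℂ) - F t)) haarAddCircle :=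
      hdi.bdd_mul (c := ‖G‖) G.continuous.aestronglyMeasurable (Eventually.of_forall fun t => G.norm_coe_le_norm t)
    have h3 := integral_re h2
    rw [h1] at h3
    simpa [G] using h3
  have hre : MemLp (fun t => (((F t).re : ℝ) : ℂ)) 2 haarAddCircle := hFL.re.ofReal
  refine hre.ae_eq ?_
  filter_upwards [hz] with t ht
  have : f t = (F t).re := by simpa [sub_eq_zero] using ht
  rw [this]

theorem circle_szego {f : AddCircle T → ℝ} (hi : Integrable f haarAddCircle)
    (he : Integrable (fun t => Real.exp (f t)) haarAddCircle)
    (hs : Summable fun k : ℕ => (k : ℝ) * ‖fourierCoeff (fun t => (f t : ℂ)) k‖ ^ 2) :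
    Tendsto (fun n : ℕ => TD (n + 1) (fun t => (Real.exp (f t) : ℂ)) *
      Complex.exp (-((n : ℂ) + 1) * fourierCoeff (fun t => (f t : ℂ)) 0 -
        ((∑' k : ℕ, (k : ℝ) * ‖fourierCoeff (fun t => (f t : ℂ)) k‖ ^ 2 : ℝ) : ℂ))) atTop (𝓝 1) := by
  set c : ℤ → ℂ := fourierCoeff (fun t => (f t : ℂ)) with hc
  have hs1 : Summable fun k : ℕ => ((k : ℝ) + 1) * ‖c ((k : ℤ) + 1)‖ ^ 2 := by
    have := (summable_nat_add_iff 1).2 hs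
    simpa using this
  have ht : ∑' k : ℕ, (k : ℝ) * ‖c k‖ ^ 2 = ∑' k : ℕ, ((k : ℝ) + 1) * ‖c ((k : ℤ) + 1)‖ ^ 2 := by
    rw [hs.tsum_eq_zero_add]; simp
  have hs2 : Summable fun k : ℕ => ‖c ((k : ℤ) + 1)‖ ^ 2 :=
    Summable.of_nonneg_of_le (fun k => by positivity) (fun k => by
      have : (0 : ℝ) ≤ k := Nat.cast_nonneg k
      nlinarith [sq_nonneg ‖c ((k : ℤ) + 1)‖]) hs1
  have hL2 := memL2 hi hs2
  have hx2 : ∀ k : ℕ, ‖(Real.sqrt (k + 1) : ℂ) * c ((k : ℤ) + 1)‖ ^ 2 = ((k : ℝ) + 1) * ‖c ((k : ℤ) + 1)‖ ^ 2 := by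
    intro k
    rw [norm_mul, mul_pow, Complex.norm_real, Real.norm_of_nonneg (Real.sqrt_nonneg _), Real.sq_sqrt (by positivity)]
  have hmem : Memℓp (fun k : ℕ => (Real.sqrt (k + 1) : ℂ) * c ((k : ℤ) + 1)) 2 := by
    refine memℓp_gen ?_
    have : Summable fun k : ℕ => ‖(Real.sqrt (k + 1) : ℂ) * c ((k : ℤ) + 1)‖ ^ 2 := by
      simp_rw [hx2]; exact hs1
    simpa using this
  set x : H2 := ⟨_, hmem⟩ with hx
  have hxn : ‖x‖ ^ 2 = ∑' k : ℕ, (k : ℝ) * ‖c k‖ ^ 2 := by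
    rw [ht, ← (H2_hasSum x).tsum_eq]
    exact tsum_congr hx2
  set a : ℝ := (c 0).re with ha
  have hc0 : c 0 = (a : ℂ) := by
    have := coeff_neg f 0
    rw [neg_zero] at this
    exact (Complex.conj_eq_iff_re.1 this.symm).symm
  set f0 : AddCircle T → ℝ := fun t => f t - a with hf0
  have hfc : ∀ n, fourierCoeff (fun t => (f0 t : ℂ)) n = c n - a * (if n = 0 then 1 else 0) := by
    intro n
    have e : (fun t : AddCircle T => (f0 t : ℂ)) = (fun t => (f t : ℂ)) + (fun t => (-a : ℂ) * (fourier 0 t : ℂ)) := by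
      ext t; simp [hf0, sub_eq_add_neg]
    have i2 : Integrable (fun t : AddCircle T => (-a : ℂ) * (fourier 0 t : ℂ)) haarAddCircle :=
      (continuous_const.mul (fourier 0).continuous).integrable_of_hasCompactSupport (HasCompactSupport.of_compactSpace _)
    have i1 : Integrable (fun t : AddCircle T => (f t : ℂ)) haarAddCircle := hi.ofReal
    rw [e, fourierCoeff.add i1 i2, Pi.add_apply, fourierCoeff.const_mul, fourierCoeff_fourier, Pi.single_apply]
    ring
  have hrel : Rel f0 x := by
    refine ⟨?_, ?_, fun k => ?_⟩
    · have : MemLp (fun t : AddCircle T => (f t : ℂ) - (a : ℂ)) 2 haarAddCircle := hL2.sub (memLp_const _)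
      simpa [hf0] using this
    · rw [hfc, hc0]; simp
    · have h1 : (k : ℤ) + 1 ≠ 0 := by omega
      have h2 : (Real.sqrt (k + 1) : ℂ) ≠ 0 := by
        rw [Complex.ofReal_ne_zero]; positivity
      rw [hfc, if_neg h1, mul_zero, sub_zero, eq_div_iff h2, mul_comm]
  have he0 : Integrable (fun t => Real.exp (f0 t)) (haarAddCircle : Measure (AddCircle T)) := by
    have := he.mul_const (Real.exp (-a))
    simpa only [← Real.exp_add, ← sub_eq_add_neg] using this
  have hTD : ∀ N, TD N (fun t => (Real.exp (f t) : ℂ)) =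
      Complex.exp (N * a) * (((Z N f0).toReal / N.factorial : ℝ) : ℂ) := by
    intro N
    rw [← (TD_eq_Z N f0 he0).1]
    have e : (fun t => (Real.exp (f t) : ℂ)) = fun t => Complex.exp a * (Real.exp (f0 t) : ℂ) := by
      ext t
      rw [← Complex.ofReal_exp, ← Complex.ofReal_mul, ← Real.exp_add, hf0]
      congr 2; ring
    unfold TD
    simp_rw [e, fourierCoeff.const_mul]
    rw [Complex.exp_nat_mul]
    have := Matrix.det_smul (Matrix.of fun i j : Fin N => fourierCoeff (fun t => (Real.exp (f0 t) : ℂ)) ((i : ℤ) - (j : ℤ))) (Complex.exp a)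
    rw [Fintype.card_fin] at this
    rw [← this]
    rfl
  have hlim := (tendsto_add_atTop_iff_nat 1).2 (Z_limit hrel)
  have hlim2 := (Complex.continuous_ofReal.tendsto _).comp hlim
  have hlim3 := hlim2.mul_const (Complex.exp (-((‖x‖ ^ 2 : ℝ) : ℂ)))
  rw [Complex.ofReal_exp, ← Complex.exp_add, add_neg_cancel, Complex.exp_zero] at hlim3
  refine hlim3.congr fun n => ?_
  rw [hTD, hc0, ← hxn, sub_eq_add_neg, Complex.exp_add]
  have e : Complex.exp (((n + 1 : ℕ) : ℂ) * a) * Complex.exp (-((n : ℂ) + 1) * a) = 1 := by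
    rw [← Complex.exp_add]
    have : ((n + 1 : ℕ) : ℂ) * a + -((n : ℂ) + 1) * a = 0 := by push_cast; ring
    rw [this, Complex.exp_zero]
  simp only [Function.comp_def]
  linear_combination (-(((Z (n + 1) f0).toReal / (n + 1).factorial : ℝ) : ℂ) * Complex.exp (-((‖x‖ ^ 2 : ℝ) : ℂ))) * e

instance fact2pi : Fact (0 < 2 * Real.pi) := ⟨Real.two_pi_pos⟩

theorem circ_eq (g : ℝ → ℂ) (k : ℤ) : circCoeff g k = fourierCoeff (liftIoc (2 * Real.pi) 0 g) k := by
  rw [fourierCoeff_eq_intervalIntegral _ _ 0, circCoeff, zero_add, Complex.real_smul]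
  push_cast
  congr 1
  refine intervalIntegral.integral_congr_ae (Eventually.of_forall fun x hx => ?_)
  rw [Set.uIoc_of_le Real.two_pi_pos.le] at hx
  rw [liftIoc_zero_coe_apply hx, smul_eq_mul, mul_comm, fourier_coe_apply]
  congr 2
  have : (Real.pi : ℂ) ≠ 0 := by exact_mod_cast Real.pi_ne_zero
  push_cast
  field_simp

theorem lift_int {g : ℝ → ℝ} (hg : IntegrableOn g (Set.Ioc 0 (2 * Real.pi)) volume) :
    Integrable (liftIoc (2 * Real.pi) 0 g) haarAddCircle := by
  have h1 : MemLp (fun θ => (g θ : ℂ)) 1 (volume.restrict (Set.Ioc 0 (0 + 2 * Real.pi))) := by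
    rw [zero_add, memLp_one_iff_integrable]
    exact Integrable.ofReal hg
  have h2 := memLp_one_iff_integrable.1 h1.memLp_liftIoc
  rw [volume_eq_smul_haarAddCircle] at h2
  rw [integrable_smul_measure (by simp [Real.pi_pos]) ENNReal.ofReal_ne_top] at h2
  exact h2.re

end Szego

/-- Szegő's Strong Limit Theorem: for `φ = e^L > 0` with `∑ k |L_k|² < ∞`,
`D_n(φ) e^{-(n+1)L₀ - ∑_{k≥1} k|L_k|²} → 1` as `n → ∞`. -/
theorem szego_strong_limit (L : ℝ → ℝ)
    (hper : Function.Periodic L (2 * Real.pi))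
    (hLint : IntegrableOn L (Set.Ioc 0 (2 * Real.pi)) volume)
    (hφint : IntegrableOn (fun θ => Real.exp (L θ)) (Set.Ioc 0 (2 * Real.pi)) volume)
    (hsum : Summable fun k : ℕ => (k : ℝ) * ‖circCoeff (fun θ => (L θ : ℂ)) k‖ ^ 2) :
    Tendsto (fun n : ℕ =>
        toeplitzDet (fun θ => (Real.exp (L θ) : ℂ)) n *
          Complex.exp (-((n : ℂ) + 1) * circCoeff (fun θ => (L θ : ℂ)) 0 -
            ((∑' k : ℕ, (k : ℝ) * ‖circCoeff (fun θ => (L θ : ℂ)) k‖ ^ 2 : ℝ) : ℂ)))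
      atTop (𝓝 1) := by
  have he : Integrable (fun t => Real.exp (AddCircle.liftIoc (2 * Real.pi) 0 L t)) AddCircle.haarAddCircle := by
    have h := Szego.lift_int (g := fun θ => Real.exp (L θ)) hφint
    have e0 : AddCircle.liftIoc (2 * Real.pi) 0 (fun θ => Real.exp (L θ)) =
      fun t => Real.exp (AddCircle.liftIoc (2 * Real.pi) 0 L t) := rfl
    rw [e0] at h
    exact h
  have e1 : AddCircle.liftIoc (2 * Real.pi) 0 (fun θ => (L θ : ℂ)) =
    fun t => ((AddCircle.liftIoc (2 * Real.pi) 0 L t : ℝ) : ℂ) := rfl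
  have e2 : AddCircle.liftIoc (2 * Real.pi) 0 (fun θ => (Real.exp (L θ) : ℂ)) =
    fun t => ((Real.exp (AddCircle.liftIoc (2 * Real.pi) 0 L t) : ℝ) : ℂ) := rfl
  have h3 : ∀ n, toeplitzDet (fun θ => (Real.exp (L θ) : ℂ)) n =
      Szego.TD (n + 1) (fun t => ((Real.exp (AddCircle.liftIoc (2 * Real.pi) 0 L t) : ℝ) : ℂ)) := by
    intro n
    rw [toeplitzDet, Szego.TD, ← e2]
    simp_rw [Szego.circ_eq]
  simp_rw [h3]
  simp_rw [Szego.circ_eq, e1] at hsum ⊢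
  exact Szego.circle_szego (Szego.lift_int hLint) he hsum
end

section
/- (Riesz's L⁴ inequality) Let f ∈ C_c^∞(ℝ) be real-valued. Then the Hilbert transform Hf satisfies ∫_ℝ (Hf(x))⁴ dx ≤ 34 ∫_ℝ f(x)⁴ dx. -/
open MeasureTheory Filter Topology

lemma aux_dom (K : ℝ) : Integrable (fun x : ℝ => K ^ 4 * (1 + x ^ 2)⁻¹) :=
  integrable_inv_one_add_sq.const_mul _

lemma aux_pow_bound {K x a : ℝ} (ha : 0 ≤ a) (h : (1 + |x|) * a ≤ K) :
    a ^ 4 ≤ K ^ 4 * (1 + x ^ 2)⁻¹ := by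
  have hx : 0 < 1 + x ^ 2 := by positivity
  rw [← div_eq_mul_inv, le_div_iff₀ hx]
  have h1 : 0 ≤ (1 + |x|) * a := by positivity
  have h2 : ((1 + |x|) * a) ^ 4 ≤ K ^ 4 := by gcongr
  have h3 : 1 + x ^ 2 ≤ (1 + |x|) ^ 4 := by
    rw [← sq_abs x]
    have := abs_nonneg x
    nlinarith [pow_nonneg this 3, pow_nonneg this 4, pow_nonneg this 2]
  calc a ^ 4 * (1 + x ^ 2) ≤ a ^ 4 * (1 + |x|) ^ 4 := by gcongr
    _ = ((1 + |x|) * a) ^ 4 := by ring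
    _ ≤ _ := h2

lemma aux_contour (F : ℂ → ℂ) (K C : ℝ)
    (hd : ∀ z : ℂ, 0 < z.im → DifferentiableAt ℂ F z)
    (hK : ∀ z : ℂ, 0 < z.im → (1 + |z.re|) * ‖F z‖ ≤ K)
    (hC : ∀ z : ℂ, 0 < z.im → ‖F z‖ ≤ C / z.im) (y : ℝ) (hy : 0 < y) :
    ∫ x : ℝ, F (x + y * Complex.I) ^ 4 = 0 := by
  have hcont : ∀ v : ℝ, 0 < v → Continuous (fun x : ℝ => F (x + v * Complex.I) ^ 4) := by
    intro v hv
    refine Continuous.pow ?_ 4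
    rw [continuous_iff_continuousAt]
    intro x
    have := (hd (x + v * Complex.I) (by simpa using hv)).continuousAt
    exact ContinuousAt.comp (f := fun x : ℝ => (x : ℂ) + v * Complex.I) this (by fun_prop)
  have hb : ∀ v : ℝ, 0 < v → ∀ x : ℝ, ‖F (x + v * Complex.I) ^ 4‖ ≤ K ^ 4 * (1 + x ^ 2)⁻¹ := by
    intro v hv x
    rw [norm_pow]
    apply aux_pow_bound (norm_nonneg _)
    simpa using hK (x + v * Complex.I) (by simpa using hv)
  have hint : ∀ v : ℝ, 0 < v → Integrable (fun x : ℝ => F (x + v * Complex.I) ^ 4) := by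
    intro v hv
    exact (aux_dom K).mono' (hcont v hv).aestronglyMeasurable (Eventually.of_forall (hb v hv))
  have hside : ∀ (Y : ℝ), y ≤ Y → ∀ σ : ℝ → ℝ, (∀ T, |σ T| = |T|) →
      Tendsto (fun T : ℝ => ∫ v in y..Y, F (σ T + v * Complex.I) ^ 4) atTop (𝓝 0) := by
    intro Y hY σ hσ
    have h0 : Tendsto (fun T : ℝ => K ^ 4 * (1 + T ^ 2)⁻¹ * |Y - y|) atTop (𝓝 0) := by
      have : Tendsto (fun T : ℝ => (1 + T ^ 2)⁻¹) atTop (𝓝 0) := by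
        apply tendsto_inv_atTop_zero.comp
        apply tendsto_atTop_add_const_left
        exact tendsto_pow_atTop (by norm_num)
      simpa using (this.const_mul (K ^ 4)).mul_const |Y - y|
    refine squeeze_zero_norm ?_ h0
    intro T
    apply intervalIntegral.norm_integral_le_of_norm_le_const
    intro v hv
    rw [Set.uIoc_of_le hY] at hv
    have := hb v (hy.trans hv.1) (σ T)
    rwa [← sq_abs (σ T), hσ, sq_abs] at this
  have heq : ∀ Y : ℝ, y ≤ Y → ∫ x : ℝ, F (x + y * Complex.I) ^ 4 = ∫ x : ℝ, F (x + Y * Complex.I) ^ 4 := by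
    intro Y hY
    have hrect : ∀ T : ℝ, (((∫ x in (-T)..T, F (x + y * Complex.I) ^ 4)
        - ∫ x in (-T)..T, F (x + Y * Complex.I) ^ 4)
        + Complex.I • ∫ v in y..Y, F ((T : ℝ) + v * Complex.I) ^ 4)
        - Complex.I • ∫ v in y..Y, F ((-T : ℝ) + v * Complex.I) ^ 4 = 0 := by
      intro T
      have := Complex.integral_boundary_rect_eq_zero_of_differentiableOn (fun z => F z ^ 4)
        ⟨-T, y⟩ ⟨T, Y⟩ (by
          intro z hz
          have hz2 := hz.2
          simp only [Set.mem_preimage, Set.uIcc_of_le hY] at hz2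
          exact ((hd z (hy.trans_le hz2.1)).pow 4).differentiableWithinAt)
      exact this
    have hl := (((intervalIntegral_tendsto_integral (hint y hy) tendsto_neg_atTop_atBot tendsto_id).sub
      (intervalIntegral_tendsto_integral (hint Y (hy.trans_le hY)) tendsto_neg_atTop_atBot tendsto_id)).add
      ((hside Y hY (fun T => T) (fun _ => rfl)).const_smul Complex.I)).sub
      ((hside Y hY (fun T => -T) (fun T => abs_neg T)).const_smul Complex.I)
    have h2 := hl.congr (fun T => hrect T)
    have h3 := tendsto_nhds_unique h2 tendsto_const_nhds
    simp only [smul_zero, add_zero, sub_zero] at h3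
    exact sub_eq_zero.1 h3
  have hlim : Tendsto (fun Y : ℝ => ∫ x : ℝ, F (x + Y * Complex.I) ^ 4) atTop (𝓝 (∫ x : ℝ, (0:ℂ))) := by
    apply tendsto_integral_filter_of_dominated_convergence (fun x : ℝ => K ^ 4 * (1 + x ^ 2)⁻¹)
    · filter_upwards [eventually_gt_atTop 0] with v hv using (hcont v hv).aestronglyMeasurable
    · filter_upwards [eventually_gt_atTop 0] with v hv using Eventually.of_forall (hb v hv)
    · exact aux_dom K
    · refine Eventually.of_forall fun x => ?_
      have : Tendsto (fun Y : ℝ => F (x + Y * Complex.I)) atTop (𝓝 0) := by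
        refine squeeze_zero_norm' (a := fun Y => C / Y) ?_ (tendsto_const_nhds.div_atTop tendsto_id)
        filter_upwards [eventually_gt_atTop 0] with v hv
        simpa using hC (x + v * Complex.I) (by simpa using hv)
      simpa using this.pow 4
  have hlim2 : Tendsto (fun Y : ℝ => ∫ x : ℝ, F (x + Y * Complex.I) ^ 4) atTop
      (𝓝 (∫ x : ℝ, F (x + y * Complex.I) ^ 4)) := by
    refine tendsto_const_nhds.congr' ?_
    filter_upwards [eventually_ge_atTop y] with Y hY using heq Y hY
  simpa using tendsto_nhds_unique hlim2 hlim

lemma aux_final (f g : ℝ → ℝ) (K : ℝ) (F : ℂ → ℂ) (hfm : Continuous f)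
    (hd : ∀ z : ℂ, 0 < z.im → DifferentiableAt ℂ F z)
    (hK : ∀ z : ℂ, 0 < z.im → (1 + |z.re|) * ‖F z‖ ≤ K) (C : ℝ)
    (hC : ∀ z : ℂ, 0 < z.im → ‖F z‖ ≤ C / z.im)
    (hl : ∀ x : ℝ, Tendsto (fun y : ℝ => F (x + y * Complex.I)) (𝓝[>] 0)
      (𝓝 ((f x : ℂ) + g x * Complex.I))) :
    ∫ x : ℝ, (g x) ^ 4 ≤ 34 * ∫ x : ℝ, (f x) ^ 4 := by
  have hcont : ∀ v : ℝ, 0 < v → Continuous (fun x : ℝ => F (x + v * Complex.I)) := by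
    intro v hv
    rw [continuous_iff_continuousAt]
    intro x
    have := (hd (x + v * Complex.I) (by simpa using hv)).continuousAt
    exact ContinuousAt.comp (f := fun x : ℝ => (x : ℂ) + v * Complex.I) this (by fun_prop)
  have hb : ∀ v : ℝ, 0 < v → ∀ x : ℝ, ‖F (x + v * Complex.I) ^ 4‖ ≤ K ^ 4 * (1 + x ^ 2)⁻¹ := by
    intro v hv x
    rw [norm_pow]
    apply aux_pow_bound (norm_nonneg _)
    simpa using hK (x + v * Complex.I) (by simpa using hv)
  have hev : ∀ᶠ v : ℝ in 𝓝[>] 0, 0 < v := self_mem_nhdsWithin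
  have hlim := tendsto_integral_filter_of_dominated_convergence (l := 𝓝[>] (0:ℝ)) (μ := volume)
    (F := fun y x => F ((x : ℝ) + y * Complex.I) ^ 4)
    (f := fun x : ℝ => ((f x : ℂ) + g x * Complex.I) ^ 4) (fun x : ℝ => K ^ 4 * (1 + x ^ 2)⁻¹)
    (by filter_upwards [hev] with v hv using ((hcont v hv).pow 4).aestronglyMeasurable)
    (by filter_upwards [hev] with v hv using Eventually.of_forall (hb v hv))
    (aux_dom K) (Eventually.of_forall fun x => (hl x).pow 4)
  have hzero : ∫ x : ℝ, ((f x : ℂ) + g x * Complex.I) ^ 4 = 0 := by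
    refine tendsto_nhds_unique hlim (tendsto_const_nhds.congr' ?_)
    filter_upwards [hev] with v hv using (aux_contour F K C hd hK hC v hv).symm
  have hPb : ∀ x : ℝ, ‖(f x : ℂ) + g x * Complex.I‖ ^ 4 ≤ K ^ 4 * (1 + x ^ 2)⁻¹ := by
    intro x
    refine le_of_tendsto ((hl x).norm.pow 4) ?_
    filter_upwards [hev] with v hv
    simpa using hb v hv x
  have hgm : AEStronglyMeasurable g volume := by
    obtain ⟨u, -, hu0, hu⟩ := exists_seq_strictAnti_tendsto (0:ℝ)
    refine aestronglyMeasurable_of_tendsto_ae atTop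
      (f := fun n x => (F ((x : ℝ) + u n * Complex.I)).im) ?_ ?_
    · exact fun n => (Complex.continuous_im.comp (hcont _ (hu0 n))).aestronglyMeasurable
    · refine Eventually.of_forall fun x => ?_
      have h1 := (hl x).comp (tendsto_nhdsWithin_iff.2 ⟨hu, Eventually.of_forall hu0⟩)
      have h2 := (Complex.continuous_im.tendsto _).comp h1
      simpa [Function.comp_def] using h2
  have hfb : ∀ x, |f x| ≤ ‖(f x : ℂ) + g x * Complex.I‖ := fun x => by
    simpa using Complex.abs_re_le_norm ((f x : ℂ) + g x * Complex.I)
  have hgb : ∀ x, |g x| ≤ ‖(f x : ℂ) + g x * Complex.I‖ := fun x => by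
    simpa using Complex.abs_im_le_norm ((f x : ℂ) + g x * Complex.I)
  have hf4 : Integrable (fun x => f x ^ 4) := by
    refine (aux_dom K).mono' (hfm.pow 4).aestronglyMeasurable (Eventually.of_forall fun x => ?_)
    rw [norm_pow, Real.norm_eq_abs]
    exact (pow_le_pow_left₀ (abs_nonneg _) (hfb x) 4).trans (hPb x)
  have hg4 : Integrable (fun x => g x ^ 4) := by
    refine (aux_dom K).mono' (hgm.pow 4) (Eventually.of_forall fun x => ?_)
    rw [norm_pow, Real.norm_eq_abs]
    exact (pow_le_pow_left₀ (abs_nonneg _) (hgb x) 4).trans (hPb x)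
  have hP : Integrable (fun x : ℝ => ((f x : ℂ) + g x * Complex.I) ^ 4) := by
    refine (aux_dom K).mono' ?_ (Eventually.of_forall fun x => ?_)
    · refine AEStronglyMeasurable.pow ?_ 4
      exact (Complex.continuous_ofReal.comp_aestronglyMeasurable hfm.aestronglyMeasurable).add
        ((Complex.continuous_ofReal.comp_aestronglyMeasurable hgm).mul_const _)
    · rw [norm_pow]; exact hPb x
  have hre : ∫ x : ℝ, (((f x : ℂ) + g x * Complex.I) ^ 4).re = 0 := by
    have := integral_re (𝕜 := ℂ) hP
    simp only [RCLike.re_eq_complex_re] at this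
    rw [this, hzero]; simp
  have hle : ∫ x : ℝ, ((1/2) * g x ^ 4 - 17 * f x ^ 4) ≤
      ∫ x : ℝ, (((f x : ℂ) + g x * Complex.I) ^ 4).re := by
    refine integral_mono ((hg4.const_mul _).sub (hf4.const_mul _)) hP.re fun x => ?_
    have : (((f x : ℂ) + g x * Complex.I) ^ 4).re = f x ^ 4 - 6 * f x ^ 2 * g x ^ 2 + g x ^ 4 := by
      simp [pow_succ]; ring
    simp only [this]
    nlinarith [sq_nonneg (6 * f x ^ 2 - g x ^ 2)]
  rw [hre, integral_sub (hg4.const_mul _) (hf4.const_mul _), integral_const_mul, integral_const_mul] at hle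
  linarith

/-- Cauchy-type integral of `f`. -/
noncomputable def cauchyF (f : ℝ → ℝ) (z : ℂ) : ℂ :=
  (Complex.I / Real.pi) * ∫ s : ℝ, (f s : ℂ) * (z - s)⁻¹

lemma aux_norm_inv {z : ℂ} (hz : 0 < z.im) (s : ℝ) : ‖(z - s)⁻¹‖ ≤ z.im⁻¹ := by
  rw [norm_inv]
  gcongr
  have := Complex.abs_im_le_norm (z - s)
  simp at this
  exact (le_abs_self _).trans this

lemma aux_ne {z : ℂ} (hz : 0 < z.im) (s : ℝ) : z - s ≠ 0 := by
  intro h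
  have := congrArg Complex.im h
  simp at this
  exact hz.ne' this

lemma aux_cont_inv {z : ℂ} (hz : 0 < z.im) : Continuous (fun s : ℝ => (z - s)⁻¹) :=
  Continuous.inv₀ (by fun_prop) (aux_ne hz)

lemma cauchyF_diff (f : ℝ → ℝ) (hf : Continuous f) (hi : Integrable f) (z : ℂ) (hz : 0 < z.im) :
    DifferentiableAt ℂ (cauchyF f) z := by
  have hball : ∀ w ∈ Metric.ball z (z.im / 2), z.im / 2 < w.im := by
    intro w hw
    rw [Metric.mem_ball, dist_eq_norm] at hw
    have h1 := (Complex.abs_im_le_norm (w - z)).trans_lt hw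
    simp only [Complex.sub_im, abs_lt] at h1
    linarith [h1.1]
  have hev : ∀ᶠ w in 𝓝 z, 0 < w.im := (Complex.continuous_im.tendsto z).eventually_const_lt hz
  have hm : ∀ w : ℂ, 0 < w.im → Continuous (fun s : ℝ => (f s : ℂ) * (w - s)⁻¹) := fun w hw =>
    (Complex.continuous_ofReal.comp hf).mul (aux_cont_inv hw)
  have := hasDerivAt_integral_of_dominated_loc_of_deriv_le (μ := volume) (𝕜 := ℂ)
    (F := fun (w : ℂ) (s : ℝ) => (f s : ℂ) * (w - s)⁻¹) (x₀ := z)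
    (F' := fun (w : ℂ) (s : ℝ) => (f s : ℂ) * (-((w - s)⁻¹ ^ 2)))
    (bound := fun s => |f s| * ((z.im / 2)⁻¹ ^ 2))
    (Metric.ball_mem_nhds z (half_pos hz))
    (by filter_upwards [hev] with w hw using (hm w hw).aestronglyMeasurable)
    (by
      refine (hi.abs.mul_const (z.im⁻¹)).mono' (hm z hz).aestronglyMeasurable
        (Eventually.of_forall fun s => ?_)
      rw [norm_mul, Complex.norm_real, Real.norm_eq_abs]
      gcongr
      exact aux_norm_inv hz s)
    ((Complex.continuous_ofReal.comp hf).mul ((aux_cont_inv hz).pow 2).neg).aestronglyMeasurable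
    (by
      refine Eventually.of_forall fun s w hw => ?_
      have h1 := hball w hw
      have h2 : 0 < w.im := (half_pos hz).trans h1
      rw [norm_mul, Complex.norm_real, Real.norm_eq_abs, norm_neg, norm_pow]
      gcongr
      exact (aux_norm_inv h2 s).trans (by gcongr))
    (hi.abs.mul_const _)
    (by
      refine Eventually.of_forall fun s w hw => ?_
      have h2 : 0 < w.im := (half_pos hz).trans (hball w hw)
      have h3 : HasDerivAt (fun w : ℂ => w - s) 1 w := (hasDerivAt_id w).sub_const _
      have h4 := (h3.inv (aux_ne h2 s)).const_mul (f s : ℂ)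
      have h5 : (f s : ℂ) * (-1 / (w - s) ^ 2) = (f s : ℂ) * (-((w - s)⁻¹ ^ 2)) := by
        rw [inv_pow, neg_div, one_div]
      rw [h5] at h4
      exact h4)
  exact (this.2.differentiableAt).const_mul _

/-- Symmetrization against an odd bounded kernel. -/
lemma aux_symm (f k : ℝ → ℝ) (hi : Integrable f) (hk : Measurable k) (B : ℝ)
    (hB : ∀ t, |k t| ≤ B) (hodd : ∀ t, k (-t) = - k t) (x : ℝ) :
    ∫ t, f (x - t) * k t = (1/2) * ∫ t, (f (x - t) - f (x + t)) * k t := by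
  have h1 : Integrable (fun t => f (x - t) * k t) :=
    (hi.comp_sub_left x).mul_bdd hk.aestronglyMeasurable (Eventually.of_forall hB)
  have h2 := h1.comp_neg
  have h3 : ∫ t, (f (x - t) - f (x + t)) * k t =
      ∫ t, (f (x - t) * k t + f (x - -t) * k (-t)) := by
    congr 1; ext t; rw [hodd, sub_neg_eq_add]; ring
  rw [h3, integral_add h1 h2, integral_neg_eq_self (fun t => f (x - t) * k t)]
  ring

section quot
variable (f : ℝ → ℝ) (hf : Continuous f) (L R : ℝ) (hL : ∀ a b, |f a - f b| ≤ L * |a - b|)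
  (hR : ∀ s, R < |s| → f s = 0)

lemma aux_d_bound (hL0 : 0 ≤ L) (hL : ∀ a b, |f a - f b| ≤ L * |a - b|)
  (hR : ∀ s, R < |s| → f s = 0) (x t : ℝ) : |(f (x - t) - f (x + t)) * t⁻¹| ≤
    (Set.Icc (-(R + |x|)) (R + |x|)).indicator (fun _ => 2 * L) t := by
  by_cases ht : t ∈ Set.Icc (-(R + |x|)) (R + |x|)
  · rw [Set.indicator_of_mem ht, abs_mul, abs_inv]
    rcases eq_or_ne t 0 with rfl | h0
    · simp; exact hL0
    · have : 0 < |t| := abs_pos.2 h0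
      rw [← div_eq_mul_inv, div_le_iff₀ this]
      refine (hL _ _).trans_eq ?_
      have : x - t - (x + t) = -(2 * t) := by ring
      rw [this, abs_neg, abs_mul, abs_two]; ring
  · rw [Set.indicator_of_notMem ht]
    have ht' : R + |x| < |t| := by
      by_contra h
      exact ht (abs_le.1 (not_lt.1 h))
    have a1 : |t| ≤ |x - t| + |x| := by
      have := abs_sub_abs_le_abs_sub t x
      rw [abs_sub_comm] at this; linarith
    have a2 : |t| ≤ |x + t| + |x| := by
      have := abs_sub (x + t) x
      simpa using this
    rw [hR (x - t) (by linarith), hR (x + t) (by linarith)]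
    simp

lemma aux_d_int (hf : Continuous f) (hL0 : 0 ≤ L) (hL : ∀ a b, |f a - f b| ≤ L * |a - b|)
    (hR : ∀ s, R < |s| → f s = 0) (x : ℝ) :
    Integrable (fun t => (f (x - t) - f (x + t)) * t⁻¹) := by
  have : Integrable ((Set.Icc (-(R + |x|)) (R + |x|)).indicator (fun _ => 2 * L)) :=
    (integrable_indicator_iff measurableSet_Icc).2 (integrableOn_const (by simp [Real.volume_Icc]))
  refine this.mono' ?_ (Eventually.of_forall fun t => aux_d_bound f L R hL0 hL hR x t)
  exact (Measurable.mul (by fun_prop) measurable_inv).aestronglyMeasurable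

lemma aux_d_le (hf : Continuous f) (hL0 : 0 ≤ L) (hR0 : 0 ≤ R)
    (hL : ∀ a b, |f a - f b| ≤ L * |a - b|)
    (hR : ∀ s, R < |s| → f s = 0) (x : ℝ) :
    ∫ t, |(f (x - t) - f (x + t)) * t⁻¹| ≤ 4 * L * (R + |x|) := by
  have h1 : Integrable ((Set.Icc (-(R + |x|)) (R + |x|)).indicator (fun _ => 2 * L)) :=
    (integrable_indicator_iff measurableSet_Icc).2 (integrableOn_const (by simp [Real.volume_Icc]))
  refine (integral_mono (aux_d_int f L R hf hL0 hL hR x).abs h1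
    (fun t => aux_d_bound f L R hL0 hL hR x t)).trans_eq ?_
  rw [integral_indicator measurableSet_Icc, setIntegral_const]
  have : 0 ≤ R + |x| := by positivity
  rw [Real.volume_real_Icc_of_le (by linarith), smul_eq_mul]
  ring
end quot

lemma aux_k_lim (f : ℝ → ℝ) (hf : Continuous f) (k : ℝ → ℝ → ℝ) (x : ℝ)
    (hdi : Integrable (fun t => (f (x - t) - f (x + t)) * t⁻¹))
    (hk : ∀ y, 0 < y → Measurable (k y))
    (hb : ∀ y, 0 < y → ∀ t, |k y t| ≤ |t⁻¹|)
    (hl : ∀ t, t ≠ 0 → Tendsto (fun y => k y t) (𝓝[>] 0) (𝓝 t⁻¹)) :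
    Tendsto (fun y => ∫ t, (f (x - t) - f (x + t)) * k y t) (𝓝[>] 0)
      (𝓝 (∫ t, (f (x - t) - f (x + t)) * t⁻¹)) := by
  have hev : ∀ᶠ v : ℝ in 𝓝[>] 0, 0 < v := self_mem_nhdsWithin
  apply tendsto_integral_filter_of_dominated_convergence
    (fun t => |(f (x - t) - f (x + t)) * t⁻¹|)
  · filter_upwards [hev] with y hy
    exact (Measurable.mul (by fun_prop) (hk y hy)).aestronglyMeasurable
  · filter_upwards [hev] with y hy
    refine Eventually.of_forall fun t => ?_
    rw [Real.norm_eq_abs, abs_mul, abs_mul]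
    exact mul_le_mul_of_nonneg_left (hb y hy t) (abs_nonneg _)
  · exact hdi.abs
  · refine Eventually.of_forall fun t => ?_
    rcases eq_or_ne t 0 with rfl | h0
    · simp
    · exact (hl t h0).const_mul _

lemma aux_pv (f : ℝ → ℝ) (hf : Continuous f) (hi : Integrable f) (x : ℝ)
    (hdi : Integrable (fun t => (f (x - t) - f (x + t)) * t⁻¹)) :
    Tendsto (fun ε : ℝ => ∫ s in {s : ℝ | ε < |s - x|}, f s / (x - s)) (𝓝[>] 0)
      (𝓝 ((1/2) * ∫ t, (f (x - t) - f (x + t)) * t⁻¹)) := by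
  have hev : ∀ᶠ v : ℝ in 𝓝[>] 0, 0 < v := self_mem_nhdsWithin
  have hms : ∀ ε : ℝ, MeasurableSet {t : ℝ | ε < |t|} := fun ε =>
    measurableSet_lt measurable_const (by fun_prop)
  have h1 := (aux_k_lim f hf (fun ε => Set.indicator {t : ℝ | ε < |t|} (fun t => t⁻¹)) x hdi
    (fun ε _ => measurable_inv.indicator (hms ε))
    (fun ε _ t => by
      by_cases h : t ∈ {t : ℝ | ε < |t|}
      · rw [Set.indicator_of_mem h]
      · rw [Set.indicator_of_notMem h]; simp)
    (fun t ht => by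
      refine tendsto_const_nhds.congr' ?_
      have : ∀ᶠ ε : ℝ in 𝓝[>] 0, ε < |t| :=
        nhdsWithin_le_nhds (eventually_lt_nhds (abs_pos.2 ht))
      filter_upwards [this] with ε hε
      rw [Set.indicator_of_mem]; exact hε)).const_mul (1/2 : ℝ)
  refine h1.congr' ?_
  filter_upwards [hev] with ε hε
  rw [← aux_symm f _ hi (measurable_inv.indicator (hms ε)) ε⁻¹ ?_ ?_ x]
  · have hms' : MeasurableSet {s : ℝ | ε < |s - x|} := measurableSet_lt measurable_const (by fun_prop)
    rw [← integral_indicator hms', ← integral_sub_left_eq_self (Set.indicator _ _) _ x]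
    congr 1; ext t
    by_cases h : ε < |t|
    · rw [Set.indicator_of_mem (by exact h), Set.indicator_of_mem (by simpa using h)]
      simp [div_eq_mul_inv]
    · rw [Set.indicator_of_notMem (by exact h), Set.indicator_of_notMem (by simpa using h)]
      simp
  · intro t
    by_cases h : ε < |t|
    · rw [Set.indicator_of_mem (by exact h), abs_inv]; gcongr
    · rw [Set.indicator_of_notMem (by exact h)]; simp; exact hε.le
  · intro t
    by_cases h : ε < |t|
    · rw [Set.indicator_of_mem (by simpa using h), Set.indicator_of_mem (by exact h), inv_neg]
    · rw [Set.indicator_of_notMem (by simpa using h), Set.indicator_of_notMem (by exact h)]; simp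

lemma aux_q_meas (y : ℝ) : Measurable (fun t : ℝ => t / (t ^ 2 + y ^ 2)) := by fun_prop

lemma aux_q_inv (y t : ℝ) : |t / (t ^ 2 + y ^ 2)| ≤ |t⁻¹| := by
  rcases eq_or_ne t 0 with rfl | h0
  · simp
  · have : 0 < t ^ 2 := by positivity
    rw [abs_div, abs_inv, abs_of_pos (by positivity : 0 < t ^ 2 + y ^ 2),
      div_le_iff₀ (by positivity), ← sq_abs t, inv_mul_eq_div, le_div_iff₀ (abs_pos.2 h0)]
    nlinarith [sq_nonneg y]

lemma aux_q_bdd (y : ℝ) (hy : 0 < y) (t : ℝ) : |t / (t ^ 2 + y ^ 2)| ≤ y⁻¹ := by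
  rw [abs_div, abs_of_pos (by positivity : 0 < t ^ 2 + y ^ 2),
      div_le_iff₀ (by positivity), ← sq_abs t, inv_mul_eq_div, le_div_iff₀ hy]
  nlinarith [sq_nonneg (|t| - y), abs_nonneg t]

lemma aux_poisson (f : ℝ → ℝ) (x y : ℝ) (hy : 0 < y) :
    ∫ t, f (x - t) * (y / (t ^ 2 + y ^ 2)) = ∫ u, f (x - y * u) * (1 + u ^ 2)⁻¹ := by
  have h := Measure.integral_comp_mul_left (fun t => f (x - t) * (y / (t ^ 2 + y ^ 2))) y
  rw [abs_of_pos (inv_pos.2 hy), smul_eq_mul, eq_inv_mul_iff_mul_eq₀ hy.ne'] at h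
  rw [← h, ← integral_const_mul]
  congr 1; ext u
  have : (0:ℝ) < 1 + u ^ 2 := by positivity
  field_simp
  ring

lemma cauchyF_eq (f : ℝ → ℝ) (hi : Integrable f) (x y : ℝ) (hy : 0 < y) :
    cauchyF f (x + y * Complex.I) =
      ((Real.pi⁻¹ * ∫ u, f (x - y * u) * (1 + u ^ 2)⁻¹ : ℝ) : ℂ) +
      ((Real.pi⁻¹ * ((1/2) * ∫ t, (f (x - t) - f (x + t)) * (t / (t ^ 2 + y ^ 2))) : ℝ) : ℂ)
        * Complex.I := by
  rw [← aux_poisson f x y hy, ← aux_symm f _ hi (aux_q_meas y) y⁻¹ (aux_q_bdd y hy)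
    (fun t => by rw [neg_sq, neg_div]) x]
  have i1 : Integrable (fun t => f (x - t) * (t / (t ^ 2 + y ^ 2))) :=
    (hi.comp_sub_left x).mul_bdd (aux_q_meas y).aestronglyMeasurable
      (Eventually.of_forall (aux_q_bdd y hy))
  have i2 : Integrable (fun t => f (x - t) * (y / (t ^ 2 + y ^ 2))) := by
    refine (hi.comp_sub_left x).mul_bdd (c := y⁻¹) (Measurable.aestronglyMeasurable (by fun_prop)) (Eventually.of_forall fun t => ?_)
    rw [Real.norm_eq_abs, abs_div, abs_of_pos (by positivity : 0 < t ^ 2 + y ^ 2), abs_of_pos hy,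
      div_le_iff₀ (by positivity), inv_mul_eq_div, le_div_iff₀ hy]
    nlinarith [sq_nonneg t]
  have key : ∫ s : ℝ, (f s : ℂ) * ((x + y * Complex.I : ℂ) - s)⁻¹ =
      ((∫ t, f (x - t) * (t / (t ^ 2 + y ^ 2)) : ℝ) : ℂ) -
      ((∫ t, f (x - t) * (y / (t ^ 2 + y ^ 2)) : ℝ) : ℂ) * Complex.I := by
    rw [← integral_sub_left_eq_self _ _ x, ← integral_complex_ofReal, ← integral_complex_ofReal,
      ← integral_mul_const, ← integral_sub i1.ofReal (i2.ofReal.mul_const _)]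
    congr 1; ext t
    have h1 : (x + y * Complex.I : ℂ) - ((x - t : ℝ) : ℂ) = t + y * Complex.I := by
      push_cast; ring
    have hp : 0 < t ^ 2 + y ^ 2 := by positivity
    have h2 : ((t : ℂ) ^ 2 + y ^ 2) ≠ 0 := by exact_mod_cast hp.ne'
    have h3 : (t + y * Complex.I : ℂ) * (t - y * Complex.I) = t ^ 2 + y ^ 2 := by
      linear_combination (-(y:ℂ)^2) * Complex.I_sq
    have h4 : (t + y * Complex.I : ℂ)⁻¹ = (t - y * Complex.I) / (t ^ 2 + y ^ 2) := by
      rw [inv_eq_iff_eq_inv, inv_div, eq_div_iff, h3]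
      intro h0; rw [h0, mul_zero] at h3; exact h2 h3.symm
    rw [h1, h4]
    push_cast
    ring
  rw [cauchyF, key]
  push_cast
  linear_combination (-(Real.pi : ℂ)⁻¹ * (∫ t, f (x - t) * (y / (t ^ 2 + y ^ 2)) : ℝ)) * Complex.I_sq

lemma cauchyF_lim (f : ℝ → ℝ) (hf : Continuous f) (hi : Integrable f) (M : ℝ)
    (hM : ∀ s, |f s| ≤ M) (x : ℝ)
    (hdi : Integrable (fun t => (f (x - t) - f (x + t)) * t⁻¹)) :
    Tendsto (fun y : ℝ => cauchyF f (x + y * Complex.I)) (𝓝[>] 0)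
      (𝓝 ((f x : ℂ) + ((Real.pi⁻¹ * ((1/2) * ∫ t, (f (x - t) - f (x + t)) * t⁻¹) : ℝ) : ℂ)
        * Complex.I)) := by
  have hev : ∀ᶠ v : ℝ in 𝓝[>] 0, 0 < v := self_mem_nhdsWithin
  have h1 := aux_k_lim f hf (fun y t => t / (t ^ 2 + y ^ 2)) x hdi (fun y _ => aux_q_meas y)
    (fun y _ t => aux_q_inv y t) (fun t ht => by
      have : ContinuousAt (fun y : ℝ => t / (t ^ 2 + y ^ 2)) 0 := by
        refine ContinuousAt.div (by fun_prop) (by fun_prop) ?_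
        simpa using ht
      have h2 := this.tendsto
      have h3 : t / (t ^ 2 + 0 ^ 2) = t⁻¹ := by field_simp; ring
      rw [h3] at h2
      exact h2.mono_left nhdsWithin_le_nhds)
  have h2 : Tendsto (fun y : ℝ => ∫ u, f (x - y * u) * (1 + u ^ 2)⁻¹) (𝓝[>] 0)
      (𝓝 (∫ u : ℝ, f x * (1 + u ^ 2)⁻¹)) := by
    apply tendsto_integral_filter_of_dominated_convergence (fun u : ℝ => M * (1 + u ^ 2)⁻¹)
    · refine Eventually.of_forall fun y => ?_
      exact (Measurable.mul (by fun_prop) (by fun_prop)).aestronglyMeasurable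
    · refine Eventually.of_forall fun y => Eventually.of_forall fun u => ?_
      rw [norm_mul, Real.norm_eq_abs, Real.norm_eq_abs, abs_of_pos (by positivity : 0 < (1 + u ^ 2)⁻¹)]
      gcongr
      exact hM _
    · exact integrable_inv_one_add_sq.const_mul _
    · refine Eventually.of_forall fun u => ?_
      have : Continuous (fun y : ℝ => f (x - y * u) * (1 + u ^ 2)⁻¹) := by fun_prop
      have h := this.tendsto 0
      simp only [zero_mul, sub_zero] at h
      exact h.mono_left nhdsWithin_le_nhds
  rw [integral_const_mul, integral_univ_inv_one_add_sq] at h2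
  have h3 := (Complex.continuous_ofReal.tendsto _).comp (h2.const_mul Real.pi⁻¹)
  have h4 := (Complex.continuous_ofReal.tendsto _).comp ((h1.const_mul (1/2 : ℝ)).const_mul Real.pi⁻¹)
  have h5 := h3.add (h4.mul_const Complex.I)
  have h6 : Real.pi⁻¹ * (f x * Real.pi) = f x := by field_simp
  rw [h6] at h5
  refine h5.congr' ?_
  filter_upwards [hev] with y hy
  rw [cauchyF_eq f hi x y hy]
  rfl

lemma cauchyF_decay (f : ℝ → ℝ) (hi : Integrable f) (z : ℂ) (hz : 0 < z.im) :
    ‖cauchyF f z‖ ≤ (∫ s, |f s|) / z.im := by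
  have h1 : ‖∫ s : ℝ, (f s : ℂ) * (z - s)⁻¹‖ ≤ ∫ s, |f s| * z.im⁻¹ := by
    refine norm_integral_le_of_norm_le (hi.abs.mul_const _) (Eventually.of_forall fun s => ?_)
    rw [norm_mul, Complex.norm_real, Real.norm_eq_abs]
    gcongr
    exact aux_norm_inv hz s
  rw [integral_mul_const, ← div_eq_mul_inv] at h1
  have h2 : ‖Complex.I / (Real.pi : ℂ)‖ ≤ 1 := by
    rw [norm_div, Complex.norm_I, Complex.norm_real, Real.norm_eq_abs, abs_of_pos Real.pi_pos,
      div_le_one Real.pi_pos]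
    linarith [Real.pi_gt_three]
  rw [cauchyF, norm_mul]
  calc _ ≤ 1 * ‖∫ s : ℝ, (f s : ℂ) * (z - s)⁻¹‖ := by gcongr
    _ ≤ _ := by rw [one_mul]; exact h1

lemma cauchyF_far (f : ℝ → ℝ) (hi : Integrable f) (R : ℝ) (hR0 : 0 < R)
    (hR : ∀ s, R < |s| → f s = 0) (z : ℂ) (hz : 2 * R ≤ |z.re|) :
    ‖cauchyF f z‖ ≤ (∫ s, |f s|) * (2 / |z.re|) := by
  have hp : 0 < |z.re| := by linarith
  have h1 : ‖∫ s : ℝ, (f s : ℂ) * (z - s)⁻¹‖ ≤ ∫ s, |f s| * (2 / |z.re|) := by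
    refine norm_integral_le_of_norm_le (hi.abs.mul_const _) (Eventually.of_forall fun s => ?_)
    rw [norm_mul, Complex.norm_real, Real.norm_eq_abs]
    by_cases hs : R < |s|
    · simp [hR s hs]
    · gcongr
      have h3 := Complex.abs_re_le_norm (z - s)
      simp only [Complex.sub_re, Complex.ofReal_re] at h3
      have h4 := abs_sub_abs_le_abs_sub z.re s
      rw [norm_inv, ← inv_div]
      gcongr
      linarith
  rw [integral_mul_const] at h1
  have h2 : ‖Complex.I / (Real.pi : ℂ)‖ ≤ 1 := by
    rw [norm_div, Complex.norm_I, Complex.norm_real, Real.norm_eq_abs, abs_of_pos Real.pi_pos,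
      div_le_one Real.pi_pos]
    linarith [Real.pi_gt_three]
  rw [cauchyF, norm_mul]
  calc _ ≤ 1 * ‖∫ s : ℝ, (f s : ℂ) * (z - s)⁻¹‖ := by gcongr
    _ ≤ _ := by rw [one_mul]; exact h1

lemma cauchyF_near (f : ℝ → ℝ) (hf : Continuous f) (hi : Integrable f) (M L R : ℝ)
    (hM : ∀ s, |f s| ≤ M) (hL0 : 0 ≤ L) (hR0 : 0 < R)
    (hL : ∀ a b, |f a - f b| ≤ L * |a - b|)
    (hR : ∀ s, R < |s| → f s = 0) (x y : ℝ) (hy : 0 < y) :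
    ‖cauchyF f (x + y * Complex.I)‖ ≤ M + 4 * L * (R + |x|) := by
  rw [cauchyF_eq f hi x y hy]
  have hpi : 0 < Real.pi⁻¹ := inv_pos.2 Real.pi_pos
  have hpi1 : Real.pi⁻¹ ≤ 1 := inv_le_one_of_one_le₀ (by linarith [Real.pi_gt_three])
  refine (norm_add_le _ _).trans (add_le_add ?_ ?_)
  · rw [Complex.norm_real, norm_mul, Real.norm_of_nonneg hpi.le]
    have : ‖∫ u, f (x - y * u) * (1 + u ^ 2)⁻¹‖ ≤ ∫ u : ℝ, M * (1 + u ^ 2)⁻¹ := by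
      refine norm_integral_le_of_norm_le (integrable_inv_one_add_sq.const_mul _)
        (Eventually.of_forall fun u => ?_)
      rw [norm_mul, Real.norm_eq_abs, Real.norm_eq_abs, abs_of_pos (by positivity : 0 < (1 + u ^ 2)⁻¹)]
      gcongr
      exact hM _
    rw [integral_const_mul, integral_univ_inv_one_add_sq] at this
    calc _ ≤ Real.pi⁻¹ * (M * Real.pi) := by gcongr
      _ = M := by field_simp
  · rw [norm_mul, Complex.norm_I, mul_one, Complex.norm_real, norm_mul, norm_mul,
      Real.norm_of_nonneg hpi.le]
    have : ‖∫ t, (f (x - t) - f (x + t)) * (t / (t ^ 2 + y ^ 2))‖ ≤ 4 * L * (R + |x|) := by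
      refine (norm_integral_le_of_norm_le (aux_d_int f L R hf hL0 hL hR x).abs
        (Eventually.of_forall fun t => ?_)).trans (aux_d_le f L R hf hL0 hR0.le hL hR x)
      rw [Real.norm_eq_abs, abs_mul, abs_mul]
      exact mul_le_mul_of_nonneg_left (aux_q_inv y t) (abs_nonneg _)
    have h2 : ‖(1/2 : ℝ)‖ ≤ 1 := by norm_num
    calc _ ≤ 1 * (1 * (4 * L * (R + |x|))) := by gcongr
      _ = _ := by ring

theorem riesz_L4_inequality (f : ℝ → ℝ) (hf : ContDiff ℝ (⊤ : ℕ∞) f) (hsupp : HasCompactSupport f)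
    (Hf : ℝ → ℝ)
    (hH : ∀ x : ℝ, Tendsto (fun ε : ℝ =>
        (Real.pi)⁻¹ * ∫ s in {s : ℝ | ε < |s - x|}, f s / (x - s))
      (𝓝[>] 0) (𝓝 (Hf x))) :
    ∫ x : ℝ, (Hf x) ^ 4 ≤ 34 * ∫ x : ℝ, (f x) ^ 4 := by
  have hc : Continuous f := hf.continuous
  have hi : Integrable f := hc.integrable_of_hasCompactSupport hsupp
  obtain ⟨L, hLip⟩ := hf.lipschitzWith_of_hasCompactSupport hsupp (by simp)
  have hL : ∀ a b, |f a - f b| ≤ (L : ℝ) * |a - b| := fun a b => by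
    simpa [Real.dist_eq] using hLip.dist_le_mul a b
  have hL0 : (0:ℝ) ≤ L := L.2
  obtain ⟨M, hM⟩ := hsupp.exists_bound_of_continuous hc
  have hM : ∀ s, |f s| ≤ M := hM
  obtain ⟨R, hR0, hR⟩ : ∃ R : ℝ, 0 < R ∧ ∀ s, R < |s| → f s = 0 := by
    obtain ⟨R, hR0, hR⟩ := hsupp.exists_pos_le_norm
    exact ⟨R, hR0, fun s hs => hR s hs.le⟩
  have hM0 : 0 ≤ M := (abs_nonneg _).trans (hM 0)
  have hdi := fun x => aux_d_int f L R hc hL0 hL hR x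
  have hHeq : ∀ x, Hf x = Real.pi⁻¹ * ((1/2) * ∫ t, (f (x - t) - f (x + t)) * t⁻¹) := fun x =>
    tendsto_nhds_unique (hH x) ((aux_pv f hc hi x (hdi x)).const_mul _)
  set A := ∫ s, |f s| with hA
  have hA0 : 0 ≤ A := integral_nonneg fun s => abs_nonneg _
  refine aux_final f Hf (max ((1 + 2 * R) * (M + 4 * L * (R + 2 * R))) (A * (R⁻¹ + 2)))
    (cauchyF f) hc (cauchyF_diff f hc hi) ?_ A (cauchyF_decay f hi) ?_
  · intro z hz
    rcases le_total (2 * R) |z.re| with h | h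
    · refine le_trans ?_ (le_max_right _ _)
      have hp : 0 < |z.re| := by linarith
      calc (1 + |z.re|) * ‖cauchyF f z‖ ≤ (1 + |z.re|) * (A * (2 / |z.re|)) := by
            gcongr; exact cauchyF_far f hi R hR0 hR z h
        _ = A * (2 / |z.re| + 2) := by field_simp
        _ ≤ A * (2 / (2 * R) + 2) := by gcongr
        _ = _ := by field_simp
    · refine le_trans ?_ (le_max_left _ _)
      have h1 := cauchyF_near f hc hi M L R hM hL0 hR0 hL hR z.re z.im hz
      rw [Complex.re_add_im] at h1
      calc (1 + |z.re|) * ‖cauchyF f z‖ ≤ (1 + 2 * R) * (M + 4 * L * (R + |z.re|)) := by gcongr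
        _ ≤ _ := by gcongr
  · intro x
    rw [hHeq]
    exact cauchyF_lim f hc hi M hM x (hdi x)
end

section
/- Let r ∈ L^∞(ℝ) with ‖r‖_∞ < 1, and fix x, t ∈ ℝ. With τ(z) = xz + 4tz³, define ω^−(z) = [[0, −conj(r(z)) e^{−2iτ(z)}],[0,0]] and ω^+(z) = [[0,0],[r(z) e^{2iτ(z)}, 0]], and let C_ω h = C^+(h ω^−) + C^−(h ω^+) acting on L²(ℝ; 2×2 complex matrices) with the Hilbert–Schmidt matrix norm. Then ‖C_ω‖_{L²→L²} ≤ ‖r‖_∞ < 1; in particular 1 − C_ω is invertible on L²(ℝ; 2×2 matrices) with ‖(1−C_ω)^{−1}‖ ≤ 1/(1−‖r‖_∞). -/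
open MeasureTheory Filter Topology Complex

/-- The Cauchy transform `Cf(z) = (1/(2πi)) ∫_ℝ f(s)/(s-z) ds`. -/
noncomputable def cauchyE (f : ℝ → ℂ) (z : ℂ) : ℂ :=
  (2 * (Real.pi : ℂ) * Complex.I)⁻¹ * ∫ s : ℝ, f s / ((s : ℂ) - z)

/-- Entrywise Cauchy transform of a matrix-valued function. -/
noncomputable def cauchyM {n : ℕ} (h : ℝ → Matrix (Fin n) (Fin n) ℂ) (z : ℂ) :
    Matrix (Fin n) (Fin n) ℂ :=
  Matrix.of fun i j => cauchyE (fun s => h s i j) z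

/-- The lower-triangular factor `ω^-` for the MKdV jump matrix. -/
noncomputable def mkdvOmegaMinus (r : ℝ → ℂ) (x t : ℝ) (z : ℝ) : Matrix (Fin 2) (Fin 2) ℂ :=
  !![0, -(starRingEnd ℂ) (r z) *
        Complex.exp (-(2 * Complex.I * ((x * z + 4 * t * z ^ 3 : ℝ) : ℂ))); 0, 0]

/-- The upper-triangular factor `ω^+` for the MKdV jump matrix. -/
noncomputable def mkdvOmegaPlus (r : ℝ → ℂ) (x t : ℝ) (z : ℝ) : Matrix (Fin 2) (Fin 2) ℂ :=
  !![0, 0; r z * Complex.exp (2 * Complex.I * ((x * z + 4 * t * z ^ 3 : ℝ) : ℂ)), 0]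

attribute [local instance] Matrix.frobeniusNormedAddCommGroup Matrix.frobeniusNormedSpace


open FourierTransform in
lemma aux_fourier_flip (f g : ℝ → ℂ) (hf : Integrable f) (hg : Integrable g) :
    ∫ ξ, 𝓕 f ξ * g ξ = ∫ s, f s * 𝓕 g s := by
  have h := VectorFourier.integral_fourierIntegral_smul_eq_flip (L := innerₗ ℝ) (μ := volume)
    (ν := volume) Real.continuous_fourierChar continuous_inner hf hg
  simpa using! h

open FourierTransform in
lemma aux_continuous_fourier (f : ℝ → ℂ) (hf : Integrable f) : Continuous (𝓕 f) :=
  VectorFourier.fourierIntegral_continuous Real.continuous_fourierChar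
    (L := innerₗ ℝ) continuous_inner hf

open FourierTransform in
lemma aux_plancherel (g : ℝ → ℂ) (h1 : Integrable g) (h2 : MemLp g 2 volume) :
    eLpNorm (𝓕 g) 2 volume = eLpNorm g 2 volume := by
  set G : Lp (α := ℝ) ℂ 2 volume := h2.toLp g with hG
  have hc := aux_continuous_fourier g h1
  have key : ∀ᵐ x : ℝ, 𝓕 g x = (𝓕 G : Lp (α := ℝ) ℂ 2 volume) x := by
    apply ae_eq_of_integral_contDiff_smul_eq hc.locallyIntegrable
    · exact (Lp.memLp _).locallyIntegrable (by norm_num)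
    intro φ hφ hφs
    have hs : HasCompactSupport (fun x => (φ x : ℂ)) :=
      hφs.comp_left (g := fun x : ℝ => (x : ℂ)) (by simp)
    have hd : ContDiff ℝ (⊤ : ℕ∞) (fun x => (φ x : ℂ)) := Complex.ofRealCLM.contDiff.comp hφ
    set ψ : SchwartzMap ℝ ℂ := hs.toSchwartzMap hd with hψ
    have hψa : ∀ x, ψ x = (φ x : ℂ) := fun x => rfl
    have e := DFunLike.congr_fun (Lp.fourier_toTemperedDistribution_eq G) ψ
    rw [TemperedDistribution.fourier_apply, Lp.toTemperedDistribution_apply,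
      Lp.toTemperedDistribution_apply] at e
    have e1 : ∫ x, φ x • (𝓕 G : Lp (α := ℝ) ℂ 2 volume) x = ∫ x, ψ x • (𝓕 G : Lp (α := ℝ) ℂ 2 volume) x := by
      congr 1
    rw [e1, ← e]
    have e2 : ∫ x, (𝓕 ψ) x • G x = ∫ x, 𝓕 (ψ : ℝ → ℂ) x * g x := by
      apply integral_congr_ae
      filter_upwards [h2.coeFn_toLp] with x hx
      rw [hG, hx, SchwartzMap.fourier_coe]; rfl
    rw [e2, aux_fourier_flip _ _ ψ.integrable h1]
    congr 1
  rw [eLpNorm_congr_ae key, ← ENNReal.toReal_eq_toReal_iff' (Lp.eLpNorm_ne_top _) h2.2.ne,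
    ← Lp.norm_def, Lp.norm_fourier_eq, hG, Lp.norm_toLp]

open FourierTransform in
lemma aux_plancherel_inv (g : ℝ → ℂ) (h1 : Integrable g) (h2 : MemLp g 2 volume) :
    eLpNorm (𝓕⁻ g) 2 volume = eLpNorm g 2 volume := by
  rw [Real.fourierInv_eq_fourier_comp_neg, aux_plancherel _ h1.comp_neg]
  · exact eLpNorm_comp_measurePreserving h2.1 (Measure.measurePreserving_neg volume)
  · exact h2.comp_measurePreserving (Measure.measurePreserving_neg volume)

open FourierTransform in
lemma aux_fourier_k (z : ℂ) (hz : 0 < z.im) :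
    Integrable (Set.indicator (Set.Ioi (0:ℝ)) fun ξ : ℝ => cexp (2 * Real.pi * I * z * ξ)) ∧
    ∀ s : ℝ, 𝓕 (Set.indicator (Set.Ioi (0:ℝ)) fun ξ : ℝ => cexp (2 * Real.pi * I * z * ξ)) s
      = (2 * (Real.pi : ℂ) * I)⁻¹ / ((s : ℂ) - z) := by
  have hre : (2 * Real.pi * I * z).re < 0 := by
    simp; positivity
  constructor
  · rw [integrable_indicator_iff measurableSet_Ioi]
    exact integrableOn_exp_mul_complex_Ioi hre 0
  · intro s
    rw [Real.fourier_real_eq_integral_exp_smul]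
    have hre' : (2 * Real.pi * I * (z - s)).re < 0 := by
      simp; positivity
    have : ∀ v : ℝ, cexp (↑(-2 * Real.pi * v * s) * I) •
        (Set.indicator (Set.Ioi (0:ℝ)) fun ξ : ℝ => cexp (2 * Real.pi * I * z * ξ)) v =
        (Set.indicator (Set.Ioi (0:ℝ)) fun ξ : ℝ => cexp (2 * Real.pi * I * (z - s) * ξ)) v := by
      intro v
      by_cases hv : v ∈ Set.Ioi (0:ℝ)
      · simp only [Set.indicator_of_mem hv, smul_eq_mul, ← Complex.exp_add]
        congr 1; push_cast; ring
      · simp [Set.indicator_of_notMem hv]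
    simp_rw [this]
    rw [integral_indicator measurableSet_Ioi, integral_exp_mul_complex_Ioi hre']
    have h1 : (z - s : ℂ) ≠ 0 := fun h => by rw [h] at hre'; simp at hre'
    have h2 : (s - z : ℂ) ≠ 0 := fun h => h1 (by linear_combination -h)
    have h3 : (Real.pi : ℂ) ≠ 0 := by exact_mod_cast Real.pi_ne_zero
    simp
    field_simp
    rw [I_sq]
    ring

open FourierTransform in
lemma aux_schwartz (f : SchwartzMap ℝ ℂ) (ε : ℝ) (hε : 0 < ε) :
    Continuous (fun x : ℝ => cauchyE f ((x : ℂ) + ε * I)) ∧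
    eLpNorm (fun x : ℝ => cauchyE f ((x : ℂ) + ε * I)) 2 volume ≤ eLpNorm f 2 volume := by
  set m : ℝ → ℂ := Set.indicator (Set.Ioi (0:ℝ)) fun ξ : ℝ => cexp (2 * Real.pi * I * (ε * I) * ξ)
    with hm
  have hmm : AEStronglyMeasurable m volume :=
    (aux_fourier_k (ε * I) (by simpa using hε)).1.1
  have hmb : ∀ ξ, ‖m ξ‖ ≤ 1 := by
    intro ξ
    by_cases hv : ξ ∈ Set.Ioi (0:ℝ)
    · simp only [hm, Set.indicator_of_mem hv, Complex.norm_exp]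
      have : 0 < ξ := hv
      simp; positivity
    · simp [hm, Set.indicator_of_notMem hv]
  set g : ℝ → ℂ := fun ξ => m ξ * 𝓕 f ξ with hg
  have hgb : ∀ ξ, ‖g ξ‖ ≤ ‖𝓕 f ξ‖ := fun ξ => by
    rw [hg, norm_mul]; exact mul_le_of_le_one_left (norm_nonneg _) (hmb ξ)
  have hgm : AEStronglyMeasurable g volume := hmm.mul (𝓕 f).continuous.aestronglyMeasurable
  have hg1 : Integrable g := (𝓕 f).integrable.mono hgm (.of_forall hgb)
  have hg2 : MemLp g 2 volume := ((𝓕 f).memLp 2 volume).mono hgm (.of_forall hgb)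
  have heq : (fun x : ℝ => cauchyE f ((x : ℂ) + ε * I)) = 𝓕⁻ g := by
    funext x
    obtain ⟨k1, k2⟩ := aux_fourier_k ((x : ℂ) + ε * I) (by simpa using hε)
    have : cauchyE f ((x : ℂ) + ε * I) = ∫ s, f s * 𝓕 (Set.indicator (Set.Ioi (0:ℝ))
        fun ξ : ℝ => cexp (2 * Real.pi * I * ((x : ℂ) + ε * I) * ξ)) s := by
      simp_rw [k2]
      rw [cauchyE, ← integral_const_mul]
      congr 1; funext s; ring
    rw [this, ← aux_fourier_flip _ _ f.integrable k1, Real.fourierInv_eq']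
    congr 1; funext ξ
    simp only [hg, hm]
    by_cases hv : ξ ∈ Set.Ioi (0:ℝ)
    · simp only [Set.indicator_of_mem hv, smul_eq_mul, SchwartzMap.fourier_coe]
      rw [← mul_assoc, ← Complex.exp_add, mul_comm]
      congr 2; simp; ring
    · simp [Set.indicator_of_notMem hv]
  rw [heq]
  constructor
  · rw [Real.fourierInv_eq_fourier_comp_neg]
    exact aux_continuous_fourier _ hg1.comp_neg
  · rw [aux_plancherel_inv g hg1 hg2]
    calc eLpNorm g 2 volume ≤ eLpNorm (𝓕 (f : ℝ → ℂ)) 2 volume := eLpNorm_mono hgb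
      _ = _ := aux_plancherel f f.integrable (f.memLp 2 volume)

open FourierTransform in
lemma aux_kernel (z : ℂ) (hz : 0 < z.im) :
    MemLp (fun s : ℝ => (2 * (Real.pi : ℂ) * I)⁻¹ / ((s : ℂ) - z)) 2 volume := by
  obtain ⟨k1, k2⟩ := aux_fourier_k z hz
  set k := Set.indicator (Set.Ioi (0:ℝ)) fun ξ : ℝ => cexp (2 * Real.pi * I * z * ξ) with hk
  have hkb : ∀ ξ, ‖k ξ‖ ≤ 1 := by
    intro ξ
    by_cases hv : ξ ∈ Set.Ioi (0:ℝ)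
    · simp only [hk, Set.indicator_of_mem hv, Complex.norm_exp]
      have : 0 < ξ := hv
      simp; positivity
    · simp [hk, Set.indicator_of_notMem hv]
  have k3 : MemLp k 2 volume := by
    rw [memLp_two_iff_integrable_sq_norm k1.1]
    refine k1.mono (k1.1.norm.pow 2) (.of_forall fun ξ => ?_)
    rw [norm_pow, norm_norm, sq]
    exact mul_le_of_le_one_left (norm_nonneg _) (hkb ξ)
  have : (fun s : ℝ => (2 * (Real.pi : ℂ) * I)⁻¹ / ((s : ℂ) - z)) = 𝓕 k := by
    funext s; rw [k2]
  rw [this]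
  refine ⟨(aux_continuous_fourier k k1).aestronglyMeasurable, ?_⟩
  rw [aux_plancherel k k1 k3]
  exact k3.2

lemma aux_L2 (f : ℝ → ℂ) (hf : MemLp f 2 volume) (ε : ℝ) (hε : 0 < ε) :
    AEStronglyMeasurable (fun x : ℝ => cauchyE f ((x : ℂ) + ε * I)) volume ∧
    eLpNorm (fun x : ℝ => cauchyE f ((x : ℂ) + ε * I)) 2 volume ≤ eLpNorm f 2 volume := by
  set F : Lp (α := ℝ) ℂ 2 volume := hf.toLp f with hF
  have hd : DenseRange (SchwartzMap.toLpCLM ℂ (E := ℝ) ℂ 2 volume) :=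
    SchwartzMap.denseRange_toLpCLM ENNReal.ofNat_ne_top
  have hex : ∃ u : ℕ → SchwartzMap ℝ ℂ, Tendsto (fun n => (u n).toLp 2 volume) atTop (𝓝 F) := by
    have : ∀ n : ℕ, ∃ u : SchwartzMap ℝ ℂ, dist F (u.toLp 2 volume) < 1 / ((n : ℝ) + 1) :=
      fun n => hd.exists_dist_lt F (by positivity)
    choose u hu using this
    refine ⟨u, ?_⟩
    rw [tendsto_iff_dist_tendsto_zero]
    refine squeeze_zero (fun _ => dist_nonneg) (fun n => ?_) tendsto_one_div_add_atTop_nhds_zero_nat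
    rw [dist_comm]; exact (hu n).le
  obtain ⟨u, hu⟩ := hex
  have hlim : ∀ x : ℝ, Tendsto (fun n => cauchyE (u n) ((x : ℂ) + ε * I)) atTop
      (𝓝 (cauchyE f ((x : ℂ) + ε * I))) := by
    intro x
    have hK := (aux_kernel ((x : ℂ) + ε * I) (by simpa using hε)).star
    set K : Lp (α := ℝ) ℂ 2 volume := hK.toLp _ with hKdef
    have hrep : ∀ (g : ℝ → ℂ) (G : Lp (α := ℝ) ℂ 2 volume), G =ᵐ[volume] g →
        cauchyE g ((x : ℂ) + ε * I) = inner ℂ K G := by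
      intro g G hG
      rw [L2.inner_def, cauchyE, ← integral_const_mul]
      apply integral_congr_ae
      filter_upwards [hG, hK.coeFn_toLp] with s h1 h2
      rw [h1, hKdef, h2]
      simp [map_ofNat (starRingEnd ℂ) 2]
      ring
    rw [hrep f F hf.coeFn_toLp]
    have : (fun n => cauchyE (u n) ((x : ℂ) + ε * I)) = fun n => inner ℂ K ((u n).toLp 2 volume) := by
      funext n
      exact hrep _ _ ((u n).coeFn_toLp 2 volume)
    rw [this]
    exact (tendsto_const_nhds (x := K)).inner hu
  have hm : ∀ n, AEStronglyMeasurable (fun x : ℝ => cauchyE (u n) ((x : ℂ) + ε * I)) volume :=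
    fun n => (aux_schwartz (u n) ε hε).1.aestronglyMeasurable
  refine ⟨aestronglyMeasurable_of_tendsto_ae atTop hm (.of_forall hlim), ?_⟩
  refine (Lp.eLpNorm_lim_le_liminf_eLpNorm hm _ (.of_forall hlim)).trans ?_
  have hn : Tendsto (fun n => eLpNorm (u n) 2 volume) atTop (𝓝 (eLpNorm f 2 volume)) := by
    have h1 := (continuous_enorm.tendsto F).comp hu
    have h2 : ‖F‖ₑ = eLpNorm f 2 volume := by
      rw [Lp.enorm_def]; exact eLpNorm_congr_ae hf.coeFn_toLp
    rw [h2] at h1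
    refine h1.congr fun n => ?_
    simp only [Function.comp]
    rw [Lp.enorm_def]; exact eLpNorm_congr_ae ((u n).coeFn_toLp 2 volume)
  rw [← hn.liminf_eq]
  exact liminf_le_liminf (.of_forall fun n => (aux_schwartz (u n) ε hε).2)

lemma aux_plus (f g : ℝ → ℂ) (hf : MemLp f 2 volume)
    (h : ∀ᵐ z : ℝ, Tendsto (fun ε : ℝ => cauchyE f ((z : ℂ) + ε * I)) (𝓝[>] 0) (𝓝 (g z))) :
    eLpNorm g 2 volume ≤ eLpNorm f 2 volume := by
  have hpos : ∀ n : ℕ, (0:ℝ) < 1 / ((n : ℝ) + 1) := fun n => by positivity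
  have ht : Tendsto (fun n : ℕ => 1 / ((n : ℝ) + 1)) atTop (𝓝[>] 0) :=
    tendsto_nhdsWithin_iff.2 ⟨tendsto_one_div_add_atTop_nhds_zero_nat, .of_forall hpos⟩
  have hl : ∀ᵐ z : ℝ, Tendsto (fun n : ℕ => cauchyE f ((z : ℂ) + (1 / ((n : ℝ) + 1) : ℝ) * I))
      atTop (𝓝 (g z)) := by
    filter_upwards [h] with z hz using hz.comp ht
  refine (Lp.eLpNorm_lim_le_liminf_eLpNorm (fun n => (aux_L2 f hf _ (hpos n)).1) _ hl).trans ?_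
  refine (liminf_le_liminf (.of_forall fun n => (aux_L2 f hf _ (hpos n)).2)).trans ?_
  simp

lemma aux_conj (f : ℝ → ℂ) (z : ℂ) :
    cauchyE (fun s => star (f s)) (star z) = - star (cauchyE f z) := by
  rw [cauchyE, cauchyE, star_mul', Complex.star_def, ← integral_conj]
  simp [map_ofNat (starRingEnd ℂ) 2]

lemma aux_minus (f g : ℝ → ℂ) (hf : MemLp f 2 volume)
    (h : ∀ᵐ z : ℝ, Tendsto (fun ε : ℝ => cauchyE f ((z : ℂ) - ε * I)) (𝓝[>] 0) (𝓝 (g z))) :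
    eLpNorm g 2 volume ≤ eLpNorm f 2 volume := by
  have h1 := aux_plus (fun s => star (f s)) (fun s => - star (g s)) hf.star ?_
  · have e1 : eLpNorm (fun s => - star (g s)) 2 volume = eLpNorm g 2 volume :=
      eLpNorm_congr_norm_ae (.of_forall fun s => by simp)
    have e2 : eLpNorm (fun s => star (f s)) 2 volume = eLpNorm f 2 volume :=
      eLpNorm_congr_norm_ae (.of_forall fun s => by simp)
    rwa [e1, e2] at h1
  · filter_upwards [h] with z hz
    have := ((continuous_star.tendsto _).comp hz).neg
    refine this.congr fun ε => ?_
    simp only [Function.comp]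
    rw [← aux_conj]
    congr 1
    simp

lemma aux_frob (M : Matrix (Fin 2) (Fin 2) ℂ) : ‖M‖ₑ ^ 2 = ∑ i, ∑ j, ‖M i j‖ₑ ^ 2 := by
  have h : ‖M‖₊ ^ 2 = ∑ i, ∑ j, ‖M i j‖₊ ^ 2 := by
    rw [Matrix.frobenius_nnnorm_def, ← NNReal.rpow_natCast, ← NNReal.rpow_mul]
    norm_num
  simp only [enorm_eq_nnnorm]
  exact_mod_cast h

lemma aux_sq {E : Type*} [NormedAddCommGroup E] (f : ℝ → E) :
    eLpNorm f 2 volume ^ 2 = ∫⁻ z, ‖f z‖ₑ ^ 2 := by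
  have := eLpNorm_nnreal_pow_eq_lintegral (f := f) (μ := (volume : Measure ℝ)) (p := 2) (by norm_num)
  simpa using this

lemma aux_entry (h : Lp (Matrix (Fin 2) (Fin 2) ℂ) 2 (volume : Measure ℝ)) (i j : Fin 2) :
    MemLp (fun z => h z i j) 2 volume := by
  refine (Lp.memLp h).mono ?_ (.of_forall fun z => ?_)
  · have hc : Continuous (fun M : Matrix (Fin 2) (Fin 2) ℂ => M i j) := by fun_prop
    exact hc.comp_aestronglyMeasurable (Lp.aestronglyMeasurable h)
  · have h1 : ‖h z i j‖ₑ ^ 2 ≤ ‖h z‖ₑ ^ 2 := by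
      rw [aux_frob]
      refine le_trans ?_ (Finset.single_le_sum (f := fun i => ∑ j, ‖h z i j‖ₑ ^ 2)
        (fun _ _ => zero_le) (Finset.mem_univ i))
      exact Finset.single_le_sum (f := fun j => ‖h z i j‖ₑ ^ 2)
        (fun _ _ => zero_le) (Finset.mem_univ j)
    have h2 := (ENNReal.pow_le_pow_left_iff (two_ne_zero)).1 h1
    exact enorm_le_iff_norm_le.1 h2

lemma aux_norm (h : Lp (Matrix (Fin 2) (Fin 2) ℂ) 2 (volume : Measure ℝ)) :
    eLpNorm h 2 volume ^ 2 = ∑ i, ∑ j, eLpNorm (fun z => h z i j) 2 volume ^ 2 := by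
  have hm : ∀ i j, AEMeasurable (fun z => ‖h z i j‖ₑ ^ 2) volume := fun i j =>
    (aux_entry h i j).1.enorm.pow_const 2
  simp_rw [aux_sq, aux_frob]
  rw [lintegral_finsetSum' _ (fun i _ => Finset.aemeasurable_fun_sum _ fun j _ => hm i j)]
  refine Finset.sum_congr rfl fun i _ => ?_
  rw [lintegral_finsetSum' _ (fun j _ => hm i j)]

lemma aux_mul (r f w : ℝ → ℂ) (hr : eLpNorm r ⊤ (volume : Measure ℝ) < 1)
    (hf : MemLp f 2 volume) (hw : AEStronglyMeasurable w volume) (hwr : ∀ z, ‖w z‖ = ‖r z‖) :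
    MemLp (fun s => f s * w s) 2 volume ∧
    eLpNorm (fun s => f s * w s) 2 volume ≤
      eLpNorm r ⊤ (volume : Measure ℝ) * eLpNorm f 2 volume := by
  have hb : ∀ᵐ z : ℝ, ‖f z * w z‖ ≤ (eLpNorm r ⊤ (volume : Measure ℝ)).toReal * ‖f z‖ := by
    filter_upwards [ae_le_eLpNormEssSup (f := r) (μ := (volume : Measure ℝ))] with z hz
    rw [norm_mul, hwr, mul_comm]
    gcongr
    rw [eLpNorm_exponent_top] at hr ⊢
    rw [← toReal_enorm]
    exact ENNReal.toReal_mono (hr.trans ENNReal.one_lt_top).ne hz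
  refine ⟨hf.of_le_mul (hf.1.mul hw) hb, ?_⟩
  have := eLpNorm_le_mul_eLpNorm_of_ae_le_mul hb 2
  rwa [ENNReal.ofReal_toReal (hr.trans ENNReal.one_lt_top).ne] at this

lemma aux_cauchy_zero (z : ℂ) : cauchyE (fun _ => 0) z = 0 := by simp [cauchyE]

lemma aux_bound (r : ℝ → ℂ)
    (hrm : AEStronglyMeasurable r (volume : Measure ℝ))
    (hrinf : eLpNorm r ⊤ (volume : Measure ℝ) < 1) (x t : ℝ)
    (h g : Lp (Matrix (Fin 2) (Fin 2) ℂ) 2 (volume : Measure ℝ))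
    (hCw : ∀ᵐ z : ℝ, ∀ i j,
        Tendsto (fun ε : ℝ =>
            (cauchyM (fun s => h s * mkdvOmegaMinus r x t s) ((z : ℂ) + ε * Complex.I) +
              cauchyM (fun s => h s * mkdvOmegaPlus r x t s) ((z : ℂ) - ε * Complex.I)) i j)
          (𝓝[>] 0) (𝓝 (g z i j))) :
    eLpNorm g 2 volume ≤ eLpNorm r ⊤ (volume : Measure ℝ) * eLpNorm h 2 volume := by
  set R := eLpNorm r ⊤ (volume : Measure ℝ) with hR
  set w1 : ℝ → ℂ := fun z => -(starRingEnd ℂ) (r z) *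
        Complex.exp (-(2 * Complex.I * ((x * z + 4 * t * z ^ 3 : ℝ) : ℂ))) with hw1
  set w2 : ℝ → ℂ := fun z => r z *
        Complex.exp (2 * Complex.I * ((x * z + 4 * t * z ^ 3 : ℝ) : ℂ)) with hw2
  have m1 : AEStronglyMeasurable w1 volume := by
    refine AEStronglyMeasurable.mul ?_ ?_
    · exact (hrm.star).neg
    · exact Continuous.aestronglyMeasurable (by fun_prop)
  have m2 : AEStronglyMeasurable w2 volume := by
    refine AEStronglyMeasurable.mul hrm ?_
    exact Continuous.aestronglyMeasurable (by fun_prop)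
  have n1 : ∀ z, ‖w1 z‖ = ‖r z‖ := by
    intro z
    rw [hw1]
    simp only [norm_mul, norm_neg, RCLike.norm_conj, Complex.norm_exp]
    simp [-ofReal_add, -ofReal_mul, -ofReal_pow]
  have n2 : ∀ z, ‖w2 z‖ = ‖r z‖ := by
    intro z
    rw [hw2]
    simp only [norm_mul, Complex.norm_exp]
    simp [-ofReal_add, -ofReal_mul, -ofReal_pow]
  have c1 : ∀ i, eLpNorm (fun z => g z i 1) 2 volume ≤ R * eLpNorm (fun z => h z i 0) 2 volume := by
    intro i
    obtain ⟨a, b⟩ := aux_mul r _ w1 hrinf (aux_entry h i 0) m1 n1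
    refine (aux_plus _ _ a ?_).trans b
    filter_upwards [hCw] with z hz
    refine (hz i 1).congr fun ε => ?_
    simp [cauchyM, mkdvOmegaMinus, mkdvOmegaPlus, Matrix.mul_apply, aux_cauchy_zero, hw1]
  have c2 : ∀ i, eLpNorm (fun z => g z i 0) 2 volume ≤ R * eLpNorm (fun z => h z i 1) 2 volume := by
    intro i
    obtain ⟨a, b⟩ := aux_mul r _ w2 hrinf (aux_entry h i 1) m2 n2
    refine (aux_minus _ _ a ?_).trans b
    filter_upwards [hCw] with z hz
    refine (hz i 0).congr fun ε => ?_
    simp [cauchyM, mkdvOmegaMinus, mkdvOmegaPlus, Matrix.mul_apply, aux_cauchy_zero, hw2]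
  rw [← ENNReal.pow_le_pow_left_iff (two_ne_zero), mul_pow, aux_norm, aux_norm, Finset.mul_sum]
  refine Finset.sum_le_sum fun i _ => ?_
  rw [Fin.sum_univ_two, Fin.sum_univ_two, mul_add, add_comm]
  gcongr
  · rw [← mul_pow]; gcongr; exact c1 i
  · rw [← mul_pow]; gcongr; exact c2 i

lemma aux_neumann {X : Type*} [NormedAddCommGroup X] [NormedSpace ℂ X] [CompleteSpace X]
    (T : X →L[ℂ] X) (R : ℝ) (hT : ‖T‖ ≤ R) (hR : R < 1) :
    ∃ S : X →L[ℂ] X, (1 - T) * S = 1 ∧ S * (1 - T) = 1 ∧ ‖S‖ ≤ (1 - R)⁻¹ := by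
  have h1 : ‖T‖ < 1 := hT.trans_lt hR
  refine ⟨_, mul_neg_geom_series T h1, geom_series_mul_neg T h1, ?_⟩
  refine (tsum_geometric_le_of_norm_lt_one T h1).trans ?_
  have h2 : ‖(1 : X →L[ℂ] X)‖ ≤ 1 := ContinuousLinearMap.norm_id_le
  have h3 : (1 - ‖T‖)⁻¹ ≤ (1 - R)⁻¹ := by
    apply inv_anti₀ <;> linarith
  linarith

/-- For the MKdV data with `‖r‖_∞ < 1`, the operator `C_ω h = C^+(hω^-) + C^-(hω^+)` on
`L²(ℝ; 2×2 matrices)` (Hilbert–Schmidt norm) has norm at most `‖r‖_∞ < 1`; in particular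
`1 - C_ω` is invertible with `‖(1-C_ω)⁻¹‖ ≤ 1/(1-‖r‖_∞)`. -/
theorem mkdv_Cw_norm_lt_one (r : ℝ → ℂ)
    (hrm : AEStronglyMeasurable r (volume : Measure ℝ))
    (hrinf : eLpNorm r ⊤ (volume : Measure ℝ) < 1) (x t : ℝ)
    (Cw : Lp (Matrix (Fin 2) (Fin 2) ℂ) 2 (volume : Measure ℝ) →L[ℂ]
      Lp (Matrix (Fin 2) (Fin 2) ℂ) 2 (volume : Measure ℝ))
    (hCw : ∀ h : Lp (Matrix (Fin 2) (Fin 2) ℂ) 2 (volume : Measure ℝ),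
      ∀ᵐ z : ℝ, ∀ i j,
        Tendsto (fun ε : ℝ =>
            (cauchyM (fun s => h s * mkdvOmegaMinus r x t s) ((z : ℂ) + ε * Complex.I) +
              cauchyM (fun s => h s * mkdvOmegaPlus r x t s) ((z : ℂ) - ε * Complex.I)) i j)
          (𝓝[>] 0) (𝓝 (Cw h z i j))) :
    ‖Cw‖ ≤ (eLpNorm r ⊤ (volume : Measure ℝ)).toReal ∧
    (eLpNorm r ⊤ (volume : Measure ℝ)).toReal < 1 ∧
    ∃ S : Lp (Matrix (Fin 2) (Fin 2) ℂ) 2 (volume : Measure ℝ) →L[ℂ]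
        Lp (Matrix (Fin 2) (Fin 2) ℂ) 2 (volume : Measure ℝ),
      (1 - Cw) * S = 1 ∧ S * (1 - Cw) = 1 ∧
        ‖S‖ ≤ (1 - (eLpNorm r ⊤ (volume : Measure ℝ)).toReal)⁻¹ := by
  have hfin : eLpNorm r ⊤ (volume : Measure ℝ) ≠ ⊤ := (hrinf.trans ENNReal.one_lt_top).ne
  have hlt : (eLpNorm r ⊤ (volume : Measure ℝ)).toReal < 1 := by
    have := (ENNReal.toReal_lt_toReal hfin ENNReal.one_ne_top).2 hrinf
    simpa using this
  have hn : ‖Cw‖ ≤ (eLpNorm r ⊤ (volume : Measure ℝ)).toReal := by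
    refine ContinuousLinearMap.opNorm_le_bound _ ENNReal.toReal_nonneg fun h => ?_
    have := aux_bound r hrm hrinf x t h (Cw h) (hCw h)
    rw [Lp.norm_def, Lp.norm_def, ← ENNReal.toReal_mul]
    exact ENNReal.toReal_mono (ENNReal.mul_ne_top hfin (Lp.eLpNorm_ne_top h)) this
  have : CompleteSpace (Matrix (Fin 2) (Fin 2) ℂ) := FiniteDimensional.complete ℂ _
  exact ⟨hn, hlt, aux_neumann Cw _ hn hlt⟩
end

section
/- Let n ≥ 1 and let v : ℝ → GL(n,ℂ) be continuous with v(z) → I as |z| → ∞ and v^{−1} bounded. Then the operator K on L²(ℝ; n×n complex matrices) defined by K h = C^−[ ( C^+( h (v^{−1} − I) ) ) (v − I) ] is a compact operator. -/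
open MeasureTheory Filter Topology Complex

attribute [local instance] Matrix.frobeniusNormedAddCommGroup Matrix.frobeniusNormedSpace


section kc
open FourierTransform SchwartzMap ENNReal

noncomputable abbrev L2C := Lp ℂ 2 (volume : Measure ℝ)

lemma kc_selfadj (f g : ℝ → ℂ) (hf : Integrable f) (hg : Integrable g) :
    ∫ x, (𝓕⁻ f x) * g x = ∫ x, f x * (𝓕⁻ g x) := by
  have := VectorFourier.integral_bilin_fourierIntegral_eq_flip (ContinuousLinearMap.mul ℂ ℂ)
    (L := -innerₗ ℝ) (μ := volume) (ν := volume) Real.continuous_fourierChar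
    ((continuous_inner (𝕜 := ℝ) (E := ℝ)).neg) hf hg
  have hfl : (-innerₗ ℝ).flip = -innerₗ ℝ := by
    ext; simp 
  rw [hfl] at this
  exact this

lemma kc_continuous_inv (f : ℝ → ℂ) (hf : Integrable f) : Continuous (𝓕⁻ f) :=
  VectorFourier.fourierIntegral_continuous (L := -innerₗ ℝ) Real.continuous_fourierChar
    ((continuous_inner (𝕜 := ℝ) (E := ℝ)).neg) hf

lemma kc_compat (g : ℝ → ℂ) (h1 : Integrable g) (h2 : MemLp g 2 volume) :
    (𝓕⁻ (h2.toLp g) : L2C) =ᵐ[volume] 𝓕⁻ g := by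
  apply ae_eq_of_integral_contDiff_smul_eq
  · exact (Lp.memLp _).locallyIntegrable (by norm_num)
  · exact (kc_continuous_inv g h1).locallyIntegrable
  · intro φ g_smooth g_cpt
    have hg₁ : HasCompactSupport (Complex.ofRealCLM ∘ φ) := g_cpt.comp_left rfl
    have hg₂ : ContDiff ℝ (⊤ : ℕ∞) (Complex.ofRealCLM ∘ φ) := by fun_prop
    set ψ : 𝓢(ℝ, ℂ) := hg₁.toSchwartzMap hg₂ with hψ
    have hψx : ∀ x, ψ x = φ x := by intro x; simp [hψ]
    have e1 := congrArg (fun T : 𝓢'(ℝ, ℂ) => T ψ)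
      (Lp.fourierInv_toTemperedDistribution_eq (h2.toLp g))
    simp only [TemperedDistribution.fourierInv_apply, Lp.toTemperedDistribution_apply] at e1
    have e2 : ∫ x, (φ x) • (𝓕⁻ (h2.toLp g) : L2C) x = ∫ x, ψ x • (𝓕⁻ (h2.toLp g) : L2C) x := by
      simp [hψx]
    have e3 : ∫ x, (φ x) • (𝓕⁻ g) x = ∫ x, ψ x * (𝓕⁻ g) x := by
      simp [hψx]
    rw [e2, e3, ← e1, ← kc_selfadj _ _ ψ.integrable h1]
    apply integral_congr_ae
    filter_upwards [h2.coeFn_toLp] with x hx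
    rw [hx, SchwartzMap.fourierInv_coe]; rfl

noncomputable def kcMul (u : ℝ → ℂ) (hu : MemLp u ∞ volume) : L2C →L[ℂ] L2C :=
  (ContinuousLinearMap.mul ℂ ℂ).holderL volume ∞ 2 2 (hu.toLp u)

lemma kcMul_coe (u : ℝ → ℂ) (hu : MemLp u ∞ volume) (f : L2C) :
    kcMul u hu f =ᵐ[volume] fun x => u x * f x := by
  have := (ContinuousLinearMap.mul ℂ ℂ).coeFn_holder (r := 2) (hu.toLp u) f
  filter_upwards [this, hu.coeFn_toLp] with x h1 h2
  rw [← h2]; exact h1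

lemma kcMul_norm (u : ℝ → ℂ) (hu : MemLp u ∞ volume) (C : ℝ) (hC : 0 ≤ C) (h : ∀ x, ‖u x‖ ≤ C) :
    ‖kcMul u hu‖ ≤ C := by
  refine ContinuousLinearMap.opNorm_le_bound _ hC fun f => ?_
  apply Lp.norm_le_mul_norm_of_ae_le_mul
  filter_upwards [kcMul_coe u hu f] with x hx
  rw [hx, norm_mul]
  gcongr
  exact h x

/-- exponential cut off to a half line -/
noncomputable def kcE (σ : ℝ) (z : ℂ) (ξ : ℝ) : ℂ :=
  if 0 < σ * ξ then σ * cexp (2 * Real.pi * I * z * ξ) else 0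

lemma kcE_meas (σ : ℝ) (z : ℂ) : Measurable (kcE σ z) := by
  unfold kcE
  refine Measurable.ite ?_ (by fun_prop) measurable_const
  exact measurableSet_lt measurable_const (by fun_prop)

lemma kcE_norm (σ : ℝ) (hσ : σ = 1 ∨ σ = -1) (z : ℂ) (hz : 0 ≤ σ * z.im) (ξ : ℝ) :
    ‖kcE σ z ξ‖ ≤ 1 := by
  unfold kcE
  split_ifs with h
  · have h1 : ‖(σ : ℂ)‖ = 1 := by rcases hσ with rfl | rfl <;> simp
    rw [norm_mul, h1, one_mul, Complex.norm_exp, Real.exp_le_one_iff]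
    have : (2 * Real.pi * I * z * ξ).re = - (2 * Real.pi * (z.im * ξ)) := by
      simp; ring
    rw [this]
    have h2 : 0 ≤ z.im * ξ := by
      have : z.im * ξ = (σ * z.im) * (σ * ξ) := by rcases hσ with rfl | rfl <;> ring
      rw [this]; positivity
    have := Real.pi_pos
    nlinarith [mul_nonneg this.le h2]
  · simp

lemma kcE_top (σ : ℝ) (hσ : σ = 1 ∨ σ = -1) (z : ℂ) (hz : 0 ≤ σ * z.im) :
    MemLp (kcE σ z) ∞ volume :=
  memLp_top_of_bound (kcE_meas σ z).aestronglyMeasurable 1 (.of_forall (kcE_norm σ hσ z hz))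

lemma kcE_integrable (σ : ℝ) (hσ : σ = 1 ∨ σ = -1) (z : ℂ) (hz : 0 < σ * z.im) :
    Integrable (kcE σ z) ∧ ∫ ξ, kcE σ z ξ = -(2 * Real.pi * I * z)⁻¹ := by
  have hp := Real.pi_pos
  rcases hσ with rfl | rfl
  · have he : kcE 1 z = (Set.Ioi (0:ℝ)).indicator (fun ξ : ℝ => cexp (2 * Real.pi * I * z * ξ)) := by
      ext ξ; simp [kcE, Set.indicator]
    have hre : (2 * Real.pi * I * z).re < 0 := by simp at hz ⊢; positivity
    rw [he, integrable_indicator_iff measurableSet_Ioi, integral_indicator measurableSet_Ioi]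
    refine ⟨integrableOn_exp_mul_complex_Ioi hre 0, ?_⟩
    rw [integral_exp_mul_complex_Ioi hre 0]; simp [neg_div]
  · have he : kcE (-1) z =
      (Set.Iio (0:ℝ)).indicator (fun ξ : ℝ => -cexp (2 * Real.pi * I * z * ξ)) := by
      ext ξ; simp [kcE, Set.indicator]
    have hre : 0 < (2 * Real.pi * I * z).re := by simp at hz ⊢; nlinarith
    rw [he, integrable_indicator_iff measurableSet_Iio, integral_indicator measurableSet_Iio]
    refine ⟨((integrableOn_exp_mul_complex_Iic hre 0).mono_set Set.Iio_subset_Iic_self).neg, ?_⟩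
    rw [integral_neg, ← integral_Iic_eq_integral_Iio, integral_exp_mul_complex_Iic hre 0]; simp

lemma kcE_two (σ : ℝ) (hσ : σ = 1 ∨ σ = -1) (z : ℂ) (hz : 0 < σ * z.im) :
    MemLp (kcE σ z) 2 volume := by
  rw [memLp_two_iff_integrable_sq_norm (kcE_meas σ z).aestronglyMeasurable]
  refine (kcE_integrable σ hσ z hz).1.mono (by have := kcE_meas σ z; fun_prop) (.of_forall fun ξ => ?_)
  have := kcE_norm σ hσ z hz.le ξ
  have h0 := norm_nonneg (kcE σ z ξ)
  rw [Real.norm_of_nonneg (by positivity)]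
  nlinarith

lemma kcE_shift (σ : ℝ) (z : ℂ) (s ξ : ℝ) :
    cexp (2 * Real.pi * (ξ * s) * I) * kcE σ z ξ = kcE σ (s + z) ξ := by
  unfold kcE
  split_ifs
  · rw [mul_left_comm, ← Complex.exp_add]; ring_nf
  · simp

lemma kcE_conj (σ : ℝ) (z : ℂ) (ξ : ℝ) :
    starRingEnd ℂ (kcE σ z ξ) = kcE σ (-starRingEnd ℂ z) ξ := by
  unfold kcE
  split_ifs
  · have h2 : starRingEnd ℂ 2 = 2 := map_ofNat _ 2
    simp [← Complex.exp_conj, h2]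
  · simp

lemma kcE_inv (σ : ℝ) (hσ : σ = 1 ∨ σ = -1) (z : ℂ) (hz : 0 < σ * z.im) (s : ℝ) :
    𝓕⁻ (kcE σ z) s = -(2 * Real.pi * I * (s + z))⁻¹ := by
  rw [Real.fourierInv_eq']
  rw [← (kcE_integrable σ hσ (s + z) (by simpa using hz)).2]
  congr 1; ext ξ
  rw [← kcE_shift]
  simp [mul_comm]

lemma kc_inner (f g : L2C) : inner ℂ f (𝓕 g) = inner ℂ (𝓕⁻ f : L2C) g := by
  rw [← Lp.inner_fourier_eq (𝓕⁻ f) g, fourier_fourierInv_eq]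

lemma kc_pair (σ : ℝ) (hσ : σ = 1 ∨ σ = -1) (z : ℂ) (hz : 0 < σ * z.im) (f : L2C) :
    cauchyE f z = ∫ ξ, kcE σ z ξ * (𝓕 f : L2C) ξ := by
  have hz' : 0 < σ * (-starRingEnd ℂ z).im := by simpa using hz
  have h2 := kcE_two σ hσ _ hz'
  have key := kc_inner (h2.toLp _) f
  rw [L2.inner_def, L2.inner_def] at key
  have e1 : ∫ a, inner ℂ ((h2.toLp _ : L2C) a) ((𝓕 f : L2C) a) = ∫ ξ, kcE σ z ξ * (𝓕 f : L2C) ξ := by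
    apply integral_congr_ae
    filter_upwards [h2.coeFn_toLp] with ξ h
    rw [h]
    simp [kcE_conj, mul_comm]
  rw [← e1, key, cauchyE, ← integral_const_mul]
  apply integral_congr_ae
  filter_upwards [kc_compat _ (kcE_integrable σ hσ _ hz').1 h2] with s h
  rw [h, kcE_inv σ hσ _ hz']
  have h2 : starRingEnd ℂ 2 = 2 := map_ofNat _ 2
  simp [h2]
  ring

noncomputable def kcF : L2C →L[ℂ] L2C :=
  (Lp.fourierTransformₗᵢ ℝ ℂ).toContinuousLinearEquiv.toContinuousLinearMap
noncomputable def kcFi : L2C →L[ℂ] L2C :=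
  (Lp.fourierTransformₗᵢ ℝ ℂ).symm.toContinuousLinearEquiv.toContinuousLinearMap

lemma kcF_apply (f : L2C) : kcF f = 𝓕 f := rfl
lemma kcFi_apply (f : L2C) : kcFi f = 𝓕⁻ f := rfl

lemma kc_im (σ : ℝ) (hσ : σ = 1 ∨ σ = -1) (x ε : ℝ) : σ * ((x : ℂ) + σ * ε * I).im = ε := by
  rcases hσ with rfl | rfl <;> simp

lemma kc_im0 (σ : ℝ) (hσ : σ = 1 ∨ σ = -1) (ε : ℝ) : σ * (σ * ε * I : ℂ).im = ε := by
  simpa using kc_im σ hσ 0 ε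

lemma kc_T (σ : ℝ) (hσ : σ = 1 ∨ σ = -1) (ε : ℝ) (hε : 0 < ε) (f : L2C) :
    kcFi (kcMul (kcE σ (σ * ε * I)) (kcE_top σ hσ _ ((kc_im0 σ hσ ε).symm ▸ hε.le)) (kcF f))
      =ᵐ[volume] fun x : ℝ => cauchyE f (x + σ * ε * I) := by
  have hz : 0 < σ * (σ * ε * I : ℂ).im := by rw [kc_im0 σ hσ]; exact hε
  set g : ℝ → ℂ := fun ξ => kcE σ (σ * ε * I) ξ * (𝓕 f : L2C) ξ with hg
  have hgi : Integrable g := (kcE_two σ hσ _ hz).integrable_mul (Lp.memLp _)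
  have hM := kcMul_coe (kcE σ (σ * ε * I)) (kcE_top σ hσ _ hz.le) (kcF f)
  have hg2 : MemLp g 2 volume := (memLp_congr_ae hM).1 (Lp.memLp _)
  have : kcMul (kcE σ (σ * ε * I)) (kcE_top σ hσ _ hz.le) (kcF f) = hg2.toLp g := by
    apply Lp.ext
    exact hM.trans hg2.coeFn_toLp.symm
  rw [this, kcFi_apply]
  filter_upwards [kc_compat g hgi hg2] with x hx
  rw [hx, kc_pair σ hσ _ (by rw [kc_im σ hσ]; exact hε), Real.fourierInv_eq']
  congr 1; ext ξ
  rw [hg, smul_eq_mul, ← kcE_shift, mul_assoc]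
  simp [mul_comm]
  ring_nf

/-- boundary operator -/
noncomputable def kcC (σ : ℝ) (hσ : σ = 1 ∨ σ = -1) : L2C →L[ℂ] L2C :=
  kcFi ∘L kcMul (kcE σ 0) (kcE_top σ hσ 0 (by simp)) ∘L kcF

lemma kc_strong (σ : ℝ) (hσ : σ = 1 ∨ σ = -1) (G : L2C) (e : ℕ → ℝ) (he : ∀ n, 0 < e n)
    (he0 : Tendsto e atTop (𝓝 0)) :
    Tendsto (fun n => kcMul (kcE σ (σ * (e n) * I))
        (kcE_top σ hσ _ ((kc_im0 σ hσ (e n)).symm ▸ (he n).le)) G) atTop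
      (𝓝 (kcMul (kcE σ 0) (kcE_top σ hσ 0 (by simp)) G)) := by
  rw [tendsto_iff_norm_sub_tendsto_zero]
  set D := fun n => kcMul (kcE σ (σ * (e n) * I))
        (kcE_top σ hσ _ ((kc_im0 σ hσ (e n)).symm ▸ (he n).le)) G -
        kcMul (kcE σ 0) (kcE_top σ hσ 0 (by simp)) G with hD
  have hb : ∀ n, ∀ ξ, ‖kcE σ (σ * (e n) * I) ξ‖ ≤ 1 := fun n =>
    kcE_norm σ hσ _ (by rw [kc_im0 σ hσ]; exact (he n).le)
  have hb0 : ∀ ξ, ‖kcE σ 0 ξ‖ ≤ 1 := kcE_norm σ hσ _ (by simp)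
  have h1 : ∀ n, D n =ᵐ[volume] fun ξ => (kcE σ (σ * (e n) * I) ξ - kcE σ 0 ξ) * G ξ := by
    intro n
    filter_upwards [Lp.coeFn_sub (kcMul (kcE σ (σ * (e n) * I))
        (kcE_top σ hσ _ ((kc_im0 σ hσ (e n)).symm ▸ (he n).le)) G)
        (kcMul (kcE σ 0) (kcE_top σ hσ 0 (by simp)) G), kcMul_coe (kcE σ (σ * (e n) * I))
        (kcE_top σ hσ _ ((kc_im0 σ hσ (e n)).symm ▸ (he n).le)) G,
        kcMul_coe (kcE σ 0) (kcE_top σ hσ 0 (by simp)) G] with ξ a1 a2 a3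
    rw [hD]; simp only []
    rw [a1, Pi.sub_apply, a2, a3]; ring
  have h2 : ∀ n, ((‖D n‖ ^ 2 : ℝ) : ℂ) =
      ∫ ξ, ((‖(kcE σ (σ * (e n) * I) ξ - kcE σ 0 ξ) * G ξ‖ ^ 2 : ℝ) : ℂ) := by
    intro n
    have := inner_self_eq_norm_sq_to_K (𝕜 := ℂ) (D n)
    rw [L2.inner_def] at this
    push_cast
    rw [show ((‖D n‖ : ℂ)) ^ 2 = _ from this.symm]
    apply integral_congr_ae
    filter_upwards [h1 n] with ξ hξ
    rw [hξ, inner_self_eq_norm_sq_to_K]; simp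
  have h3 : Tendsto (fun n => ‖D n‖ ^ 2) atTop (𝓝 0) := by
    have : Tendsto (fun n => ∫ ξ, ((‖(kcE σ (σ * (e n) * I) ξ - kcE σ 0 ξ) * G ξ‖ ^ 2 : ℝ))) atTop
        (𝓝 (∫ ξ : ℝ, (0:ℝ))) := by
      apply tendsto_integral_of_dominated_convergence (fun ξ => 4 * ‖G ξ‖ ^ 2)
      · intro n
        have m1 := kcE_meas σ (σ * (e n) * I)
        have m2 := kcE_meas σ 0
        have m3 := Lp.aestronglyMeasurable G
        exact (((m1.sub m2).aestronglyMeasurable.mul m3).norm.pow 2)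
      · exact ((memLp_two_iff_integrable_sq_norm (Lp.aestronglyMeasurable G)).1
          (Lp.memLp G)).const_mul 4
      · intro n
        refine .of_forall fun ξ => ?_
        rw [Real.norm_of_nonneg (by positivity), norm_mul, mul_pow]
        gcongr
        have := norm_sub_le (kcE σ (σ * (e n) * I) ξ) (kcE σ 0 ξ)
        have := hb n ξ
        have := hb0 ξ
        have h0 := norm_nonneg (kcE σ (σ * (e n) * I) ξ - kcE σ 0 ξ)
        nlinarith
      · refine .of_forall fun ξ => ?_
        have hc : Tendsto (fun n => kcE σ (σ * (e n) * I) ξ) atTop (𝓝 (kcE σ 0 ξ)) := by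
          unfold kcE
          split_ifs
          · have hcont : Continuous fun t : ℝ =>
              (σ : ℂ) * cexp (2 * Real.pi * I * (σ * t * I) * ξ) := by fun_prop
            have := (hcont.tendsto 0).comp he0
            simpa [Function.comp_def] using this
          · exact tendsto_const_nhds
        have := ((hc.sub_const (kcE σ 0 ξ)).mul_const (G ξ)).norm.pow 2
        simpa using this
    simp only [integral_zero] at this
    convert this using 2 with n
    have := h2 n
    rw [integral_complex_ofReal] at this
    exact_mod_cast this
  have := h3.sqrt
  simpa [Real.sqrt_sq] using this

lemma kc_ident (σ : ℝ) (hσ : σ = 1 ∨ σ = -1) (f : L2C) (f' a : ℝ → ℂ) (hf : f =ᵐ[volume] f')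
    (ha : ∀ᵐ x : ℝ, Tendsto (fun ε : ℝ => cauchyE f' (x + σ * ε * I)) (𝓝[>] 0) (𝓝 (a x))) :
    kcC σ hσ f =ᵐ[volume] a := by
  have hE : ∀ z, cauchyE f' z = cauchyE f z := by
    intro z
    unfold cauchyE
    congr 1
    apply integral_congr_ae
    filter_upwards [hf] with s hs
    rw [hs]
  simp only [hE] at ha
  set e : ℕ → ℝ := fun n => 1 / ((n : ℝ) + 1) with he_def
  have he : ∀ n, 0 < e n := fun n => by positivity
  have he0 : Tendsto e atTop (𝓝 0) := tendsto_one_div_add_atTop_nhds_zero_nat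
  have hs := (kcFi.continuous.tendsto _).comp (kc_strong σ hσ (kcF f) e he he0)
  obtain ⟨ns, hns, hlim⟩ := (tendstoInMeasure_of_tendsto_Lp hs).exists_seq_tendsto_ae
  have hT : ∀ᵐ x : ℝ, ∀ n, _ := ae_all_iff.2 fun n => kc_T σ hσ (e n) (he n) f
  filter_upwards [ha, hlim, hT] with x h1 h2 h3
  have h4 : Tendsto (fun i => e (ns i)) atTop (𝓝[>] 0) :=
    tendsto_nhdsWithin_iff.2 ⟨he0.comp hns.tendsto_atTop, .of_forall fun i => he _⟩
  have h5 := h1.comp h4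
  refine tendsto_nhds_unique h2 ?_
  refine h5.congr fun i => ?_
  exact (h3 (ns i)).symm

lemma kc_zero (f : L2C) (z : ℂ) (hz : z.im < 0) : cauchyE (kcC 1 (.inl rfl) f) z = 0 := by
  rw [kc_pair (-1) (.inr rfl) z (by simpa using hz)]
  have h : (𝓕 (kcC 1 (.inl rfl) f) : L2C) =
      kcMul (kcE 1 0) (kcE_top 1 (.inl rfl) 0 (by simp)) (kcF f) :=
    fourier_fourierInv_eq (E := L2C) _
  rw [h]
  apply integral_eq_zero_of_ae
  filter_upwards [kcMul_coe (kcE 1 0) (kcE_top 1 (.inl rfl) 0 (by simp)) (kcF f)] with ξ hξ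
  rw [hξ]
  unfold kcE
  split_ifs <;> first | (simp; done) | (exfalso; linarith)

lemma kc_sum (f : L2C) : kcC 1 (.inl rfl) f - kcC (-1) (.inr rfl) f = f := by
  have : kcMul (kcE 1 0) (kcE_top 1 (.inl rfl) 0 (by simp)) (kcF f) -
      kcMul (kcE (-1) 0) (kcE_top (-1) (.inr rfl) 0 (by simp)) (kcF f) = kcF f := by
    apply Lp.ext
    have h0 : ∀ᵐ ξ : ℝ, ξ ≠ 0 := by simp [ae_iff, measure_singleton]
    filter_upwards [Lp.coeFn_sub (kcMul (kcE 1 0) (kcE_top 1 (.inl rfl) 0 (by simp)) (kcF f))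
      (kcMul (kcE (-1) 0) (kcE_top (-1) (.inr rfl) 0 (by simp)) (kcF f)),
      kcMul_coe (kcE 1 0) (kcE_top 1 (.inl rfl) 0 (by simp)) (kcF f),
      kcMul_coe (kcE (-1) 0) (kcE_top (-1) (.inr rfl) 0 (by simp)) (kcF f), h0] with ξ a1 a2 a3 hξ
    rw [a1, Pi.sub_apply, a2, a3]
    unfold kcE
    rcases lt_or_gt_of_ne hξ with h | h
    · have : ¬ (0 < ξ) := by linarith
      simp [h, this]
    · have : ¬ (ξ < 0) := by linarith
      simp [h, this]
  have h2 := congrArg kcFi this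
  rw [map_sub] at h2
  have h3 : kcFi (kcF f) = f := fourierInv_fourier_eq (F := L2C) (E := L2C) f
  exact h2.trans h3

noncomputable def kcH (u : ℝ → ℂ) (hu : MemLp u ∞ volume) : L2C →L[ℂ] L2C :=
  kcC (-1) (.inr rfl) ∘L kcMul u hu ∘L kcC 1 (.inl rfl)

lemma kc_ne (p : ℂ) (hp : p.im ≠ 0) (s : ℝ) : (s : ℂ) - p ≠ 0 := by
  intro h
  apply hp
  have := congrArg Complex.im h
  simpa using this

lemma kc_res_two (p : ℂ) (hp : p.im ≠ 0) : MemLp (fun s : ℝ => ((s : ℂ) - p)⁻¹) 2 volume := by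
  have key : ∀ (σ : ℝ) (hσ : σ = 1 ∨ σ = -1) (hz : 0 < σ * (-p).im),
      MemLp (fun s : ℝ => ((s : ℂ) - p)⁻¹) 2 volume := by
    intro σ hσ hz
    have h2 := kcE_two σ hσ _ hz
    have h := kc_compat _ (kcE_integrable σ hσ _ hz).1 h2
    have h3 := ((memLp_congr_ae h).1 (Lp.memLp _)).const_mul (-(2 * Real.pi * I))
    convert h3 using 2 with s
    rw [kcE_inv σ hσ _ hz]
    have := kc_ne p hp s
    have : (Real.pi : ℂ) ≠ 0 := by exact_mod_cast Real.pi_ne_zero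
    rw [← sub_eq_add_neg]
    field_simp
  rcases lt_or_gt_of_ne hp with h | h
  · exact key 1 (.inl rfl) (by simpa using h)
  · exact key (-1) (.inr rfl) (by simpa using h)

lemma kc_rank (p : ℂ) (hp : p.im ≠ 0) (hu : MemLp (fun s : ℝ => ((s : ℂ) - p)⁻¹) ∞ volume)
    (f : L2C) : kcH _ hu f = (-cauchyE (kcC 1 (.inl rfl) f) p) • (kc_res_two p hp).toLp _ := by
  set a := kcC 1 (.inl rfl) f with ha
  have hz0 := kc_zero f
  rw [← ha] at hz0
  have hc : ∀ z : ℂ, z.im < 0 → z ≠ p →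
      cauchyE (fun s : ℝ => ((s : ℂ) - p)⁻¹ * a s) z = cauchyE a p * (p - z)⁻¹ := by
    intro z hz hzp
    have i1 : Integrable fun s : ℝ => a s / ((s : ℂ) - p) := by
      simp_rw [div_eq_mul_inv]
      exact (Lp.memLp a).integrable_mul (kc_res_two p hp)
    have i2 : Integrable fun s : ℝ => a s / ((s : ℂ) - z) := by
      simp_rw [div_eq_mul_inv]
      exact (Lp.memLp a).integrable_mul (kc_res_two z hz.ne)
    have e1 : cauchyE (fun s : ℝ => ((s : ℂ) - p)⁻¹ * a s) z =
        (cauchyE a p - cauchyE a z) * (p - z)⁻¹ := by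
      unfold cauchyE
      rw [← mul_sub, ← integral_sub i1 i2, mul_assoc (2 * (Real.pi : ℂ) * I)⁻¹, ← integral_mul_const]
      congr 2; ext s
      have h1 := kc_ne p hp s
      have h2 := kc_ne z hz.ne s
      have h3 : p - z ≠ 0 := sub_ne_zero.2 hzp.symm
      field_simp
      ring
    rw [e1, hz0 z hz, sub_zero]
  apply Lp.ext
  refine (kc_ident (-1) (.inr rfl) (kcMul _ hu a) _ (fun x : ℝ => cauchyE a p * (p - x)⁻¹)
    (kcMul_coe _ hu a) ?_).trans ?_
  · refine .of_forall fun x => ?_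
    have hev : ∀ᶠ ε : ℝ in 𝓝[>] 0, ε < |p.im| ∧ 0 < ε := by
      have := Ioo_mem_nhdsGT (abs_pos.2 hp)
      filter_upwards [this] with ε h
      exact ⟨h.2, h.1⟩
    have hl : Tendsto (fun ε : ℝ => cauchyE a p * (p - (x + (-1 : ℝ) * ε * I))⁻¹) (𝓝[>] 0)
        (𝓝 (cauchyE a p * (p - x)⁻¹)) := by
      have hcont : ContinuousAt (fun ε : ℝ => cauchyE a p * (p - (x + (-1 : ℝ) * ε * I))⁻¹) 0 := by
        refine ContinuousAt.mul continuousAt_const (ContinuousAt.inv₀ (by fun_prop) ?_)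
        have := kc_ne p hp x
        simpa [sub_eq_zero, eq_comm] using this
      have := hcont.tendsto.mono_left (nhdsWithin_le_nhds (s := Set.Ioi 0))
      simpa using this
    refine hl.congr' ?_
    filter_upwards [hev] with ε hε
    rw [hc]
    · simpa using hε.2
    · intro h
      have := congrArg Complex.im h
      simp at this
      rw [← this, abs_neg, abs_of_pos hε.2] at hε
      linarith [hε.1]
  · filter_upwards [Lp.coeFn_smul (-cauchyE a p) ((kc_res_two p hp).toLp _),
      (kc_res_two p hp).coeFn_toLp] with x h1 h2
    rw [h1, Pi.smul_apply, h2, smul_eq_mul, neg_mul, ← mul_neg, ← inv_neg, neg_sub]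

lemma kc_compact_of_rank (T : L2C →L[ℂ] L2C) (g : L2C) (h : ∀ f, ∃ c : ℂ, T f = c • g) :
    IsCompactOperator T := by
  have hm : ∀ f, T f ∈ Submodule.span ℂ {g} := fun f => by
    obtain ⟨c, hc⟩ := h f
    rw [hc]; exact Submodule.smul_mem _ _ (Submodule.mem_span_singleton_self g)
  have : ProperSpace (Submodule.span ℂ {g}) := FiniteDimensional.proper ℂ _
  have h1 := isCompactOperator_of_locallyCompactSpace_dom (T.codRestrict _ hm)
  exact h1.clm_comp (Submodule.subtypeL _)

lemma kc_cm_top (u : C(OnePoint ℝ, ℂ)) : MemLp (fun s : ℝ => u (s : OnePoint ℝ)) ∞ volume :=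
  memLp_top_of_bound (u.continuous.comp OnePoint.continuous_coe).aestronglyMeasurable ‖u‖
    (.of_forall fun _ => u.norm_coe_le_norm _)

noncomputable def kcPhi : C(OnePoint ℝ, ℂ) →ₗ[ℂ] (L2C →L[ℂ] L2C) where
  toFun u := kcMul _ (kc_cm_top u)
  map_add' u v := by
    ext1 f
    apply Lp.ext
    rw [_root_.add_apply]
    filter_upwards [kcMul_coe _ (kc_cm_top (u + v)) f, kcMul_coe _ (kc_cm_top u) f,
      kcMul_coe _ (kc_cm_top v) f, Lp.coeFn_add (kcMul _ (kc_cm_top u) f)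
      (kcMul _ (kc_cm_top v) f)] with x h1 h2 h3 h4
    rw [h1, h4, Pi.add_apply, h2, h3, ContinuousMap.add_apply, add_mul]
  map_smul' c u := by
    ext1 f
    apply Lp.ext
    rw [RingHom.id_apply, _root_.smul_apply]
    filter_upwards [kcMul_coe _ (kc_cm_top (c • u)) f, kcMul_coe _ (kc_cm_top u) f,
      Lp.coeFn_smul c (kcMul _ (kc_cm_top u) f)] with x h1 h2 h4
    rw [h1, h4, Pi.smul_apply, h2, ContinuousMap.smul_apply, smul_eq_mul, smul_eq_mul, mul_assoc]

lemma kcPhi_cont : Continuous kcPhi :=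
  AddMonoidHomClass.continuous_of_bound kcPhi 1 fun u => by
    rw [one_mul]
    exact kcMul_norm _ (kc_cm_top u) ‖u‖ (norm_nonneg _) fun s => u.norm_coe_le_norm _

lemma kcPhi_mul (u v : C(OnePoint ℝ, ℂ)) : kcPhi (u * v) = kcPhi u ∘L kcPhi v := by
  ext1 f
  apply Lp.ext
  filter_upwards [kcMul_coe _ (kc_cm_top (u * v)) f, kcMul_coe _ (kc_cm_top u) (kcPhi v f),
      kcMul_coe _ (kc_cm_top v) f] with x h1 h2 h3
  refine h1.trans (Eq.trans ?_ h2.symm)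
  rw [show (kcPhi v f) x = _ from h3, ContinuousMap.mul_apply, mul_assoc]

lemma kcPhi_one : kcPhi 1 = ContinuousLinearMap.id ℂ L2C := by
  ext1 f
  apply Lp.ext
  filter_upwards [kcMul_coe _ (kc_cm_top 1) f] with x h1
  refine h1.trans ?_
  simp

noncomputable def kcPsi (u : C(OnePoint ℝ, ℂ)) : L2C →L[ℂ] L2C :=
  kcC (-1) (.inr rfl) ∘L kcPhi u ∘L kcC 1 (.inl rfl)

lemma kcPsi_one : kcPsi 1 = 0 := by
  ext1 f
  have : ∀ g, kcC (-1) (.inr rfl) (kcC 1 (.inl rfl) g) = 0 := by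
    intro g
    apply Lp.ext
    refine (kc_ident (-1) (.inr rfl) (kcC 1 (.inl rfl) g) _ (fun _ => 0) ae_eq_rfl ?_).trans
      (Lp.coeFn_zero _ _ _).symm
    refine .of_forall fun x => ?_
    refine tendsto_const_nhds.congr' ?_
    filter_upwards [self_mem_nhdsWithin] with ε hε
    rw [kc_zero]
    simpa using hε
  simp [kcPsi, kcPhi_one, this]

noncomputable def kcAlg : Subalgebra ℂ C(OnePoint ℝ, ℂ) where
  carrier := {u | IsCompactOperator (kcPsi u)}
  mul_mem' := by
    intro u v hu hv
    have : kcPsi (u * v) = kcPsi u ∘L (kcPhi v ∘L kcC 1 (.inl rfl)) -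
        (kcC (-1) (.inr rfl) ∘L kcPhi u) ∘L kcPsi v := by
      ext1 f
      have := kc_sum (kcPhi v (kcC 1 (.inl rfl) f))
      simp only [kcPsi, kcPhi_mul, ContinuousLinearMap.comp_apply, _root_.sub_apply]
      rw [← map_sub, ← map_sub, this]
    simp only [Set.mem_ofPred_eq] at hu hv ⊢
    rw [this]
    exact (hu.comp_clm _).sub (hv.clm_comp (kcC (-1) (.inr rfl) ∘L kcPhi u))
  add_mem' := by
    intro u v hu hv
    have : kcPsi (u + v) = kcPsi u + kcPsi v := by
      ext1 f; simp [kcPsi]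
    simp only [Set.mem_ofPred_eq] at hu hv ⊢
    rw [this]; exact hu.add hv
  algebraMap_mem' := by
    intro c
    have : kcPsi (algebraMap ℂ _ c) = 0 := by
      rw [Algebra.algebraMap_eq_smul_one]
      have : kcPsi (c • 1) = c • kcPsi 1 := by ext1 f; simp [kcPsi]
      rw [this, kcPsi_one, smul_zero]
    simp only [Set.mem_ofPred_eq]
    rw [this]; exact isCompactOperator_zero

lemma kcAlg_closed : IsClosed (kcAlg : Set C(OnePoint ℝ, ℂ)) := by
  have hc : Continuous kcPsi :=
    continuous_const.clm_comp (kcPhi_cont.clm_comp continuous_const)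
  exact isClosed_setOfPred_isCompactOperator.preimage hc

lemma kc_res_tendsto (p : ℂ) : Tendsto (fun s : ℝ => ((s : ℂ) - p)⁻¹) (cocompact ℝ) (𝓝 0) := by
  apply tendsto_inv₀_cobounded.comp
  rw [← Metric.cobounded_eq_cocompact]
  have h : Tendsto (fun s : ℝ => (s : ℂ)) (Bornology.cobounded ℝ) (Bornology.cobounded ℂ) := by
    rw [← tendsto_norm_atTop_iff_cobounded]
    refine (tendsto_norm_cobounded_atTop (E := ℝ)).congr fun s => ?_
    exact (Complex.norm_real s).symm
  rw [← tendsto_norm_atTop_iff_cobounded] at h ⊢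
  refine tendsto_atTop_mono (fun s => norm_sub_norm_le (s : ℂ) p) ?_
  exact tendsto_atTop_add_const_right _ _ h

noncomputable def kcR (p : ℂ) (hp : p.im ≠ 0) : C(OnePoint ℝ, ℂ) :=
  OnePoint.continuousMapMk ⟨fun s : ℝ => ((s : ℂ) - p)⁻¹,
    (by fun_prop : Continuous fun s : ℝ => ((s : ℂ) - p)).inv₀ (kc_ne p hp)⟩ 0
    (by rw [coclosedCompact_eq_cocompact]; exact kc_res_tendsto p)

lemma kcR_coe (p : ℂ) (hp : p.im ≠ 0) (s : ℝ) : kcR p hp (s : OnePoint ℝ) = ((s : ℂ) - p)⁻¹ := rfl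
lemma kcR_infty (p : ℂ) (hp : p.im ≠ 0) : kcR p hp (OnePoint.infty) = 0 := rfl

lemma kcR_mem (p : ℂ) (hp : p.im ≠ 0) : kcR p hp ∈ kcAlg :=
  kc_compact_of_rank _ _ fun f => ⟨_, kc_rank p hp (kc_cm_top (kcR p hp)) f⟩

lemma kc_hI : (I : ℂ).im ≠ 0 := by simp
lemma kc_hI' : (-I : ℂ).im ≠ 0 := by simp

lemma kcR_star : star (kcR I kc_hI) = kcR (-I) kc_hI' := by
  ext x
  induction x using OnePoint.rec with
  | infty => simp [kcR_infty]
  | coe s => simp [kcR_coe]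

lemma kcR_inj (x y : OnePoint ℝ) (h : kcR I kc_hI x = kcR I kc_hI y) : x = y := by
  induction x using OnePoint.rec with
  | infty =>
    induction y using OnePoint.rec with
    | infty => rfl
    | coe t =>
      rw [kcR_infty, kcR_coe] at h
      exact absurd h.symm (inv_ne_zero (kc_ne I kc_hI t))
  | coe s =>
    induction y using OnePoint.rec with
    | infty =>
      rw [kcR_infty, kcR_coe] at h
      exact absurd h (inv_ne_zero (kc_ne I kc_hI s))
    | coe t =>
      rw [kcR_coe, kcR_coe, inv_inj, sub_left_inj] at h
      rw [Complex.ofReal_inj.1 h]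

lemma kc_all (u : C(OnePoint ℝ, ℂ)) : IsCompactOperator (kcPsi u) := by
  have hle : (StarAlgebra.adjoin ℂ {kcR I kc_hI}).toSubalgebra ≤ kcAlg := by
    rw [StarAlgebra.adjoin_toSubalgebra]
    apply Algebra.adjoin_le
    rintro x (hx | hx)
    · rw [Set.mem_singleton_iff.1 hx]; exact kcR_mem _ _
    · have : x = star (kcR I kc_hI) := by
        rw [Set.mem_star, Set.mem_singleton_iff] at hx
        rw [← hx, star_star]
      rw [this, kcR_star]; exact kcR_mem _ _
  have htop := ContinuousMap.starSubalgebra_topologicalClosure_eq_top_of_separatesPoints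
    (StarAlgebra.adjoin ℂ {kcR I kc_hI}) (by
      intro x y hxy
      refine ⟨_, ⟨kcR I kc_hI, StarAlgebra.self_mem_adjoin_singleton ℂ _, rfl⟩, ?_⟩
      exact fun h => hxy (kcR_inj x y h))
  have hu : u ∈ (StarAlgebra.adjoin ℂ {kcR I kc_hI}).topologicalClosure := by
    rw [htop]; trivial
  have hu' : u ∈ closure ((StarAlgebra.adjoin ℂ {kcR I kc_hI} : StarSubalgebra ℂ _) :
    Set C(OnePoint ℝ, ℂ)) := hu
  exact closure_minimal (fun x hx => hle hx) kcAlg_closed hu'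

lemma kc_hankel (u : ℝ → ℂ) (hc : Continuous u) (h0 : Tendsto u (cocompact ℝ) (𝓝 0))
    (hu : MemLp u ∞ volume) : IsCompactOperator (kcH u hu) :=
  kc_all (OnePoint.continuousMapMk ⟨u, hc⟩ 0 (by rw [coclosedCompact_eq_cocompact]; exact h0))

lemma kc_bdd (u : ℝ → ℂ) (hc : Continuous u) (h0 : Tendsto u (cocompact ℝ) (𝓝 0)) :
    MemLp u ∞ volume :=
  kc_cm_top (OnePoint.continuousMapMk ⟨u, hc⟩ 0 (by rw [coclosedCompact_eq_cocompact]; exact h0))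

end kc

section kcfin
variable {n : ℕ}

noncomputable def kcEntry (i j : Fin n) : Matrix (Fin n) (Fin n) ℂ →L[ℂ] ℂ :=
  LinearMap.toContinuousLinearMap (Matrix.entryLinearMap ℂ ℂ i j)

lemma kcEntry_apply (i j : Fin n) (m : Matrix (Fin n) (Fin n) ℂ) : kcEntry i j m = m i j := rfl

noncomputable def kcSingle (i j : Fin n) : ℂ →L[ℂ] Matrix (Fin n) (Fin n) ℂ :=
  LinearMap.toContinuousLinearMap (Matrix.singleLinearMap ℂ i j)

lemma kcSingle_apply (i j : Fin n) (c : ℂ) : kcSingle i j c = Matrix.single i j c := rfl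

noncomputable abbrev L2M (n : ℕ) := Lp (Matrix (Fin n) (Fin n) ℂ) 2 (volume : Measure ℝ)

noncomputable def kcPi (i j : Fin n) : L2M n →L[ℂ] L2C := (kcEntry i j).compLpL 2 volume
noncomputable def kcIn (i j : Fin n) : L2C →L[ℂ] L2M n := (kcSingle i j).compLpL 2 volume

lemma kcPi_coe (i j : Fin n) (h : L2M n) : kcPi i j h =ᵐ[volume] fun s => h s i j :=
  (kcEntry i j).coeFn_compLpL h

lemma kc_sum_coe {ι : Type*} (s : Finset ι) (f : ι → L2C) :
    (∑ k ∈ s, f k : L2C) =ᵐ[volume] fun x => ∑ k ∈ s, f k x := by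
  have := Lp.coeFn_finsetSum s f
  filter_upwards [this] with x hx
  rw [hx]; simp

lemma kc_decomp (h : L2M n) : ∑ i, ∑ j, kcIn i j (kcPi i j h) = h := by
  apply Lp.ext
  have h1 : ∀ᵐ x : ℝ, ∀ i j, kcIn i j (kcPi i j h) x = Matrix.single i j (h x i j) := by
    rw [ae_all_iff]; intro i
    rw [ae_all_iff]; intro j
    filter_upwards [(kcSingle i j).coeFn_compLpL (p := 2) (kcPi i j h), kcPi_coe i j h] with x a b
    rw [← b]; exact a
  have h2 : ∀ᵐ x : ℝ, ∀ i, (∑ j, kcIn i j (kcPi i j h) : L2M n) x =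
      ∑ j, kcIn i j (kcPi i j h) x := by
    rw [ae_all_iff]; intro i
    filter_upwards [Lp.coeFn_finsetSum Finset.univ fun j => kcIn i j (kcPi i j h)] with x hx
    rw [hx]; simp
  filter_upwards [Lp.coeFn_finsetSum Finset.univ fun i => ∑ j, kcIn i j (kcPi i j h), h1, h2]
    with x a b c
  rw [a]
  simp only [Finset.sum_apply, b, c]
  exact (Matrix.matrix_eq_sum_single (h x)).symm

lemma kc_compact_sum {E F : Type*} [NormedAddCommGroup E] [NormedSpace ℂ E]
    [NormedAddCommGroup F] [NormedSpace ℂ F] {ι : Type*} (s : Finset ι) (T : ι → E →L[ℂ] F)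
    (h : ∀ i, IsCompactOperator (T i)) : IsCompactOperator (∑ i ∈ s, T i : E →L[ℂ] F) := by
  classical
  induction s using Finset.induction_on with
  | empty => simpa using isCompactOperator_zero
  | insert a s ha ih => rw [Finset.sum_insert ha]; exact (h a).add ih

lemma kc_entry_le (m : Matrix (Fin n) (Fin n) ℂ) (i j : Fin n) : ‖m i j‖ ≤ ‖m‖ := by
  rw [Matrix.frobenius_norm_def]
  have h0 : ∀ a b, 0 ≤ ‖m a b‖ ^ (2 : ℝ) := fun a b => by positivity
  have h1 : ‖m i j‖ ^ (2 : ℝ) ≤ ∑ a, ∑ b, ‖m a b‖ ^ (2 : ℝ) :=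
    (Finset.single_le_sum (f := fun b => ‖m i b‖ ^ (2 : ℝ)) (fun b _ => h0 i b)
      (Finset.mem_univ j)).trans
    (Finset.single_le_sum (f := fun a => ∑ b, ‖m a b‖ ^ (2 : ℝ))
      (fun a _ => Finset.sum_nonneg fun b _ => h0 a b) (Finset.mem_univ i))
  have h2 := Real.rpow_le_rpow (h0 i j) h1 (by norm_num : (0 : ℝ) ≤ 1 / 2)
  rw [← Real.rpow_mul (norm_nonneg _)] at h2
  norm_num at h2
  norm_num
  exact h2

lemma kc_main
    (v : ℝ → Matrix (Fin n) (Fin n) ℂ)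
    (hvcont : Continuous v) (hvu : ∀ z, IsUnit (v z))
    (hvlim : Tendsto v (Filter.cocompact ℝ) (𝓝 1))
    (hvinv : ∃ C : ℝ, ∀ z, ‖(v z)⁻¹‖ ≤ C)
    (K : L2M n →L[ℂ] L2M n)
    (hK : ∀ h : L2M n,
      ∃ a : ℝ → Matrix (Fin n) (Fin n) ℂ,
        (∀ᵐ z : ℝ, ∀ i j,
          Tendsto (fun ε : ℝ =>
              cauchyM (fun s => h s * ((v s)⁻¹ - 1)) ((z : ℂ) + ε * Complex.I) i j)
            (𝓝[>] 0) (𝓝 (a z i j))) ∧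
        ∀ᵐ z : ℝ, ∀ i j,
          Tendsto (fun ε : ℝ =>
              cauchyM (fun s => a s * (v s - 1)) ((z : ℂ) - ε * Complex.I) i j)
            (𝓝[>] 0) (𝓝 (K h z i j))) :
    IsCompactOperator K := by
  have huc : ∀ k j, Continuous fun s => (v s - 1) k j := fun k j =>
    (kcEntry k j).continuous.comp (hvcont.sub continuous_const)
  have hul : ∀ k j, Tendsto (fun s => (v s - 1) k j) (cocompact ℝ) (𝓝 0) := by
    intro k j
    have h1 : Tendsto (fun s => v s - 1) (cocompact ℝ) (𝓝 0) := by
      simpa using hvlim.sub_const 1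
    have h2 := ((kcEntry k j).continuous.tendsto 0).comp h1
    rw [map_zero] at h2
    exact h2
  have hub : ∀ k j, MemLp (fun s => (v s - 1) k j) ⊤ volume := fun k j =>
    kc_bdd _ (huc k j) (hul k j)
  have hwc : ∀ l k, Continuous fun s => ((v s)⁻¹ - 1) l k := by
    intro l k
    have h1 : Continuous fun s => (v s)⁻¹ := by
      simp_rw [Matrix.inv_def, Ring.inverse_eq_inv']
      refine Continuous.smul (Continuous.inv₀ hvcont.matrix_det fun s => ?_) hvcont.matrix_adjugate
      exact ((Matrix.isUnit_iff_isUnit_det _).1 (hvu s)).ne_zero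
    exact (kcEntry l k).continuous.comp (h1.sub continuous_const)
  obtain ⟨C, hC⟩ := hvinv
  have hwb : ∀ l k, MemLp (fun s => ((v s)⁻¹ - 1) l k) ⊤ volume := by
    intro l k
    refine memLp_top_of_bound (hwc l k).aestronglyMeasurable
      (C + ‖(1 : Matrix (Fin n) (Fin n) ℂ)‖) (.of_forall fun s => ?_)
    exact (kc_entry_le _ l k).trans ((norm_sub_le _ _).trans (add_le_add (hC s) le_rfl))
  have key : ∀ i j h, kcPi i j (K h) = ∑ k, kcH _ (hub k j) (∑ l, kcMul _ (hwb l k) (kcPi i l h)) := by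
    intro i j h
    obtain ⟨a, ha1, ha2⟩ := hK h
    have hA : ∀ k, kcC 1 (.inl rfl) (∑ l, kcMul _ (hwb l k) (kcPi i l h)) =ᵐ[volume]
        fun x => a x i k := by
      intro k
      apply kc_ident 1 (.inl rfl) _ (fun s => (h s * ((v s)⁻¹ - 1)) i k)
      · have h1 : ∀ᵐ s : ℝ, ∀ l, kcMul _ (hwb l k) (kcPi i l h) s =
            h s i l * ((v s)⁻¹ - 1) l k := by
          rw [ae_all_iff]; intro l
          filter_upwards [kcMul_coe _ (hwb l k) (kcPi i l h), kcPi_coe i l h] with s e1 e2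
          rw [e1, e2, mul_comm]
        filter_upwards [h1, kc_sum_coe Finset.univ fun l => kcMul _ (hwb l k) (kcPi i l h)]
          with s e1 e2
        rw [e2, Matrix.mul_apply]
        exact Finset.sum_congr rfl fun l _ => e1 l
      · filter_upwards [ha1] with x hx
        simpa [cauchyM] using hx i k
    have hsum : ∑ k, kcH _ (hub k j) (∑ l, kcMul _ (hwb l k) (kcPi i l h)) =
        kcC (-1) (.inr rfl) (∑ k, kcMul _ (hub k j)
          (kcC 1 (.inl rfl) (∑ l, kcMul _ (hwb l k) (kcPi i l h)))) := by
      rw [map_sum]; rfl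
    rw [hsum]
    apply Lp.ext
    refine (kcPi_coe i j (K h)).trans (Filter.EventuallyEq.symm ?_)
    apply kc_ident (-1) (.inr rfl) _ (fun s => (a s * (v s - 1)) i j)
    · have h1 : ∀ᵐ s : ℝ, ∀ k, kcMul _ (hub k j)
          (kcC 1 (.inl rfl) (∑ l, kcMul _ (hwb l k) (kcPi i l h))) s =
            a s i k * (v s - 1) k j := by
        rw [ae_all_iff]; intro k
        filter_upwards [kcMul_coe _ (hub k j)
          (kcC 1 (.inl rfl) (∑ l, kcMul _ (hwb l k) (kcPi i l h))), hA k] with s e1 e2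
        rw [e1, e2, mul_comm]
      filter_upwards [h1, kc_sum_coe Finset.univ fun k => kcMul _ (hub k j)
          (kcC 1 (.inl rfl) (∑ l, kcMul _ (hwb l k) (kcPi i l h)))] with s e1 e2
      rw [e2, Matrix.mul_apply]
      exact Finset.sum_congr rfl fun l _ => e1 l
    · filter_upwards [ha2] with x hx
      simpa [cauchyM, sub_eq_add_neg] using hx i j
  have hcomp : ∀ i j, IsCompactOperator (kcPi i j ∘L K) := by
    intro i j
    have : kcPi i j ∘L K =
        ∑ k, kcH _ (hub k j) ∘L (∑ l, kcMul _ (hwb l k) ∘L kcPi i l) := by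
      ext1 h
      have := key i j h
      simpa [sum_apply] using this
    rw [this]
    exact kc_compact_sum _ _ fun k => (kc_hankel _ (huc k j) (hul k j) (hub k j)).comp_clm _
  have : K = ∑ i, ∑ j, kcIn i j ∘L (kcPi i j ∘L K) := by
    ext1 h
    have := (kc_decomp (K h)).symm
    simpa [sum_apply] using this
  rw [this]
  exact kc_compact_sum _ _ fun i => kc_compact_sum _ _ fun j => (hcomp i j).clm_comp (kcIn i j)

end kcfin

/-- If `v : ℝ → GL(n,ℂ)` is continuous with `v(z) → I` as `|z| → ∞` and `v⁻¹` bounded,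
then the operator `K h = C^-[(C^+(h(v⁻¹-I)))(v-I)]` on `L²(ℝ; n×n matrices)` is compact.
Here `C^±` are realized through a.e. vertical boundary limits of Cauchy transforms. -/
theorem Khat_compact {n : ℕ} (hn : 1 ≤ n)
    (v : ℝ → Matrix (Fin n) (Fin n) ℂ)
    (hvcont : Continuous v) (hvu : ∀ z, IsUnit (v z))
    (hvlim : Tendsto v (Filter.cocompact ℝ) (𝓝 1))
    (hvinv : ∃ C : ℝ, ∀ z, ‖(v z)⁻¹‖ ≤ C)
    (K : Lp (Matrix (Fin n) (Fin n) ℂ) 2 (volume : Measure ℝ) →L[ℂ]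
      Lp (Matrix (Fin n) (Fin n) ℂ) 2 (volume : Measure ℝ))
    (hK : ∀ h : Lp (Matrix (Fin n) (Fin n) ℂ) 2 (volume : Measure ℝ),
      ∃ a : ℝ → Matrix (Fin n) (Fin n) ℂ,
        (∀ᵐ z : ℝ, ∀ i j,
          Tendsto (fun ε : ℝ =>
              cauchyM (fun s => h s * ((v s)⁻¹ - 1)) ((z : ℂ) + ε * Complex.I) i j)
            (𝓝[>] 0) (𝓝 (a z i j))) ∧
        ∀ᵐ z : ℝ, ∀ i j,
          Tendsto (fun ε : ℝ =>
              cauchyM (fun s => a s * (v s - 1)) ((z : ℂ) - ε * Complex.I) i j)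
            (𝓝[>] 0) (𝓝 (K h z i j))) :
    IsCompactOperator K := by
  exact kc_main v hvcont hvu hvlim hvinv K hK
end
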